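/- For every T > 0 and M > 0 there exists a constant C = C(M,T) > 0 with the following property: if u, v : (−T,T) × ℝ → ℝ³ are smooth maps, 2π-periodic in the second variable, with |u(t,s)| = |v(t,s)| = 1 everywhere, both solving the Schrödinger map equation ∂ₜu = ∂ₛ(u × ∂ₛu) and ∂ₜv = ∂ₛ(v × ∂ₛv), and if (∫₀^{2π} |∂ₛₛₛu(0,s)|² ds)^{1/2} ≤ M, then there exists a continuous function σ : (−T,T) → ℝ such that for every t ∈ (−T,T), (∫₀^{2π} |v(t,s) − u(t, s + σ(t))|² ds)^{1/2} ≤ C · (∫₀^{2π} |v(0,s) − u(0,s)|² ds)^{1/2}. -/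

import Mathlib

noncomputable section
open Real MeasureTheory

/-- `ℝ³` as Euclidean space. -/
abbrev R3 : Type := EuclideanSpace ℝ (Fin 3)

/-- Pack three real numbers into a vector of `ℝ³`. -/
def toE (v : Fin 3 → ℝ) : R3 := (EuclideanSpace.equiv (Fin 3) ℝ).symm v

/-- The cross product on `ℝ³`. -/
def cross3 (a b : R3) : R3 :=
  toE ![a 1 * b 2 - a 2 * b 1, a 2 * b 0 - a 0 * b 2, a 0 * b 1 - a 1 * b 0]

/-! ### Vector algebra -/

lemma cross3_0 (a b : R3) : cross3 a b 0 = a 1 * b 2 - a 2 * b 1 := rfl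
lemma cross3_1 (a b : R3) : cross3 a b 1 = a 2 * b 0 - a 0 * b 2 := rfl
lemma cross3_2 (a b : R3) : cross3 a b 2 = a 0 * b 1 - a 1 * b 0 := rfl

/-- dot product in coordinates -/
def dot (a b : R3) : ℝ := a 0 * b 0 + a 1 * b 1 + a 2 * b 2

lemma dot_eq_inner (a b : R3) : dot a b = inner ℝ a b := by
  simp [dot, PiLp.inner_apply, Fin.sum_univ_three, mul_comm]

lemma dot_self (a : R3) : dot a a = ‖a‖ ^ 2 := by
  rw [dot_eq_inner, real_inner_self_eq_norm_sq]

lemma abs_dot_le (a b : R3) : |dot a b| ≤ ‖a‖ * ‖b‖ := by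
  rw [dot_eq_inner]; exact abs_real_inner_le_norm a b

lemma norm_cross3_le (a b : R3) : ‖cross3 a b‖ ≤ ‖a‖ * ‖b‖ := by
  apply le_of_sq_le_sq _ (by positivity)
  rw [mul_pow, ← dot_self, ← dot_self, ← dot_self]
  have : 0 ≤ (dot a b) ^ 2 := sq_nonneg _
  have h : dot (cross3 a b) (cross3 a b) = dot a a * dot b b - (dot a b) ^ 2 := by
    simp only [dot, cross3_0, cross3_1, cross3_2]; ring
  linarith

/-- triple product -/
def det3 (a b c : R3) : ℝ := dot a (cross3 b c)

lemma abs_det3_le (a b c : R3) : |det3 a b c| ≤ ‖a‖ * ‖b‖ * ‖c‖ := by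
  unfold det3
  calc _ ≤ ‖a‖ * ‖cross3 b c‖ := abs_dot_le _ _
    _ ≤ ‖a‖ * (‖b‖ * ‖c‖) := by gcongr; exact norm_cross3_le _ _
    _ = _ := by ring

lemma ext3 {a b : R3} (h0 : a 0 = b 0) (h1 : a 1 = b 1) (h2 : a 2 = b 2) : a = b := by
  ext i; fin_cases i <;> assumption

lemma cross3_self (a : R3) : cross3 a a = 0 := by
  apply ext3 <;> simp [cross3_0, cross3_1, cross3_2, mul_comm]

/-- the cross product as a continuous bilinear map -/
def crossL : R3 →L[ℝ] R3 →L[ℝ] R3 :=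
  LinearMap.mkContinuous₂ (LinearMap.mk₂ ℝ cross3
    (by intro a b c; apply ext3 <;> simp [cross3_0, cross3_1, cross3_2] <;> ring)
    (by intro a b c; apply ext3 <;> simp [cross3_0, cross3_1, cross3_2] <;> ring)
    (by intro a b c; apply ext3 <;> simp [cross3_0, cross3_1, cross3_2] <;> ring)
    (by intro a b c; apply ext3 <;> simp [cross3_0, cross3_1, cross3_2] <;> ring)) 1
    (by intro a b; simpa using norm_cross3_le a b)

lemma crossL_apply (a b : R3) : crossL a b = cross3 a b := rfl

lemma HasDerivAt.cross3' {f g : ℝ → R3} {f' g' : R3} {x : ℝ} (hf : HasDerivAt f f' x)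
    (hg : HasDerivAt g g' x) :
    HasDerivAt (fun t => cross3 (f t) (g t)) (cross3 f' (g x) + cross3 (f x) g') x := by
  have := crossL.hasDerivAt_of_bilinear (fun _ => hf) (fun _ => hg)
  simpa [crossL_apply, add_comm] using this

lemma HasDerivAt.coord {f : ℝ → R3} {f' : R3} {x : ℝ} (hf : HasDerivAt f f' x) (i : Fin 3) :
    HasDerivAt (fun t => f t i) (f' i) x :=
  (EuclideanSpace.proj (𝕜 := ℝ) i : R3 →L[ℝ] ℝ).hasFDerivAt.comp_hasDerivAt x hf

lemma HasDerivAt.dot' {f g : ℝ → R3} {f' g' : R3} {x : ℝ} (hf : HasDerivAt f f' x)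
    (hg : HasDerivAt g g' x) :
    HasDerivAt (fun t => dot (f t) (g t)) (dot f' (g x) + dot (f x) g') x := by
  simp only [dot_eq_inner]
  rw [add_comm]
  exact hf.inner ℝ hg

lemma HasDerivAt.det3' {f g h : ℝ → R3} {f' g' h' : R3} {x : ℝ} (hf : HasDerivAt f f' x)
    (hg : HasDerivAt g g' x) (hh : HasDerivAt h h' x) :
    HasDerivAt (fun t => det3 (f t) (g t) (h t))
      (det3 f' (g x) (h x) + det3 (f x) g' (h x) + det3 (f x) (g x) h') x := by
  have := hf.dot' (hg.cross3' hh)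
  simp only [det3]
  convert this using 1
  simp [dot]; ring

section cont
variable {X : Type*} [TopologicalSpace X] {S : Set X} {f g h : X → R3}

lemma ContinuousOn.cross3' (hf : ContinuousOn f S) (hg : ContinuousOn g S) :
    ContinuousOn (fun x => cross3 (f x) (g x)) S := by
  have : ContinuousOn (fun x => crossL (f x) (g x)) S := by fun_prop
  exact this

lemma ContinuousOn.dot' (hf : ContinuousOn f S) (hg : ContinuousOn g S) :
    ContinuousOn (fun x => dot (f x) (g x)) S := by
  simp only [dot_eq_inner]; exact hf.inner hg

lemma ContinuousOn.det3' (hf : ContinuousOn f S) (hg : ContinuousOn g S) (hh : ContinuousOn h S) :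
    ContinuousOn (fun x => det3 (f x) (g x) (h x)) S :=
  hf.dot' (hg.cross3' hh)

end cont

lemma ContDiffOn.cross3' {E : Type*} [NormedAddCommGroup E] [NormedSpace ℝ E] {S : Set E}
    {f g : E → R3} {n : WithTop ℕ∞} (hf : ContDiffOn ℝ n f S) (hg : ContDiffOn ℝ n g S) :
    ContDiffOn ℝ n (fun x => cross3 (f x) (g x)) S :=
  crossL.isBoundedBilinearMap.contDiff.comp_contDiffOn (hf.prodMk hg)

/-! ### One-variable tools -/

lemma hasDerivAt_intParam {φ φt : ℝ → ℝ → ℝ} {I : Set ℝ} (hI : IsOpen I)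
    (hφ : ∀ t ∈ I, ∀ s, HasDerivAt (fun τ => φ τ s) (φt t s) t)
    (hc : ContinuousOn (fun p : ℝ × ℝ => φ p.1 p.2) (I ×ˢ Set.univ))
    (hct : ContinuousOn (fun p : ℝ × ℝ => φt p.1 p.2) (I ×ˢ Set.univ)) {t : ℝ} (ht : t ∈ I) :
    HasDerivAt (fun t => ∫ s in (0:ℝ)..2 * π, φ t s) (∫ s in (0:ℝ)..2 * π, φt t s) t := by
  obtain ⟨r, hr, hrI⟩ := Metric.isOpen_iff.1 hI t ht
  have hsub : Metric.closedBall t (r / 2) ⊆ I :=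
    (Metric.closedBall_subset_ball (by linarith)).trans hrI
  have hcomp : IsCompact (Metric.closedBall t (r / 2) ×ˢ Set.Icc (0:ℝ) (2 * π)) :=
    (isCompact_closedBall _ _).prod isCompact_Icc
  obtain ⟨B, hB⟩ := hcomp.exists_bound_of_continuousOn
    (hct.mono (Set.prod_mono hsub (Set.subset_univ _)))
  have hslice : ∀ ψ : ℝ → ℝ → ℝ, ContinuousOn (fun p : ℝ × ℝ => ψ p.1 p.2) (I ×ˢ Set.univ) →
      ∀ τ ∈ I, Continuous (ψ τ) := by
    intro ψ hψ τ hτ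
    rw [← continuousOn_univ]
    exact hψ.comp (f := fun s => (τ, s)) (by fun_prop) (fun s _ => ⟨hτ, trivial⟩)
  have := intervalIntegral.hasDerivAt_integral_of_dominated_loc_of_deriv_le (μ := volume)
    (F := φ) (F' := φt) (x₀ := t) (s := Metric.ball t (r / 2)) (a := 0) (b := 2 * π)
    (bound := fun _ => B) (Metric.ball_mem_nhds _ (by linarith)) ?_ ?_ ?_ ?_ ?_ ?_
  · exact this.2
  · filter_upwards [hI.mem_nhds ht] with τ hτ
    exact (hslice φ hc τ hτ).aestronglyMeasurable
  · exact (hslice φ hc t ht).intervalIntegrable _ _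
  · exact (hslice φt hct t ht).aestronglyMeasurable
  · refine Filter.Eventually.of_forall fun s hs τ hτ => ?_
    rw [Set.uIoc_of_le (by positivity)] at hs
    exact hB (τ, s) ⟨Metric.ball_subset_closedBall hτ, hs.1.le, hs.2⟩
  · simp
  · refine Filter.Eventually.of_forall fun s hs τ hτ => ?_
    exact hφ τ (hsub (Metric.ball_subset_closedBall hτ)) s

/-- Integral of an exact derivative over one period. -/
lemma int_exact {q qs : ℝ → ℝ} (h : ∀ s, HasDerivAt q (qs s) s) (hc : Continuous qs)
    (hp : q (2 * π) = q 0) : ∫ s in (0:ℝ)..2 * π, qs s = 0 := by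
  rw [intervalIntegral.integral_eq_sub_of_hasDerivAt (fun s _ => h s)
    (hc.intervalIntegrable _ _), hp, sub_self]

lemma int_mono {f g : ℝ → ℝ} (hf : Continuous f) (hg : Continuous g) (h : ∀ s, f s ≤ g s) :
    ∫ s in (0:ℝ)..2 * π, f s ≤ ∫ s in (0:ℝ)..2 * π, g s :=
  intervalIntegral.integral_mono (by positivity) (hf.intervalIntegrable _ _)
    (hg.intervalIntegrable _ _) h

lemma int_nonneg {f : ℝ → ℝ} (h : ∀ s, 0 ≤ f s) : 0 ≤ ∫ s in (0:ℝ)..2 * π, f s :=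
  intervalIntegral.integral_nonneg (by positivity) (fun s _ => h s)

lemma sub_le_int {h h' : ℝ → ℝ} (hd : ∀ s, HasDerivAt h (h' s) s) (hc : Continuous h')
    {s c : ℝ} (hs : s ∈ Set.Icc 0 (2 * π)) (hcc : c ∈ Set.Icc 0 (2 * π)) :
    h s ≤ h c + ∫ x in (0:ℝ)..2 * π, |h' x| := by
  have h1 : ∫ x in c..s, h' x = h s - h c :=
    intervalIntegral.integral_eq_sub_of_hasDerivAt (fun s _ => hd s) (hc.intervalIntegrable _ _)
  have h2 : |∫ x in c..s, h' x| ≤ |∫ x in c..s, (|h' x|)| :=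
    by simpa only [Real.norm_eq_abs] using
      intervalIntegral.norm_integral_le_abs_integral_norm (f := h') (a := c) (b := s) (μ := volume)
  have h3 : |∫ x in c..s, (|h' x|)| ≤ |∫ x in (0:ℝ)..2 * π, (|h' x|)| := by
    apply intervalIntegral.abs_integral_mono_interval
    · rw [Set.uIoc_of_le (by positivity : (0:ℝ) ≤ 2 * π)]
      intro x hx
      rcases Set.mem_uIoc.1 hx with hx | hx
      · exact ⟨hcc.1.trans_lt hx.1, hx.2.trans hs.2⟩
      · exact ⟨hs.1.trans_lt hx.1, hx.2.trans hcc.2⟩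
    · exact Filter.Eventually.of_forall fun x => abs_nonneg _
    · exact hc.abs.intervalIntegrable _ _
  rw [abs_of_nonneg (int_nonneg (fun s => abs_nonneg (h' s)))] at h3
  have := le_abs_self (∫ x in c..s, h' x)
  linarith

lemma sq_le_int {g g' : ℝ → ℝ} (hd : ∀ s, HasDerivAt g (g' s) s) (hc : Continuous g')
    {s c η : ℝ} (hη : 0 < η) (hs : s ∈ Set.Icc 0 (2 * π)) (hcc : c ∈ Set.Icc 0 (2 * π)) :
    g s ^ 2 ≤ g c ^ 2 + ∫ x in (0:ℝ)..2 * π, (η * g' x ^ 2 + g x ^ 2 / η) := by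
  have hgc : Continuous g := continuous_iff_continuousAt.2 fun s => (hd s).continuousAt
  have h1 := sub_le_int (h := fun s => g s ^ 2) (h' := fun s => 2 * g s * g' s)
    (fun s => by simpa using (hd s).fun_pow 2) (by fun_prop) hs hcc
  refine h1.trans ?_
  gcongr
  apply int_mono (by fun_prop) (by fun_prop)
  intro x
  rw [abs_le]
  have e1 : η * g' x ^ 2 + g x ^ 2 / η - 2 * g x * g' x = (η * g' x - g x) ^ 2 / η := by
    field_simp; ring
  have e2 : η * g' x ^ 2 + g x ^ 2 / η + 2 * g x * g' x = (η * g' x + g x) ^ 2 / η := by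
    field_simp; ring
  have p1 : 0 ≤ (η * g' x - g x) ^ 2 / η := by positivity
  have p2 : 0 ≤ (η * g' x + g x) ^ 2 / η := by positivity
  constructor <;> linarith

lemma int_lin {f g : ℝ → ℝ} (hf : Continuous f) (hg : Continuous g) (a b : ℝ) :
    ∫ x in (0:ℝ)..2 * π, (a * f x + b * g x) =
      a * (∫ x in (0:ℝ)..2 * π, f x) + b * ∫ x in (0:ℝ)..2 * π, g x := by
  rw [intervalIntegral.integral_add ((hf.const_mul a).intervalIntegrable _ _)
    ((hg.const_mul b).intervalIntegrable _ _)]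
  simp

lemma int_le_const {f : ℝ → ℝ} (hf : Continuous f) {B : ℝ}
    (h : ∀ s ∈ Set.Icc 0 (2 * π), f s ≤ B) : ∫ x in (0:ℝ)..2 * π, f x ≤ 2 * π * B := by
  have := intervalIntegral.integral_mono_on (μ := volume) (by positivity : (0:ℝ) ≤ 2 * π)
    (hf.intervalIntegrable 0 (2*π)) ((continuous_const (y := B)).intervalIntegrable 0 (2*π)) h
  simpa using this

/-- Poincaré for a function vanishing somewhere. -/
lemma poinc {g g' : ℝ → ℝ} (hd : ∀ s, HasDerivAt g (g' s) s) (hc : Continuous g')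
    {c : ℝ} (hcc : c ∈ Set.Icc 0 (2 * π)) (h0 : g c = 0) :
    ∫ x in (0:ℝ)..2 * π, g x ^ 2 ≤ 16 * π ^ 2 * ∫ x in (0:ℝ)..2 * π, g' x ^ 2 := by
  have hgc : Continuous g := continuous_iff_continuousAt.2 fun s => (hd s).continuousAt
  have h1 : ∀ s ∈ Set.Icc 0 (2 * π), g s ^ 2 ≤ 4 * π * (∫ x in (0:ℝ)..2 * π, g' x ^ 2)
      + (1 / (4 * π)) * ∫ x in (0:ℝ)..2 * π, g x ^ 2 := by
    intro s hs
    have := sq_le_int hd hc (η := 4 * π) (by positivity) hs hcc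
    rw [h0] at this
    rw [← int_lin (by fun_prop) (by fun_prop)]
    convert this using 1
    simp only [ne_eq, OfNat.ofNat_ne_zero, not_false_eq_true, zero_pow, zero_add]
    congr 1; ext x; ring
  have h2 := int_le_const (f := fun s => g s ^ 2) (by fun_prop) h1
  have : 2 * π * (4 * π * (∫ x in (0:ℝ)..2 * π, g' x ^ 2)
      + (1 / (4 * π)) * ∫ x in (0:ℝ)..2 * π, g x ^ 2) =
      8 * π ^ 2 * (∫ x in (0:ℝ)..2 * π, g' x ^ 2) + (1/2) * ∫ x in (0:ℝ)..2 * π, g x ^ 2 := by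
    field_simp; ring
  rw [this] at h2
  linarith

lemma poinc_sup {g g' : ℝ → ℝ} (hd : ∀ s, HasDerivAt g (g' s) s) (hc : Continuous g')
    {c : ℝ} (hcc : c ∈ Set.Icc 0 (2 * π)) (h0 : g c = 0) {s : ℝ} (hs : s ∈ Set.Icc 0 (2 * π)) :
    g s ^ 2 ≤ 8 * π * ∫ x in (0:ℝ)..2 * π, g' x ^ 2 := by
  have hgc : Continuous g := continuous_iff_continuousAt.2 fun s => (hd s).continuousAt
  have := sq_le_int hd hc (η := 4 * π) (by positivity) hs hcc
  rw [h0] at this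
  have e : ∫ x in (0:ℝ)..2 * π, (4 * π * g' x ^ 2 + g x ^ 2 / (4 * π)) =
     4 * π * (∫ x in (0:ℝ)..2 * π, g' x ^ 2)
      + (1 / (4 * π)) * ∫ x in (0:ℝ)..2 * π, g x ^ 2 := by
    rw [← int_lin (by fun_prop) (by fun_prop)]
    congr 1; ext x; ring
  rw [e] at this
  have h3 := poinc hd hc hcc h0
  have : 1 / (4 * π) * ∫ x in (0:ℝ)..2 * π, g x ^ 2 ≤ 
      1 / (4 * π) * (16 * π ^ 2 * ∫ x in (0:ℝ)..2 * π, g' x ^ 2) := by gcongr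
  have e2 : 1 / (4 * π) * (16 * π ^ 2 * ∫ x in (0:ℝ)..2 * π, g' x ^ 2) =
     4 * π * ∫ x in (0:ℝ)..2 * π, g' x ^ 2 := by field_simp; ring
  linarith

/-- Sobolev bound for `h = ‖y‖²`. -/
lemma sob_sup {y y' : ℝ → R3} (hd : ∀ s, HasDerivAt y (y' s) s) (hc : Continuous y')
    {s : ℝ} (hs : s ∈ Set.Icc 0 (2 * π)) :
    ‖y s‖ ^ 2 ≤ ∫ x in (0:ℝ)..2 * π, (2 * ‖y x‖ ^ 2 + ‖y' x‖ ^ 2) := by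
  have hgc : Continuous y := continuous_iff_continuousAt.2 fun s => (hd s).continuousAt
  have hdc : Continuous fun s => dot (y' s) (y s) + dot (y s) (y' s) := by
    rw [← continuousOn_univ] at *
    exact (hc.dot' hgc).add (hgc.dot' hc)
  set B := ∫ x in (0:ℝ)..2 * π, (‖y x‖ ^ 2 + ‖y' x‖ ^ 2) with hB
  have h1 : ∀ c ∈ Set.Icc 0 (2 * π), ‖y s‖ ^ 2 - B ≤ ‖y c‖ ^ 2 := by
    intro c hcc
    have := sub_le_int (fun s => (hd s).dot' (hd s)) hdc hs hcc
    rw [dot_self, dot_self] at this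
    have h2 : ∫ x in (0:ℝ)..2 * π, |dot (y' x) (y x) + dot (y x) (y' x)| ≤ B := by
      apply int_mono hdc.abs (by fun_prop)
      intro x
      have := abs_dot_le (y' x) (y x)
      have := abs_dot_le (y x) (y' x)
      have := abs_add_le (dot (y' x) (y x)) (dot (y x) (y' x))
      nlinarith [sq_nonneg (‖y x‖ - ‖y' x‖)]
    linarith
  have h2 : 2 * π * (‖y s‖ ^ 2 - B) ≤ ∫ x in (0:ℝ)..2 * π, ‖y x‖ ^ 2 := by
    have := intervalIntegral.integral_mono_on (μ := volume) (by positivity : (0:ℝ) ≤ 2 * π)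
      ((continuous_const (y := ‖y s‖ ^ 2 - B)).intervalIntegrable 0 (2*π))
      ((hgc.norm.pow 2).intervalIntegrable 0 (2*π)) h1
    simp only [intervalIntegral.integral_const, smul_eq_mul, sub_zero] at this
    exact this
  have h3 : 0 ≤ ∫ x in (0:ℝ)..2 * π, ‖y x‖ ^ 2 := int_nonneg fun _ => by positivity
  have h4 : ‖y s‖ ^ 2 - B ≤ ∫ x in (0:ℝ)..2 * π, ‖y x‖ ^ 2 := by
    have := pi_gt_three
    by_cases h : 0 ≤ ‖y s‖ ^ 2 - B
    · nlinarith
    · linarith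
  have e1 : ∫ x in (0:ℝ)..2 * π, (2 * ‖y x‖ ^ 2 + ‖y' x‖ ^ 2) =
      (∫ x in (0:ℝ)..2 * π, ‖y x‖ ^ 2) + B := by
    rw [hB, ← intervalIntegral.integral_add]
    · congr 1; ext x; ring
    · exact (hgc.norm.pow 2).intervalIntegrable _ _
    · exact ((hgc.norm.pow 2).add (hc.norm.pow 2)).intervalIntegrable _ _
  linarith

/-- Gronwall -/
lemma gron {E E' : ℝ → ℝ} {a b C : ℝ} (hd : ∀ t ∈ Set.Ioo a b, HasDerivAt E (E' t) t)
    (hE : ∀ t ∈ Set.Ioo a b, |E' t| ≤ C * E t) {t0 t : ℝ} (h0 : t0 ∈ Set.Ioo a b)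
    (ht : t ∈ Set.Ioo a b) : E t ≤ exp (C * |t - t0|) * E t0 := by
  have key : ∀ c : ℝ, ∀ τ ∈ Set.Ioo a b, HasDerivAt (fun τ => exp (c * τ) * E τ)
      (exp (c * τ) * (c * E τ + E' τ)) τ := by
    intro c τ hτ
    have h1 : HasDerivAt (fun τ : ℝ => exp (c * τ)) (exp (c * τ) * c) τ := by
      simpa using ((hasDerivAt_id τ).const_mul c).exp
    exact (h1.fun_mul (hd τ hτ)).congr_deriv (by ring)
  rcases le_total t0 t with h | h
  · have hanti : AntitoneOn (fun τ => exp (-C * τ) * E τ) (Set.Ioo a b) := by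
      apply antitoneOn_of_deriv_nonpos (convex_Ioo a b)
      · exact fun τ hτ => (key (-C) τ hτ).continuousAt.continuousWithinAt
      · rw [interior_Ioo]
        exact fun τ hτ => (key (-C) τ hτ).differentiableAt.differentiableWithinAt
      · rw [interior_Ioo]
        intro τ hτ
        rw [(key (-C) τ hτ).deriv]
        have := (abs_le.1 (hE τ hτ)).2
        exact mul_nonpos_of_nonneg_of_nonpos (exp_pos _).le (by linarith)
    have := hanti h0 ht h
    simp only at this
    rw [abs_of_nonneg (by linarith)]
    have e : exp (C * (t - t0)) = exp (C * t) * exp (-C * t0) := by rw [← exp_add]; ring_nf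
    rw [e, mul_assoc]
    calc E t = exp (C * t) * (exp (-C * t) * E t) := by
          rw [← mul_assoc, ← exp_add]; simp
      _ ≤ _ := by gcongr
  · have hmono : MonotoneOn (fun τ => exp (C * τ) * E τ) (Set.Ioo a b) := by
      apply monotoneOn_of_deriv_nonneg (convex_Ioo a b)
      · exact fun τ hτ => (key C τ hτ).continuousAt.continuousWithinAt
      · rw [interior_Ioo]
        exact fun τ hτ => (key C τ hτ).differentiableAt.differentiableWithinAt
      · rw [interior_Ioo]
        intro τ hτ
        rw [(key C τ hτ).deriv]
        have := (abs_le.1 (hE τ hτ)).1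
        exact mul_nonneg (exp_pos _).le (by linarith)
    have := hmono ht h0 h
    simp only at this
    rw [abs_of_nonpos (by linarith)]
    have e : exp (C * -(t - t0)) = exp (-C * t) * exp (C * t0) := by rw [← exp_add]; ring_nf
    rw [e, mul_assoc]
    calc E t = exp (-C * t) * (exp (C * t) * E t) := by
          rw [← mul_assoc, ← exp_add]; simp
      _ ≤ _ := by gcongr


/-! ### Partial derivatives and the jet of a solution -/

/-- the space-time strip -/
def strip (T : ℝ) : Set (ℝ × ℝ) := Set.Ioo (-T) T ×ˢ Set.univ

lemma isOpen_strip (T : ℝ) : IsOpen (strip T) := isOpen_Ioo.prod isOpen_univ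

lemma mem_strip {T t s : ℝ} : (t, s) ∈ strip T ↔ t ∈ Set.Ioo (-T) T := by simp [strip]

/-- time derivative -/
def Dt (F : ℝ × ℝ → R3) (p : ℝ × ℝ) : R3 := fderiv ℝ F p (1, 0)
/-- space derivative -/
def Ds (F : ℝ × ℝ → R3) (p : ℝ × ℝ) : R3 := fderiv ℝ F p (0, 1)

lemma contDiffOn_fderiv_apply {S : Set (ℝ × ℝ)} (hS : IsOpen S) {F : ℝ × ℝ → R3}
    (hF : ContDiffOn ℝ (⊤ : ℕ∞) F S) (e : ℝ × ℝ) :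
    ContDiffOn ℝ (⊤ : ℕ∞) (fun p => fderiv ℝ F p e) S :=
  (hF.fderiv_of_isOpen hS (m := (⊤ : ℕ∞)) (by norm_cast)).clm_apply contDiffOn_const

lemma hasDerivAt_Ds {F : ℝ × ℝ → R3} {t s : ℝ} (hF : DifferentiableAt ℝ F (t, s)) :
    HasDerivAt (fun σ => F (t, σ)) (Ds F (t, s)) s := by
  have h : HasDerivAt (fun σ : ℝ => (t, σ)) ((0 : ℝ), (1 : ℝ)) s :=
    (hasDerivAt_const s t).prodMk (hasDerivAt_id s)
  exact hF.hasFDerivAt.comp_hasDerivAt s h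

lemma hasDerivAt_Dt {F : ℝ × ℝ → R3} {t s : ℝ} (hF : DifferentiableAt ℝ F (t, s)) :
    HasDerivAt (fun τ => F (τ, s)) (Dt F (t, s)) t := by
  have h : HasDerivAt (fun τ : ℝ => (τ, s)) ((1 : ℝ), (0 : ℝ)) t :=
    (hasDerivAt_id t).prodMk (hasDerivAt_const t s)
  exact hF.hasFDerivAt.comp_hasDerivAt t h

lemma smooth_diffAt {T : ℝ} {F : ℝ × ℝ → R3} (hF : ContDiffOn ℝ (⊤ : ℕ∞) F (strip T)) {t s : ℝ}
    (ht : t ∈ Set.Ioo (-T) T) : DifferentiableAt ℝ F (t, s) :=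
  (hF.contDiffAt ((isOpen_strip T).mem_nhds (mem_strip.2 ht))).differentiableAt (by simp)

lemma Dt_Ds_comm {T : ℝ} {F : ℝ × ℝ → R3} (hF : ContDiffOn ℝ (⊤ : ℕ∞) F (strip T)) {t s : ℝ}
    (ht : t ∈ Set.Ioo (-T) T) : Dt (Ds F) (t, s) = Ds (Dt F) (t, s) := by
  have hA := hF.contDiffAt ((isOpen_strip T).mem_nhds (mem_strip.2 ht : (t, s) ∈ strip T))
  have hsym : IsSymmSndFDerivAt ℝ F (t, s) := hA.isSymmSndFDerivAt (by
    simp only [minSmoothness_of_isRCLikeNormedField]; exact WithTop.coe_le_coe.2 (le_top : (2 : ℕ∞) ≤ ⊤))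
  have hd : DifferentiableAt ℝ (fderiv ℝ F) (t, s) :=
    (hA.fderiv_right (m := 1) (by norm_cast)).differentiableAt (by simp)
  have h1 : ∀ e, fderiv ℝ (fun p => fderiv ℝ F p e) (t, s) =
      (fderiv ℝ (fderiv ℝ F) (t, s)).flip e := by
    intro e
    rw [fderiv_clm_apply hd (differentiableAt_const e)]
    simp
  simp only [Dt, Ds]
  change fderiv ℝ (fun p => fderiv ℝ F p (0, 1)) (t, s) (1, 0) =
    fderiv ℝ (fun p => fderiv ℝ F p (1, 0)) (t, s) (0, 1)
  rw [h1, h1]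
  exact hsym _ _

lemma time_step {T : ℝ} {F : ℝ × ℝ → R3} (hF : ContDiffOn ℝ (⊤ : ℕ∞) F (strip T))
    {E E' : ℝ → ℝ → R3} (hE : ∀ t ∈ Set.Ioo (-T) T, ∀ s, Dt F (t, s) = E t s)
    (hE' : ∀ t ∈ Set.Ioo (-T) T, ∀ s, HasDerivAt (E t) (E' t s) s) :
    ∀ t ∈ Set.Ioo (-T) T, ∀ s, Dt (Ds F) (t, s) = E' t s := by
  intro t ht s
  rw [Dt_Ds_comm hF ht]
  have h1 := hasDerivAt_Ds (smooth_diffAt (s := s)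
    (contDiffOn_fderiv_apply (isOpen_strip T) hF (1, 0)) ht)
  have h2 : (fun σ => fderiv ℝ F (t, σ) (1, 0)) = E t := funext fun σ => hE t ht σ
  rw [h2] at h1
  exact h1.unique (hE' t ht s)

/-- The jet of a smooth solution of the Schrödinger map equation. -/
structure Sol (T : ℝ) (w : ℕ → ℝ → ℝ → R3) : Prop where
  smooth : ∀ n, ContDiffOn ℝ (⊤ : ℕ∞) (fun p : ℝ × ℝ => w n p.1 p.2) (strip T)
  ds : ∀ n, ∀ t ∈ Set.Ioo (-T) T, ∀ s, HasDerivAt (w n t) (w (n + 1) t s) s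
  dt0 : ∀ t ∈ Set.Ioo (-T) T, ∀ s, HasDerivAt (fun τ => w 0 τ s) (cross3 (w 0 t s) (w 2 t s)) t
  dt1 : ∀ t ∈ Set.Ioo (-T) T, ∀ s, HasDerivAt (fun τ => w 1 τ s)
    (cross3 (w 1 t s) (w 2 t s) + cross3 (w 0 t s) (w 3 t s)) t
  dt2 : ∀ t ∈ Set.Ioo (-T) T, ∀ s, HasDerivAt (fun τ => w 2 τ s)
    ((2 : ℝ) • cross3 (w 1 t s) (w 3 t s) + cross3 (w 0 t s) (w 4 t s)) t
  dt3 : ∀ t ∈ Set.Ioo (-T) T, ∀ s, HasDerivAt (fun τ => w 3 τ s)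
    ((2 : ℝ) • cross3 (w 2 t s) (w 3 t s) + (3 : ℝ) • cross3 (w 1 t s) (w 4 t s)
      + cross3 (w 0 t s) (w 5 t s)) t
  per : ∀ n, ∀ t ∈ Set.Ioo (-T) T, ∀ s, w n t (s + 2 * π) = w n t s
  unit : ∀ t ∈ Set.Ioo (-T) T, ∀ s, ‖w 0 t s‖ = 1

lemma exists_sol {T : ℝ} {u : ℝ → ℝ → R3}
    (hu : ContDiffOn ℝ (⊤ : ℕ∞) (fun p : ℝ × ℝ => u p.1 p.2) (Set.Ioo (-T) T ×ˢ Set.univ))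
    (hper : ∀ t ∈ Set.Ioo (-T) T, ∀ s : ℝ, u t (s + 2 * π) = u t s)
    (hunit : ∀ t ∈ Set.Ioo (-T) T, ∀ s : ℝ, ‖u t s‖ = 1)
    (heq : ∀ t ∈ Set.Ioo (-T) T, ∀ s : ℝ,
          deriv (fun τ => u τ s) t =
            deriv (fun σ => cross3 (u t σ) (deriv (u t) σ)) s) :
    ∃ w : ℕ → ℝ → ℝ → R3, Sol T w ∧ w 0 = u ∧
      ∀ t ∈ Set.Ioo (-T) T, deriv (deriv (deriv (u t))) = w 3 t := by
  set U : ℝ × ℝ → R3 := fun p => u p.1 p.2 with hU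
  set w : ℕ → ℝ → ℝ → R3 := fun n t s => (Ds^[n] U) (t, s) with hw
  have hsm : ∀ n, ContDiffOn ℝ (⊤ : ℕ∞) (Ds^[n] U) (strip T) := by
    intro n
    induction n with
    | zero => exact hu
    | succ n ih =>
      rw [Function.iterate_succ_apply']
      exact contDiffOn_fderiv_apply (isOpen_strip T) ih _
  have hds : ∀ n, ∀ t ∈ Set.Ioo (-T) T, ∀ s, HasDerivAt (w n t) (w (n + 1) t s) s := by
    intro n t ht s
    have := hasDerivAt_Ds (smooth_diffAt (s := s) (hsm n) ht)
    simpa only [hw, Function.iterate_succ_apply'] using this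
  have hdt : ∀ n, ∀ t ∈ Set.Ioo (-T) T, ∀ s, HasDerivAt (fun τ => w n τ s)
      (Dt (Ds^[n] U) (t, s)) t := by
    intro n t ht s
    exact hasDerivAt_Dt (smooth_diffAt (s := s) (hsm n) ht)
  have hw0 : w 0 = u := rfl
  have hder : ∀ n, ∀ t ∈ Set.Ioo (-T) T, deriv (w n t) = w (n + 1) t := by
    intro n t ht; ext1 s; exact (hds n t ht s).deriv
  have e0 : ∀ t ∈ Set.Ioo (-T) T, ∀ s, Dt (Ds^[0] U) (t, s) = cross3 (w 0 t s) (w 2 t s) := by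
    intro t ht s
    have h1 := (hdt 0 t ht s).deriv
    rw [← h1]
    rw [hw0]
    rw [heq t ht s, ← hw0, hder 0 t ht]
    rw [((hds 0 t ht s).cross3' (hds 1 t ht s)).deriv, cross3_self, zero_add]
  have e1 : ∀ t ∈ Set.Ioo (-T) T, ∀ s, Dt (Ds^[1] U) (t, s) =
      cross3 (w 1 t s) (w 2 t s) + cross3 (w 0 t s) (w 3 t s) :=
    time_step (hsm 0) e0 (fun t ht s => (hds 0 t ht s).cross3' (hds 2 t ht s))
  have e2 : ∀ t ∈ Set.Ioo (-T) T, ∀ s, Dt (Ds^[2] U) (t, s) =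
      (2 : ℝ) • cross3 (w 1 t s) (w 3 t s) + cross3 (w 0 t s) (w 4 t s) := by
    have h := time_step (hsm 1) e1
      (fun t ht s => ((hds 1 t ht s).cross3' (hds 2 t ht s)).add
        ((hds 0 t ht s).cross3' (hds 3 t ht s)))
    intro t ht s
    have := h t ht s
    rw [cross3_self] at this
    rw [show Ds^[2] U = Ds (Ds^[1] U) from rfl, this]
    module
  have e3 : ∀ t ∈ Set.Ioo (-T) T, ∀ s, Dt (Ds^[3] U) (t, s) =
      (2 : ℝ) • cross3 (w 2 t s) (w 3 t s) + (3 : ℝ) • cross3 (w 1 t s) (w 4 t s)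
      + cross3 (w 0 t s) (w 5 t s) := by
    have h := time_step (hsm 2) e2
      (fun t ht s => (((hds 1 t ht s).cross3' (hds 3 t ht s)).const_smul (2 : ℝ)).add
        ((hds 0 t ht s).cross3' (hds 4 t ht s)))
    intro t ht s
    have := h t ht s
    rw [show Ds^[3] U = Ds (Ds^[2] U) from rfl, this]
    module
  refine ⟨w, ⟨hsm, hds, ?_, ?_, ?_, ?_, ?_, hunit⟩, hw0, ?_⟩
  · intro t ht s; rw [← e0 t ht s]; exact hdt 0 t ht s
  · intro t ht s; rw [← e1 t ht s]; exact hdt 1 t ht s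
  · intro t ht s; rw [← e2 t ht s]; exact hdt 2 t ht s
  · intro t ht s; rw [← e3 t ht s]; exact hdt 3 t ht s
  · intro n
    induction n with
    | zero => exact hper
    | succ n ih =>
      intro t ht s
      have h1 := hds n t ht s
      have h2 : HasDerivAt (fun σ => w n t (σ + 2 * π)) (w (n + 1) t (s + 2 * π)) s := by
        exact (hds n t ht (s + 2 * π)).comp_add_const s (2 * π)
      have h3 : (fun σ => w n t (σ + 2 * π)) = w n t := funext fun σ => ih t ht σ
      rw [h3] at h2
      exact h2.unique h1
  · intro t ht
    rw [← hw0, hder 0 t ht, hder 1 t ht, hder 2 t ht]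


/-! ### A priori bounds -/

lemma slice_cont {X : Type*} [TopologicalSpace X] {I : Set ℝ} {f : ℝ → ℝ → X}
    (hf : ContinuousOn (fun p : ℝ × ℝ => f p.1 p.2) (I ×ˢ Set.univ)) {t : ℝ} (ht : t ∈ I) :
    Continuous (f t) := by
  rw [← continuousOn_univ]
  exact hf.comp (f := fun s => (t, s)) (by fun_prop) (fun s _ => ⟨ht, trivial⟩)

lemma energy {I : Set ℝ} (hI : IsOpen I) {φ R q qs : ℝ → ℝ → ℝ}
    (hφ : ∀ t ∈ I, ∀ s, HasDerivAt (fun τ => φ τ s) (qs t s + R t s) t)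
    (hq : ∀ t ∈ I, ∀ s, HasDerivAt (q t) (qs t s) s)
    (hcφ : ContinuousOn (fun p : ℝ × ℝ => φ p.1 p.2) (I ×ˢ Set.univ))
    (hcqs : ContinuousOn (fun p : ℝ × ℝ => qs p.1 p.2) (I ×ˢ Set.univ))
    (hcR : ContinuousOn (fun p : ℝ × ℝ => R p.1 p.2) (I ×ˢ Set.univ))
    (hper : ∀ t ∈ I, q t (2 * π) = q t 0) {t : ℝ} (ht : t ∈ I) :
    HasDerivAt (fun t => ∫ s in (0:ℝ)..2 * π, φ t s) (∫ s in (0:ℝ)..2 * π, R t s) t := by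
  have h := hasDerivAt_intParam hI (φt := fun t s => qs t s + R t s) hφ hcφ (hcqs.add hcR) ht
  rw [intervalIntegral.integral_add ((slice_cont hcqs ht).intervalIntegrable _ _)
    ((slice_cont hcR ht).intervalIntegrable _ _),
    int_exact (hq t ht) (slice_cont hcqs ht) (hper t ht), zero_add] at h
  exact h

namespace Sol
variable {T : ℝ} {w : ℕ → ℝ → ℝ → R3}

lemma cont (h : Sol T w) (n : ℕ) :
    ContinuousOn (fun p : ℝ × ℝ => w n p.1 p.2) (Set.Ioo (-T) T ×ˢ Set.univ) :=
  (h.smooth n).continuousOn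

lemma conts (h : Sol T w) (n : ℕ) {t : ℝ} (ht : t ∈ Set.Ioo (-T) T) : Continuous (w n t) :=
  slice_cont (h.cont n) ht

lemma per0 (h : Sol T w) (n : ℕ) {t : ℝ} (ht : t ∈ Set.Ioo (-T) T) : w n t (2 * π) = w n t 0 := by
  simpa using h.per n t ht 0

lemma c01 (h : Sol T w) {t : ℝ} (ht : t ∈ Set.Ioo (-T) T) (s : ℝ) :
    dot (w 0 t s) (w 1 t s) = 0 := by
  have h1 := (h.ds 0 t ht s).dot' (h.ds 0 t ht s)
  have h2 : (fun s => dot (w 0 t s) (w 0 t s)) = fun _ => (1 : ℝ) := by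
    ext s; rw [dot_self, h.unit t ht s]; norm_num
  rw [h2] at h1
  have := h1.unique (hasDerivAt_const s (1:ℝ))
  have e : dot (w (0 + 1) t s) (w 0 t s) = dot (w 0 t s) (w 1 t s) := by simp [dot]; ring
  rw [e] at this
  simp only [zero_add] at this
  linarith

lemma c02 (h : Sol T w) {t : ℝ} (ht : t ∈ Set.Ioo (-T) T) (s : ℝ) :
    dot (w 0 t s) (w 2 t s) = - dot (w 1 t s) (w 1 t s) := by
  have h1 := (h.ds 0 t ht s).dot' (h.ds 1 t ht s)
  rw [show (fun s => dot (w 0 t s) (w 1 t s)) = fun _ => (0 : ℝ) from funext (h.c01 ht)] at h1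
  have := h1.unique (hasDerivAt_const s (0:ℝ))
  simp only [zero_add, Nat.reduceAdd] at this
  linarith

lemma c03 (h : Sol T w) {t : ℝ} (ht : t ∈ Set.Ioo (-T) T) (s : ℝ) :
    dot (w 0 t s) (w 3 t s) = - 3 * dot (w 1 t s) (w 2 t s) := by
  have h1 := (h.ds 0 t ht s).dot' (h.ds 2 t ht s)
  rw [show (fun s => dot (w 0 t s) (w 2 t s)) = _ from funext (h.c02 ht)] at h1
  have := h1.unique ((h.ds 1 t ht s).dot' (h.ds 1 t ht s)).neg
  simp only [zero_add, Nat.reduceAdd, dot] at this ⊢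
  linarith

lemma c04 (h : Sol T w) {t : ℝ} (ht : t ∈ Set.Ioo (-T) T) (s : ℝ) :
    dot (w 0 t s) (w 4 t s) = - 4 * dot (w 1 t s) (w 3 t s) - 3 * dot (w 2 t s) (w 2 t s) := by
  have h1 := (h.ds 0 t ht s).dot' (h.ds 3 t ht s)
  rw [show (fun s => dot (w 0 t s) (w 3 t s)) = _ from funext (h.c03 ht)] at h1
  have := h1.unique (((h.ds 1 t ht s).dot' (h.ds 2 t ht s)).const_mul (-3))
  simp only [zero_add, Nat.reduceAdd, dot] at this ⊢
  linarith

end Sol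

lemma det_split {u a b c : R3} (hu : dot u u = 1) (hb : dot u b = 0) :
    det3 a b c = dot u a * det3 u b c + dot u c * det3 a b u := by
  have e : dot u u * det3 a b c = dot u a * det3 u b c + dot u b * det3 a u c
      + dot u c * det3 a b u := by
    simp only [det3, dot, cross3_0, cross3_1, cross3_2]; ring
  rw [hu, hb] at e
  linarith

/-- the homogeneous energies -/
def NN (w : ℕ → ℝ → ℝ → R3) (n : ℕ) (t : ℝ) : ℝ := ∫ s in (0:ℝ)..2 * π, ‖w n t s‖ ^ 2

lemma NN_nonneg (w : ℕ → ℝ → ℝ → R3) (n : ℕ) (t : ℝ) : 0 ≤ NN w n t :=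
  int_nonneg fun _ => by positivity

lemma norm_sq3 (a : R3) : ‖a‖ ^ 2 = a 0 ^ 2 + a 1 ^ 2 + a 2 ^ 2 := by
  rw [← dot_self, dot]; ring

lemma cont_coord {f : ℝ → R3} (hf : Continuous f) (i : Fin 3) : Continuous (fun s => f s i) :=
  (EuclideanSpace.proj (𝕜 := ℝ) i : R3 →L[ℝ] ℝ).continuous.comp hf

lemma int_norm_sq3 {f : ℝ → R3} (hf : Continuous f) :
    ∫ s in (0:ℝ)..2 * π, ‖f s‖ ^ 2 = (∫ s in (0:ℝ)..2 * π, f s 0 ^ 2)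
      + (∫ s in (0:ℝ)..2 * π, f s 1 ^ 2) + ∫ s in (0:ℝ)..2 * π, f s 2 ^ 2 := by
  have hi : ∀ i : Fin 3, IntervalIntegrable (fun s => f s i ^ 2) volume 0 (2 * π) :=
    fun i => ((cont_coord hf i).pow 2).intervalIntegrable _ _
  rw [← intervalIntegral.integral_add (hi 0) (hi 1),
    ← intervalIntegral.integral_add ((hi 0).add (hi 1)) (hi 2)]
  simp only [norm_sq3]

namespace Sol
variable {T : ℝ} {w : ℕ → ℝ → ℝ → R3}

lemma zero_coord (h : Sol T w) (n : ℕ) {t : ℝ} (ht : t ∈ Set.Ioo (-T) T) (i : Fin 3) :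
    ∃ c ∈ Set.Icc 0 (2 * π), w (n + 1) t c i = 0 := by
  obtain ⟨c, hc, h0⟩ := exists_hasDerivAt_eq_zero (f := fun s => w n t s i)
    (f' := fun s => w (n + 1) t s i) (by positivity : (0:ℝ) < 2 * π)
    (cont_coord (h.conts n ht) i).continuousOn (by simp only [h.per0 n ht])
    (fun s _ => (h.ds n t ht s).coord i)
  exact ⟨c, ⟨hc.1.le, hc.2.le⟩, h0⟩

lemma sup_w (h : Sol T w) (n : ℕ) {t : ℝ} (ht : t ∈ Set.Ioo (-T) T) {η : ℝ} (hη : 0 < η) (s : ℝ) :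
    ‖w (n + 1) t s‖ ^ 2 ≤ η * NN w (n + 2) t + NN w (n + 1) t / η := by
  have hp : Function.Periodic (w (n + 1) t) (2 * π) := h.per (n + 1) t ht
  obtain ⟨s', hs', hss⟩ := hp.exists_mem_Ico₀ (by positivity) s
  rw [hss]
  have key : ∀ i : Fin 3, w (n + 1) t s' i ^ 2 ≤
      η * (∫ x in (0:ℝ)..2 * π, w (n + 2) t x i ^ 2)
        + (1 / η) * ∫ x in (0:ℝ)..2 * π, w (n + 1) t x i ^ 2 := by
    intro i
    obtain ⟨c, hc, h0⟩ := h.zero_coord n ht i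
    have := sq_le_int (fun s => (h.ds (n + 1) t ht s).coord i) (cont_coord (h.conts (n + 2) ht) i)
      hη ⟨hs'.1, hs'.2.le⟩ hc
    rw [h0] at this
    rw [← int_lin (f := fun x => w (n + 2) t x i ^ 2) (g := fun x => w (n + 1) t x i ^ 2)
      ((cont_coord (h.conts (n + 2) ht) i).pow 2)
      ((cont_coord (h.conts (n + 1) ht) i).pow 2)]
    refine this.trans (le_of_eq ?_)
    simp only [ne_eq, OfNat.ofNat_ne_zero, not_false_eq_true, zero_pow, zero_add]
    congr 1; ext x; ring
  rw [NN, NN, int_norm_sq3 (h.conts _ ht), int_norm_sq3 (h.conts _ ht), norm_sq3]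
  have := key 0; have := key 1; have := key 2
  simp only [div_eq_mul_inv, one_mul] at *
  linarith

lemma poinc_w (h : Sol T w) (n : ℕ) {t : ℝ} (ht : t ∈ Set.Ioo (-T) T) :
    NN w (n + 1) t ≤ 16 * π ^ 2 * NN w (n + 2) t := by
  have key : ∀ i : Fin 3, ∫ x in (0:ℝ)..2 * π, w (n + 1) t x i ^ 2 ≤
      16 * π ^ 2 * ∫ x in (0:ℝ)..2 * π, w (n + 2) t x i ^ 2 := by
    intro i
    obtain ⟨c, hc, h0⟩ := h.zero_coord n ht i
    exact poinc (fun s => (h.ds (n + 1) t ht s).coord i) (cont_coord (h.conts (n + 2) ht) i) hc h0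
  rw [NN, NN, int_norm_sq3 (h.conts _ ht), int_norm_sq3 (h.conts _ ht)]
  have := key 0; have := key 1; have := key 2
  linarith

lemma cdot (h : Sol T w) (i j : ℕ) : ContinuousOn (fun p : ℝ × ℝ => dot (w i p.1 p.2) (w j p.1 p.2))
    (Set.Ioo (-T) T ×ˢ Set.univ) := (h.cont i).dot' (h.cont j)

lemma cdet (h : Sol T w) (i j k : ℕ) :
    ContinuousOn (fun p : ℝ × ℝ => det3 (w i p.1 p.2) (w j p.1 p.2) (w k p.1 p.2))
    (Set.Ioo (-T) T ×ˢ Set.univ) := (h.cont i).det3' (h.cont j) (h.cont k)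

lemma deriv1 (h : Sol T w) {t : ℝ} (ht : t ∈ Set.Ioo (-T) T) : HasDerivAt (NN w 1) 0 t := by
  have := energy (I := Set.Ioo (-T) T) isOpen_Ioo (φ := fun t s => dot (w 1 t s) (w 1 t s))
    (R := fun _ _ => 0) (q := fun t s => 2 * det3 (w 1 t s) (w 0 t s) (w 2 t s))
    (qs := fun t s => 2 * det3 (w 1 t s) (w 0 t s) (w 3 t s))
    (fun t ht s => ((h.dt1 t ht s).dot' (h.dt1 t ht s)).congr_deriv (by
      simp only [det3, dot, cross3_0, cross3_1, cross3_2, PiLp.add_apply]; ring))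
    (fun t ht s => (((h.ds 1 t ht s).det3' (h.ds 0 t ht s) (h.ds 2 t ht s)).const_mul
      2).congr_deriv (by
      simp only [det3, dot, cross3_0, cross3_1, cross3_2]; ring))
    (h.cdot 1 1) (continuousOn_const.mul (h.cdet 1 0 3)) continuousOn_const
    (fun t ht => by simp only [h.per0 _ ht]) ht
  simp only [intervalIntegral.integral_zero, dot_self] at this
  exact this

lemma deriv2 (h : Sol T w) {t : ℝ} (ht : t ∈ Set.Ioo (-T) T) :
    HasDerivAt (fun t => ∫ s in (0:ℝ)..2 * π, (dot (w 2 t s) (w 2 t s) -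
      5 / 4 * (dot (w 1 t s) (w 1 t s) * dot (w 1 t s) (w 1 t s)))) 0 t := by
  have := energy (I := Set.Ioo (-T) T) isOpen_Ioo
    (φ := fun t s => dot (w 2 t s) (w 2 t s) -
      5 / 4 * (dot (w 1 t s) (w 1 t s) * dot (w 1 t s) (w 1 t s)))
    (R := fun _ _ => 0)
    (q := fun t s => 2 * det3 (w 2 t s) (w 0 t s) (w 3 t s)
      + 3 * (dot (w 1 t s) (w 1 t s) * det3 (w 0 t s) (w 1 t s) (w 2 t s)))
    (qs := fun t s => 2 * (det3 (w 2 t s) (w 1 t s) (w 3 t s) + det3 (w 2 t s) (w 0 t s) (w 4 t s))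
      + 3 * (2 * dot (w 1 t s) (w 2 t s) * det3 (w 0 t s) (w 1 t s) (w 2 t s)
        + dot (w 1 t s) (w 1 t s) * det3 (w 0 t s) (w 1 t s) (w 3 t s)))
    (fun t ht s => (((h.dt2 t ht s).dot' (h.dt2 t ht s)).sub
      ((((h.dt1 t ht s).dot' (h.dt1 t ht s)).mul
        ((h.dt1 t ht s).dot' (h.dt1 t ht s))).const_mul (5 / 4))).congr_deriv (by
      have e := det_split (a := w 2 t s) (c := w 3 t s)
        (by rw [dot_self, h.unit t ht s]; norm_num) (h.c01 ht s)
      rw [h.c02 ht, h.c03 ht] at e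
      simp only [det3, dot, cross3_0, cross3_1, cross3_2, PiLp.add_apply, PiLp.smul_apply,
        smul_eq_mul] at e ⊢
      linear_combination 2 * e))
    (fun t ht s => ((((h.ds 2 t ht s).det3' (h.ds 0 t ht s) (h.ds 3 t ht s)).const_mul
      2).add ((((h.ds 1 t ht s).dot' (h.ds 1 t ht s)).mul
        ((h.ds 0 t ht s).det3' (h.ds 1 t ht s) (h.ds 2 t ht s))).const_mul 3)).congr_deriv (by
      simp only [det3, dot, cross3_0, cross3_1, cross3_2]; ring))
    ((h.cdot 2 2).sub (continuousOn_const.mul ((h.cdot 1 1).mul (h.cdot 1 1))))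
    ((continuousOn_const.mul ((h.cdet 2 1 3).add (h.cdet 2 0 4))).add
      (continuousOn_const.mul (((continuousOn_const.mul (h.cdot 1 2)).mul (h.cdet 0 1 2)).add
        ((h.cdot 1 1).mul (h.cdet 0 1 3))))) continuousOn_const
    (fun t ht => by simp only [h.per0 _ ht]) ht
  simp only [intervalIntegral.integral_zero] at this
  exact this

/-- remainder in the third energy -/
def R3f (w : ℕ → ℝ → ℝ → R3) (t s : ℝ) : ℝ :=
  (28 * dot (w 1 t s) (w 3 t s) + 24 * dot (w 2 t s) (w 2 t s)) *
    det3 (w 0 t s) (w 1 t s) (w 3 t s)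
  + 12 * (dot (w 1 t s) (w 2 t s) * det3 (w 0 t s) (w 2 t s) (w 3 t s))

lemma contR3 (h : Sol T w) : ContinuousOn (fun p : ℝ × ℝ => R3f w p.1 p.2)
    (Set.Ioo (-T) T ×ˢ Set.univ) :=
  (((continuousOn_const.mul (h.cdot 1 3)).add (continuousOn_const.mul (h.cdot 2 2))).mul
    (h.cdet 0 1 3)).add (continuousOn_const.mul ((h.cdot 1 2).mul (h.cdet 0 2 3)))

lemma deriv3 (h : Sol T w) {t : ℝ} (ht : t ∈ Set.Ioo (-T) T) :
    HasDerivAt (NN w 3) (∫ s in (0:ℝ)..2 * π, R3f w t s) t := by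
  have := energy (I := Set.Ioo (-T) T) isOpen_Ioo
    (φ := fun t s => dot (w 3 t s) (w 3 t s))
    (R := R3f w)
    (q := fun t s => 2 * det3 (w 3 t s) (w 0 t s) (w 4 t s)
      + (-12) * (dot (w 1 t s) (w 2 t s) * det3 (w 0 t s) (w 1 t s) (w 3 t s)))
    (qs := fun t s => 2 * (det3 (w 3 t s) (w 1 t s) (w 4 t s) + det3 (w 3 t s) (w 0 t s) (w 5 t s))
      + (-12) * ((dot (w 2 t s) (w 2 t s) + dot (w 1 t s) (w 3 t s)) *
          det3 (w 0 t s) (w 1 t s) (w 3 t s)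
        + dot (w 1 t s) (w 2 t s) * (det3 (w 0 t s) (w 2 t s) (w 3 t s)
          + det3 (w 0 t s) (w 1 t s) (w 4 t s))))
    (fun t ht s => ((h.dt3 t ht s).dot' (h.dt3 t ht s)).congr_deriv (by
      have e := det_split (a := w 3 t s) (c := w 4 t s)
        (by rw [dot_self, h.unit t ht s]; norm_num) (h.c01 ht s)
      rw [h.c03 ht, h.c04 ht] at e
      simp only [R3f, det3, dot, cross3_0, cross3_1, cross3_2, PiLp.add_apply, PiLp.smul_apply,
        smul_eq_mul] at e ⊢
      linear_combination 4 * e))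
    (fun t ht s => ((((h.ds 3 t ht s).det3' (h.ds 0 t ht s) (h.ds 4 t ht s)).const_mul
      2).add ((((h.ds 1 t ht s).dot' (h.ds 2 t ht s)).mul
        ((h.ds 0 t ht s).det3' (h.ds 1 t ht s) (h.ds 3 t ht s))).const_mul (-12))).congr_deriv (by
      simp only [det3, dot, cross3_0, cross3_1, cross3_2]; ring))
    (h.cdot 3 3)
    ((continuousOn_const.mul ((h.cdet 3 1 4).add (h.cdet 3 0 5))).add
      (continuousOn_const.mul ((((h.cdot 2 2).add (h.cdot 1 3)).mul (h.cdet 0 1 3)).add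
        ((h.cdot 1 2).mul ((h.cdet 0 2 3).add (h.cdet 0 1 4)))))) h.contR3
    (fun t ht => by simp only [h.per0 _ ht]) ht
  simp only [dot_self] at this
  exact this


end Sol

lemma abs_int_le {f g : ℝ → ℝ} (hf : Continuous f) (hg : Continuous g) (h : ∀ s, |f s| ≤ g s) :
    |∫ s in (0:ℝ)..2 * π, f s| ≤ ∫ s in (0:ℝ)..2 * π, g s := by
  rw [abs_le]
  constructor
  · have := int_mono hg.neg hf (fun s => (abs_le.1 (h s)).1)
    simpa using this
  · exact int_mono hf hg (fun s => (abs_le.1 (h s)).2)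

lemma int_mul_le {f g : ℝ → ℝ} (hf : Continuous f) (hg : Continuous g) {S : ℝ}
    (h : ∀ s, f s ≤ S) (hg0 : ∀ s, 0 ≤ g s) :
    ∫ s in (0:ℝ)..2 * π, f s * g s ≤ S * ∫ s in (0:ℝ)..2 * π, g s := by
  have := int_mono (f := fun s => f s * g s) (g := fun s => S * g s) (by fun_prop) (by fun_prop)
    (fun s => mul_le_mul_of_nonneg_right (h s) (hg0 s))
  simpa using this

namespace Sol
variable {T : ℝ} {w : ℕ → ℝ → ℝ → R3}

lemma contn (h : Sol T w) (n : ℕ) {t : ℝ} (ht : t ∈ Set.Ioo (-T) T) :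
    Continuous (fun s => ‖w n t s‖ ^ 2) := (h.conts n ht).norm.pow 2

lemma contnn (h : Sol T w) (n : ℕ) {t : ℝ} (ht : t ∈ Set.Ioo (-T) T) :
    Continuous (fun s => ‖w n t s‖ ^ 2 * ‖w n t s‖ ^ 2) := (h.contn n ht).mul (h.contn n ht)

lemma nn1_le (h : Sol T w) (h0 : (0:ℝ) ∈ Set.Ioo (-T) T) {t : ℝ} (ht : t ∈ Set.Ioo (-T) T) :
    NN w 1 t ≤ NN w 1 0 := by
  have := gron (E := NN w 1) (E' := fun _ => 0) (C := 0) (fun t ht => h.deriv1 ht)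
    (by intro t _; simp) h0 ht
  simpa using this

lemma nn2_le (h : Sol T w) (h0 : (0:ℝ) ∈ Set.Ioo (-T) T) {t : ℝ} (ht : t ∈ Set.Ioo (-T) T) {B1 B2 : ℝ}
    (hB1 : NN w 1 0 ≤ B1) (hB2 : NN w 2 0 ≤ B2) :
    NN w 2 t ≤ 2 * B2 + 5 / 2 * B1 ^ 2 * (5 / 2 * B1 + 1) := by
  have hB10 : 0 ≤ B1 := (NN_nonneg w 1 0).trans hB1
  have key := gron (E' := fun _ => 0) (C := 0) (fun t ht => h.deriv2 ht)
    (by intro t _; simp) h0 ht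
  simp only [zero_mul, exp_zero, one_mul, dot_self] at key
  have split : ∀ t ∈ Set.Ioo (-T) T, ∫ s in (0:ℝ)..2 * π, (‖w 2 t s‖ ^ 2 -
      5 / 4 * (‖w 1 t s‖ ^ 2 * ‖w 1 t s‖ ^ 2)) = NN w 2 t - 5 / 4 *
        ∫ s in (0:ℝ)..2 * π, ‖w 1 t s‖ ^ 2 * ‖w 1 t s‖ ^ 2 := by
    intro t ht
    have := int_lin (h.contn 2 ht) (h.contnn 1 ht) 1 (-(5/4))
    rw [NN, sub_eq_add_neg, ← neg_mul, ← one_mul (∫ s in (0:ℝ)..2 * π, ‖w 2 t s‖ ^ 2)]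
    refine Eq.trans ?_ this
    congr 1; ext s; ring
  rw [split t ht, split 0 h0] at key
  have p0 : 0 ≤ ∫ s in (0:ℝ)..2 * π, ‖w 1 0 s‖ ^ 2 * ‖w 1 0 s‖ ^ 2 :=
    int_nonneg fun s => by positivity
  have hη : 0 < 1 / (5 / 2 * B1 + 1) := by positivity
  have p1 := int_mul_le (h.contn 1 ht) (h.contn 1 ht) (h.sup_w 0 ht hη) (fun s => by positivity)
  have n1 : NN w 1 t ≤ B1 := (h.nn1_le h0 ht).trans hB1
  have n10 := NN_nonneg w 1 t
  have n20 := NN_nonneg w 2 t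
  simp only [zero_add, Nat.reduceAdd] at p1
  change _ ≤ _ * NN w 1 t at p1
  have e1 : 1 / (5 / 2 * B1 + 1) * NN w 2 t + NN w 1 t / (1 / (5 / 2 * B1 + 1)) ≤
     1 / (5 / 2 * B1 + 1) * NN w 2 t + B1 * (5 / 2 * B1 + 1) := by
    rw [div_div_eq_mul_div, div_one]; gcongr
  have e2 : (1 / (5 / 2 * B1 + 1) * NN w 2 t + NN w 1 t / (1 / (5 / 2 * B1 + 1))) * NN w 1 t ≤
     (1 / (5 / 2 * B1 + 1) * NN w 2 t + B1 * (5 / 2 * B1 + 1)) * B1 := by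
    gcongr
  have e3 : 1 / (5 / 2 * B1 + 1) * B1 ≤ 2 / 5 := by
    rw [div_mul_eq_mul_div, div_le_div_iff₀ (by positivity) (by positivity)]; linarith
  have e4 := mul_le_mul_of_nonneg_right e3 n20
  nlinarith

lemma R3_bound (h : Sol T w) {t : ℝ} (ht : t ∈ Set.Ioo (-T) T) {A : ℝ} (s : ℝ)
    (hA : ‖w 1 t s‖ ^ 2 ≤ A) :
    |R3f w t s| ≤ 46 * A * ‖w 3 t s‖ ^ 2 + 18 * (‖w 2 t s‖ ^ 2 * ‖w 2 t s‖ ^ 2) := by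
  have hu := h.unit t ht s
  have a1 := abs_dot_le (w 1 t s) (w 3 t s)
  have a2 := abs_dot_le (w 2 t s) (w 2 t s)
  have a3 := abs_dot_le (w 1 t s) (w 2 t s)
  have a4 := abs_det3_le (w 0 t s) (w 1 t s) (w 3 t s)
  have a5 := abs_det3_le (w 0 t s) (w 2 t s) (w 3 t s)
  rw [hu, one_mul] at a4 a5
  unfold R3f
  set x := ‖w 1 t s‖
  set y := ‖w 2 t s‖
  set z := ‖w 3 t s‖
  have hx : 0 ≤ x := norm_nonneg _
  have hy : 0 ≤ y := norm_nonneg _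
  have hz : 0 ≤ z := norm_nonneg _
  have b1 : |(28 * dot (w 1 t s) (w 3 t s) + 24 * dot (w 2 t s) (w 2 t s)) *
    det3 (w 0 t s) (w 1 t s) (w 3 t s)| ≤ (28 * (x * z) + 24 * (y * y)) * (x * z) := by
    rw [abs_mul]
    gcongr
    refine (abs_add_le _ _).trans ?_
    rw [abs_mul, abs_mul]
    norm_num
    linarith
  have b2 : |12 * (dot (w 1 t s) (w 2 t s) * det3 (w 0 t s) (w 2 t s) (w 3 t s))| ≤
     12 * ((x * y) * (y * z)) := by
    rw [abs_mul, abs_mul]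
    norm_num
    gcongr
  refine (abs_add_le _ _).trans ((add_le_add b1 b2).trans ?_)
  have c1 : x ^ 2 * z ^ 2 ≤ A * z ^ 2 := by gcongr
  nlinarith [sq_nonneg (x * z - y * y)]

end Sol

/-- The a priori bound constant. -/
lemma apriori (T M : ℝ) : ∃ K : ℝ, 1 ≤ K ∧ ∀ w : ℕ → ℝ → ℝ → R3, Sol T w →
    (0:ℝ) ∈ Set.Ioo (-T) T → NN w 3 0 ≤ M ^ 2 → ∀ t ∈ Set.Ioo (-T) T, ∀ s,
      ‖w 1 t s‖ ≤ K ∧ ‖w 2 t s‖ ≤ K := by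
  set B2 := 16 * π ^ 2 * M ^ 2 with hB2
  set B1 := 16 * π ^ 2 * B2 with hB1
  have hB20 : 0 ≤ B2 := by positivity
  have hB10 : 0 ≤ B1 := by positivity
  set A2 := 2 * B2 + 5 / 2 * B1 ^ 2 * (5 / 2 * B1 + 1) with hA2
  have hA20 : 0 ≤ A2 := by positivity
  set C := 46 * (A2 + B1) + 18 * A2 + 18 * A2 ^ 2 with hC
  have hC0 : 0 ≤ C := by positivity
  set A3 := exp (C * |T|) * (M ^ 2 + 1) with hA3
  have hA30 : 0 ≤ A3 := by positivity
  refine ⟨1 + A2 + B1 + A3, by linarith, ?_⟩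
  intro w h h0 hM
  have n2 : NN w 2 0 ≤ B2 := (h.poinc_w 1 h0).trans (by rw [hB2]; gcongr)
  have n1 : NN w 1 0 ≤ B1 := (h.poinc_w 0 h0).trans (by rw [hB1]; gcongr)
  have n1t : ∀ t ∈ Set.Ioo (-T) T, NN w 1 t ≤ B1 := fun t ht => (h.nn1_le h0 ht).trans n1
  have n2t : ∀ t ∈ Set.Ioo (-T) T, NN w 2 t ≤ A2 := fun t ht => h.nn2_le h0 ht n1 n2
  have s1 : ∀ t ∈ Set.Ioo (-T) T, ∀ s, ‖w 1 t s‖ ^ 2 ≤ A2 + B1 := by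
    intro t ht s
    have := h.sup_w 0 ht one_pos s
    have := n1t t ht
    have := n2t t ht
    simp only [zero_add, Nat.reduceAdd, one_mul, div_one] at *
    linarith
  have s2 : ∀ t ∈ Set.Ioo (-T) T, ∀ s, ‖w 2 t s‖ ^ 2 ≤ NN w 3 t + A2 := by
    intro t ht s
    have := h.sup_w 1 ht one_pos s
    have := n2t t ht
    simp only [Nat.reduceAdd, one_mul, div_one] at *
    linarith
  have n3t : ∀ t ∈ Set.Ioo (-T) T, NN w 3 t ≤ A3 := by
    intro t ht
    have := gron (E := fun t => NN w 3 t + 1) (E' := fun t => ∫ s in (0:ℝ)..2 * π, Sol.R3f w t s)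
      (C := C) (fun t ht => (h.deriv3 ht).add_const 1) (by
        intro t ht
        have i1 := abs_int_le (g := fun s => 46 * (A2 + B1) * ‖w 3 t s‖ ^ 2
            + 18 * (‖w 2 t s‖ ^ 2 * ‖w 2 t s‖ ^ 2)) (slice_cont h.contR3 ht)
          ((continuous_const.mul (h.contn 3 ht)).add
            (continuous_const.mul (h.contnn 2 ht)))
          (fun s => h.R3_bound ht s (s1 t ht s))
        rw [int_lin (h.contn 3 ht) (h.contnn 2 ht)] at i1
        have i2 := int_mul_le (h.contn 2 ht) (h.contn 2 ht) (s2 t ht) (fun s => by positivity)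
        change _ ≤ _ * NN w 2 t at i2
        change _ ≤ _ * NN w 3 t + _ at i1
        have m2 := n2t t ht
        have m20 := NN_nonneg w 2 t
        have m30 := NN_nonneg w 3 t
        have i3 : (NN w 3 t + A2) * NN w 2 t ≤ (NN w 3 t + A2) * A2 := by gcongr
        refine i1.trans ?_
        rw [hC]
        have q1 : 0 ≤ A2 ^ 2 * NN w 3 t := by positivity
        nlinarith) h0 ht
    have e : exp (C * |t - 0|) * (NN w 3 0 + 1) ≤ A3 := by
      rw [hA3]
      have : |t - 0| ≤ |T| := by
        rw [sub_zero]
        exact (abs_le.2 ⟨ht.1.le, ht.2.le⟩).trans (le_abs_self _)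
      have := NN_nonneg w 3 0
      gcongr
    have := NN_nonneg w 3 t
    linarith
  intro t ht s
  have q1 := s1 t ht s
  have q2 := s2 t ht s
  have q3 := n3t t ht
  constructor <;> nlinarith [norm_nonneg (w 1 t s), norm_nonneg (w 2 t s)]


/-! ### The curve -/

/-- A curve evolving by the binormal flow whose tangent is the solution. -/
structure Curve (T : ℝ) (w : ℕ → ℝ → ℝ → R3) (γ : ℝ → ℝ → R3) : Prop where
  smooth : ContDiffOn ℝ (⊤ : ℕ∞) (fun p : ℝ × ℝ => γ p.1 p.2) (strip T)
  ds : ∀ t ∈ Set.Ioo (-T) T, ∀ s, HasDerivAt (γ t) (w 0 t s) s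
  dt : ∀ t ∈ Set.Ioo (-T) T, ∀ s, HasDerivAt (fun τ => γ τ s) (cross3 (w 0 t s) (w 1 t s)) t

lemma fderiv_split {F : ℝ × ℝ → R3} {p : ℝ × ℝ} (x : ℝ × ℝ) :
    fderiv ℝ F p x = x.1 • Dt F p + x.2 • Ds F p := by
  have : x = x.1 • ((1:ℝ), (0:ℝ)) + x.2 • ((0:ℝ), (1:ℝ)) := by ext <;> simp
  conv_lhs => rw [this]
  rw [map_add, map_smul, map_smul, Dt, Ds]

lemma convex_strip (T : ℝ) : Convex ℝ (strip T) := (convex_Ioo _ _).prod convex_univ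

lemma exists_curve {T : ℝ} {w : ℕ → ℝ → ℝ → R3} (h : Sol T w) : ∃ γ, Curve T w γ ∧ γ 0 0 = 0 := by
  set W : ℝ × ℝ → R3 := fun p => w 0 p.1 p.2 with hW
  set B : ℝ × ℝ → R3 := fun p => cross3 (w 0 p.1 p.2) (w 1 p.1 p.2) with hB
  have hWs : ContDiffOn ℝ (⊤ : ℕ∞) W (strip T) := h.smooth 0
  have hBs : ContDiffOn ℝ (⊤ : ℕ∞) B (strip T) := (h.smooth 0).cross3' (h.smooth 1)
  set L1 := ContinuousLinearMap.smulRightL ℝ (ℝ × ℝ) R3 (ContinuousLinearMap.fst ℝ ℝ ℝ) with hL1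
  set L2 := ContinuousLinearMap.smulRightL ℝ (ℝ × ℝ) R3 (ContinuousLinearMap.snd ℝ ℝ ℝ) with hL2
  have a1 : ∀ b x, L1 b x = x.1 • b := fun _ _ => rfl
  have a2 : ∀ b x, L2 b x = x.2 • b := fun _ _ => rfl
  set ω : ℝ × ℝ → (ℝ × ℝ →L[ℝ] R3) := fun p => L1 (B p) + L2 (W p) with hω
  have hωs : ContDiffOn ℝ (⊤ : ℕ∞) ω (strip T) :=
    (L1.contDiff.comp_contDiffOn hBs).add (L2.contDiff.comp_contDiffOn hWs)
  have hsym : ∀ a ∈ strip T, ∀ x y, fderiv ℝ ω a x y = fderiv ℝ ω a y x := by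
    rintro ⟨t, s⟩ ha x y
    have ht := mem_strip.1 ha
    have dB := smooth_diffAt (s := s) hBs ht
    have dW := smooth_diffAt (s := s) hWs ht
    have e : HasFDerivAt ω (L1.comp (fderiv ℝ B (t, s)) + L2.comp (fderiv ℝ W (t, s))) (t, s) :=
      (L1.hasFDerivAt.comp _ dB.hasFDerivAt).add (L2.hasFDerivAt.comp _ dW.hasFDerivAt)
    rw [e.fderiv]
    have e1 : Dt W (t, s) = Ds B (t, s) := by
      have a1 := (hasDerivAt_Dt dW).unique (h.dt0 t ht s)
      have a2 := (hasDerivAt_Ds dB).unique ((h.ds 0 t ht s).cross3' (h.ds 1 t ht s))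
      rw [a1, a2]
      simp [cross3_self]
    simp only [add_apply, ContinuousLinearMap.comp_apply, a1, a2, fderiv_split, e1]
    module
  obtain ⟨f, hf⟩ := (convex_strip T).exists_forall_hasFDerivAt_of_fderiv_symmetric
    (isOpen_strip T) (hωs.differentiableOn (by simp)) hsym
  have hfs : ContDiffOn ℝ (⊤ : ℕ∞) f (strip T) := by
    rw [contDiffOn_infty_iff_fderiv_of_isOpen (isOpen_strip T)]
    exact ⟨fun a ha => (hf a ha).differentiableAt.differentiableWithinAt,
      hωs.congr fun a ha => (hf a ha).fderiv⟩
  refine ⟨fun t s => f (t, s) - f (0, 0), ⟨hfs.sub contDiffOn_const, ?_, ?_⟩, by simp⟩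
  · intro t ht s
    have hd := hf (t, s) (mem_strip.2 ht)
    have := hasDerivAt_Ds hd.differentiableAt
    rw [Ds, hd.fderiv] at this
    simp only [hω, add_apply, a1, a2, zero_smul, one_smul, zero_add] at this
    exact this.sub_const _
  · intro t ht s
    have hd := hf (t, s) (mem_strip.2 ht)
    have := hasDerivAt_Dt hd.differentiableAt
    rw [Dt, hd.fderiv] at this
    simp only [hω, add_apply, a1, a2, zero_smul, one_smul, add_zero] at this
    exact this.sub_const _

/-- the holonomy of the curve is constant -/
lemma Curve.holonomy {T : ℝ} {w : ℕ → ℝ → ℝ → R3} {γ : ℝ → ℝ → R3} (h : Sol T w)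
    (hγ : Curve T w γ) (h0 : (0:ℝ) ∈ Set.Ioo (-T) T) :
    ∀ t ∈ Set.Ioo (-T) T, ∀ s, γ t (s + 2 * π) - γ t s = γ 0 (2 * π) - γ 0 0 := by
  have e1 : ∀ t ∈ Set.Ioo (-T) T, ∀ s, γ t (s + 2 * π) - γ t s = γ t (2 * π) - γ t 0 := by
    intro t ht s
    have hd : ∀ s, HasDerivAt (fun s => γ t (s + 2 * π) - γ t s) 0 s := by
      intro s
      have := (HasDerivAt.comp_add_const s (2 * π) (hγ.ds t ht (s + 2 * π))).sub (hγ.ds t ht s)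
      rwa [h.per 0 t ht, sub_self] at this
    have := is_const_of_deriv_eq_zero (fun s => (hd s).differentiableAt) (fun s => (hd s).deriv) s 0
    simpa using this
  intro t ht s
  rw [e1 t ht s]
  have hd : ∀ t ∈ Set.Ioo (-T) T, HasDerivAt (fun t => γ t (2 * π) - γ t 0) 0 t := by
    intro t ht
    have := (hγ.dt t ht (2 * π)).sub (hγ.dt t ht 0)
    rwa [h.per0 0 ht, h.per0 1 ht, sub_self] at this
  exact (convex_Ioo (-T) T).is_const_of_fderivWithin_eq_zero (𝕜 := ℝ)
    (fun t ht => (hd t ht).differentiableAt.differentiableWithinAt)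
    (fun t ht => by
      rw [fderivWithin_of_isOpen isOpen_Ioo ht, (hd t ht).hasFDerivAt.fderiv]; simp) ht h0

/-- All the data entering the comparison of two solutions. -/
structure Dat (T K : ℝ) (w x : ℕ → ℝ → ℝ → R3) (g G : ℝ → ℝ → R3) (δ : R3) : Prop where
  zero : (0:ℝ) ∈ Set.Ioo (-T) T
  K1 : 1 ≤ K
  hw : Sol T w
  hx : Sol T x
  b1 : ∀ t ∈ Set.Ioo (-T) T, ∀ s, ‖w 1 t s‖ ≤ K
  b2 : ∀ t ∈ Set.Ioo (-T) T, ∀ s, ‖w 2 t s‖ ≤ K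
  hG : Curve T x G
  gsmooth : ContDiffOn ℝ (⊤ : ℕ∞) (fun p : ℝ × ℝ => g p.1 p.2) (strip T)
  gs : ∀ t ∈ Set.Ioo (-T) T, ∀ s, HasDerivAt (g t) (w 0 t s + δ) s
  gt : ∀ t ∈ Set.Ioo (-T) T, ∀ s, HasDerivAt (fun τ => g τ s) (cross3 (w 0 t s) (w 1 t s)) t
  per : ∀ t ∈ Set.Ioo (-T) T, ∀ s σ, G t (s + 2 * π) - g t (σ + 2 * π) = G t s - g t σ

/-- vector version of `poinc_sup` -/
lemma vec_sup {y y' : ℝ → R3} (hd : ∀ s, HasDerivAt y (y' s) s) (hc : Continuous y')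
    (h0 : y 0 = 0) {s : ℝ} (hs : s ∈ Set.Icc 0 (2 * π)) :
    ‖y s‖ ^ 2 ≤ 8 * π * ∫ x in (0:ℝ)..2 * π, ‖y' x‖ ^ 2 := by
  have := fun i : Fin 3 => poinc_sup (fun s => (hd s).coord i) (cont_coord hc i)
    (c := 0) ⟨le_rfl, by positivity⟩ (by rw [h0]; simp) hs
  have a := this 0; have b := this 1; have c := this 2
  rw [int_norm_sq3 hc, norm_sq3]
  linarith

lemma exists_dat {T K : ℝ} {w x : ℕ → ℝ → ℝ → R3} (h0 : (0:ℝ) ∈ Set.Ioo (-T) T) (hK : 1 ≤ K)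
    (hw : Sol T w) (hx : Sol T x)
    (hb : ∀ t ∈ Set.Ioo (-T) T, ∀ s, ‖w 1 t s‖ ≤ K ∧ ‖w 2 t s‖ ≤ K) :
    ∃ g G δ, Dat T K w x g G δ ∧
      ‖δ‖ ≤ sqrt (∫ s in (0:ℝ)..2 * π, ‖x 0 0 s - w 0 0 s‖ ^ 2) ∧
      ∀ s, ‖G 0 s - g 0 s‖ ≤ 13 * sqrt (∫ s in (0:ℝ)..2 * π, ‖x 0 0 s - w 0 0 s‖ ^ 2) := by
  obtain ⟨γ, hγ, hγ0⟩ := exists_curve hw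
  obtain ⟨G, hG, hG0⟩ := exists_curve hx
  have o1 := hγ.holonomy hw h0
  have o2 := hG.holonomy hx h0
  set A := ∫ s in (0:ℝ)..2 * π, ‖x 0 0 s - w 0 0 s‖ ^ 2 with hA
  have hA0 : 0 ≤ A := int_nonneg fun s => by positivity
  set d : ℝ → R3 := fun s => G 0 s - γ 0 s with hd
  have hdd : ∀ s ∈ Set.Icc 0 (2 * π), ‖d s‖ ^ 2 ≤ 8 * π * A := fun s hs =>
    vec_sup (y := d) (fun s => (hG.ds 0 h0 s).sub (hγ.ds 0 h0 s))
      ((hx.conts 0 h0).sub (hw.conts 0 h0)) (by simp [hd, hγ0, hG0]) hs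
  have p3 := pi_gt_three
  have p4 := pi_lt_four
  set δ : R3 := (2 * π)⁻¹ • d (2 * π) with hδ
  have hδ2 : (2 * π) • δ = d (2 * π) := by
    rw [hδ, smul_smul, mul_inv_cancel₀ (by positivity), one_smul]
  have hdn : ∀ s ∈ Set.Icc 0 (2 * π), ‖d s‖ ≤ 6 * sqrt A := by
    intro s hs
    apply le_of_sq_le_sq _ (by positivity)
    rw [mul_pow, sq_sqrt hA0]
    nlinarith [hdd s hs]
  have hδn : ‖δ‖ ≤ sqrt A := by
    have := hdn (2 * π) ⟨by positivity, le_rfl⟩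
    rw [← hδ2, norm_smul, Real.norm_of_nonneg (by positivity)] at this
    nlinarith [norm_nonneg δ]
  have hper : ∀ t ∈ Set.Ioo (-T) T, ∀ s σ, G t (s + 2 * π) - (γ t (σ + 2 * π) + (σ + 2 * π) • δ)
      = G t s - (γ t σ + σ • δ) := by
    intro t ht s σ
    have a := o1 t ht σ
    have b := o2 t ht s
    have c : d (2 * π) = G 0 (2 * π) - γ 0 (2 * π) := rfl
    rw [hγ0, sub_zero] at a
    rw [hG0, sub_zero] at b
    rw [← hδ2] at c
    rw [add_smul, c, ← a, ← b]
    abel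
  refine ⟨fun t s => γ t s + s • δ, G, δ, ⟨h0, hK, hw, hx, fun t ht s => (hb t ht s).1,
    fun t ht s => (hb t ht s).2, hG, ?_, ?_, ?_, hper⟩, hδn, ?_⟩
  · exact hγ.smooth.add (ContDiff.contDiffOn (by fun_prop))
  · intro t ht s
    have := (hγ.ds t ht s).add ((hasDerivAt_id s).smul_const δ)
    rwa [one_smul] at this
  · intro t ht s
    exact (hγ.dt t ht s).add_const _
  · intro s
    have hp : Function.Periodic (fun s => G 0 s - (γ 0 s + s • δ)) (2 * π) :=
      fun s => hper 0 h0 s s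
    obtain ⟨s', hs', hss⟩ := hp.exists_mem_Ico₀ (by positivity) s
    rw [hss]
    have e : G 0 s' - (γ 0 s' + s' • δ) = d s' - s' • δ := by simp [hd]; abel
    rw [e]
    refine (norm_sub_le _ _).trans ?_
    have a := hdn s' ⟨hs'.1, hs'.2.le⟩
    rw [norm_smul, Real.norm_of_nonneg hs'.1]
    have b : s' * ‖δ‖ ≤ 2 * π * sqrt A := by
      gcongr
      exact hs'.2.le
    have : π < 3.15 := pi_lt_d2
    nlinarith [sqrt_nonneg A]


/-! ### The implicit function -/

/-- orthogonality defect -/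
def Gf (w : ℕ → ℝ → ℝ → R3) (g G : ℝ → ℝ → R3) (δ : R3) (t s σ : ℝ) : ℝ :=
  dot (G t s - g t σ) (w 0 t σ + δ)

/-- its negative derivative -/
def Jf (w : ℕ → ℝ → ℝ → R3) (g G : ℝ → ℝ → R3) (δ : R3) (t s σ : ℝ) : ℝ :=
  dot (w 0 t σ + δ) (w 0 t σ + δ) - dot (G t s - g t σ) (w 1 t σ)

lemma invertible_of_ne {L : ℝ →L[ℝ] ℝ} (h : L 1 ≠ 0) : L.IsInvertible := by
  refine ⟨ContinuousLinearEquiv.unitsEquivAut ℝ (Units.mk0 (L 1) h), ?_⟩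
  ext
  simp

namespace Dat
variable {T K : ℝ} {w x : ℕ → ℝ → ℝ → R3} {g G : ℝ → ℝ → R3} {δ : R3}

lemma hasDerivAt_Gf (D : Dat T K w x g G δ) {t : ℝ} (ht : t ∈ Set.Ioo (-T) T) (s σ : ℝ) :
    HasDerivAt (Gf w g G δ t s) (-Jf w g G δ t s σ) σ := by
  have := ((D.gs t ht σ).const_sub (G t s)).dot' ((D.hw.ds 0 t ht σ).add_const δ)
  refine this.congr_deriv ?_
  simp only [Jf, dot, PiLp.sub_apply, PiLp.add_apply, PiLp.neg_apply, zero_add]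
  ring

lemma p_le (D : Dat T K w x g G δ) (hδ : ‖δ‖ ≤ 1 / 16) {t : ℝ} (ht : t ∈ Set.Ioo (-T) T) (σ : ℝ) :
    ‖w 0 t σ + δ‖ ≤ 2 := by
  refine (norm_add_le _ _).trans ?_
  rw [D.hw.unit t ht]; linarith

lemma pp_ge (D : Dat T K w x g G δ) (hδ : ‖δ‖ ≤ 1 / 16) {t : ℝ} (ht : t ∈ Set.Ioo (-T) T) (σ : ℝ) :
    3 / 4 ≤ dot (w 0 t σ + δ) (w 0 t σ + δ) := by
  rw [dot_self]
  have h1 : ‖w 0 t σ‖ ≤ ‖w 0 t σ + δ‖ + ‖δ‖ := by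
    have := norm_sub_le (w 0 t σ + δ) δ
    simpa using this
  rw [D.hw.unit t ht] at h1
  nlinarith

lemma J_ge (D : Dat T K w x g G δ) (hδ : ‖δ‖ ≤ 1 / 16) {t : ℝ} (ht : t ∈ Set.Ioo (-T) T) {s σ : ℝ}
    (hy : ‖G t s - g t σ‖ * (4 * K) ≤ 1) : 1 / 2 ≤ Jf w g G δ t s σ := by
  have h1 := D.pp_ge hδ ht σ
  have h2 := (abs_le.1 (abs_dot_le (G t s - g t σ) (w 1 t σ))).2
  have h3 := mul_le_mul_of_nonneg_left (D.b1 t ht σ) (norm_nonneg (G t s - g t σ))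
  unfold Jf
  linarith

lemma g_lip (D : Dat T K w x g G δ) (hδ : ‖δ‖ ≤ 1 / 16) {t : ℝ} (ht : t ∈ Set.Ioo (-T) T)
    (σ σ' : ℝ) : ‖g t σ - g t σ'‖ ≤ 2 * |σ - σ'| :=
  convex_univ.norm_image_sub_le_of_norm_hasDerivWithin_le
    (fun σ _ => (D.gs t ht σ).hasDerivWithinAt) (fun σ _ => D.p_le hδ ht σ) trivial trivial

lemma w_lip (D : Dat T K w x g G δ) {t : ℝ} (ht : t ∈ Set.Ioo (-T) T)
    (σ σ' : ℝ) : ‖w 0 t σ - w 0 t σ'‖ ≤ K * |σ - σ'| :=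
  convex_univ.norm_image_sub_le_of_norm_hasDerivWithin_le
    (fun σ _ => (D.hw.ds 0 t ht σ).hasDerivWithinAt) (fun σ _ => D.b1 t ht σ) trivial trivial

lemma zone (D : Dat T K w x g G δ) (hδ : ‖δ‖ ≤ 1 / 16) {t : ℝ} (ht : t ∈ Set.Ioo (-T) T)
    {s τ σ ρ : ℝ} (hρ : ρ * (44 * K) = 1) (hn : ‖G t s - g t (s + τ)‖ < ρ)
    (hσ : |σ - (s + τ)| ≤ 5 * ρ) : ‖G t s - g t σ‖ * (4 * K) ≤ 1 := by
  have h1 := norm_sub_le (G t s - g t (s + τ)) (g t σ - g t (s + τ))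
  have h2 := D.g_lip hδ ht σ (s + τ)
  rw [sub_sub_sub_cancel_right] at h1
  have := D.K1
  have h3 : ‖G t s - g t σ‖ ≤ 11 * ρ := by linarith
  have h4 := mul_le_mul_of_nonneg_right h3 (by linarith : 0 ≤ 4 * K)
  linarith

lemma slope (D : Dat T K w x g G δ) (hδ : ‖δ‖ ≤ 1 / 16) {t : ℝ} (ht : t ∈ Set.Ioo (-T) T)
    {s τ ρ : ℝ} (hρ : ρ * (44 * K) = 1) (hn : ‖G t s - g t (s + τ)‖ < ρ) {a b : ℝ}
    (ha : |a - (s + τ)| ≤ 5 * ρ) (hb : |b - (s + τ)| ≤ 5 * ρ) (hab : a ≤ b) :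
    Gf w g G δ t s b - Gf w g G δ t s a ≤ -(1 / 2) * (b - a) := by
  have hd := D.hasDerivAt_Gf ht s
  refine (convex_Icc (s + τ - 5 * ρ) (s + τ + 5 * ρ)).image_sub_le_mul_sub_of_deriv_le
    (fun σ _ => (hd σ).continuousAt.continuousWithinAt)
    (fun σ _ => (hd σ).differentiableAt.differentiableWithinAt) ?_ a ?_ b ?_ hab
  · intro σ hσ
    have hσ := interior_subset hσ
    rw [(hd σ).deriv]
    have := D.J_ge hδ ht (D.zone hδ ht hρ hn (σ := σ)
      (abs_le.2 ⟨by linarith [hσ.1], by linarith [hσ.2]⟩))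
    linarith
  · have := abs_le.1 ha; exact ⟨by linarith, by linarith⟩
  · have := abs_le.1 hb; exact ⟨by linarith, by linarith⟩

lemma uniq (D : Dat T K w x g G δ) (hδ : ‖δ‖ ≤ 1 / 16) {t : ℝ} (ht : t ∈ Set.Ioo (-T) T)
    {s τ ρ : ℝ} (hρ : ρ * (44 * K) = 1) (hn : ‖G t s - g t (s + τ)‖ < ρ) {a b : ℝ}
    (ha : |a - (s + τ)| ≤ 5 * ρ) (hb : |b - (s + τ)| ≤ 5 * ρ)
    (ha0 : Gf w g G δ t s a = 0) (hb0 : Gf w g G δ t s b = 0) : a = b := by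
  rcases le_total a b with h | h
  · have := D.slope hδ ht hρ hn ha hb h
    rw [ha0, hb0] at this
    linarith
  · have := D.slope hδ ht hρ hn hb ha h
    rw [ha0, hb0] at this
    linarith

lemma exists_zero (D : Dat T K w x g G δ) (hδ : ‖δ‖ ≤ 1 / 16) {t : ℝ} (ht : t ∈ Set.Ioo (-T) T)
    {s τ ρ : ℝ} (hρ : ρ * (44 * K) = 1) (hn : ‖G t s - g t (s + τ)‖ < ρ) :
    ∃ σ, |σ - (s + τ)| ≤ 4 * ‖G t s - g t (s + τ)‖ ∧ Gf w g G δ t s σ = 0 := by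
  have hd := D.hasDerivAt_Gf ht s
  have hρ0 : 0 < ρ := lt_of_le_of_lt (norm_nonneg _) hn
  have h0 : |Gf w g G δ t s (s + τ)| ≤ 2 * ‖G t s - g t (s + τ)‖ := by
    have := abs_dot_le (G t s - g t (s + τ)) (w 0 t (s + τ) + δ)
    have h2 := mul_le_mul_of_nonneg_left (D.p_le hδ ht (s + τ)) (norm_nonneg (G t s - g t (s + τ)))
    unfold Gf; linarith
  have z0 : |s + τ - (s + τ)| ≤ 5 * ρ := by simp; positivity
  have zm : |s + τ - 5 * ρ - (s + τ)| ≤ 5 * ρ := by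
    rw [abs_le]; constructor <;> linarith
  have zp : |s + τ + 5 * ρ - (s + τ)| ≤ 5 * ρ := by
    rw [abs_le]; constructor <;> linarith
  have s1 := D.slope hδ ht hρ hn zm z0 (by linarith)
  have s2 := D.slope hδ ht hρ hn z0 zp (by linarith)
  have h0' := abs_le.1 h0
  obtain ⟨σ, hσ, hz⟩ := intermediate_value_Icc' (f := Gf w g G δ t s)
    (by linarith : s + τ - 5 * ρ ≤ s + τ + 5 * ρ)
    (fun σ _ => (hd σ).continuousAt.continuousWithinAt)
    (show (0:ℝ) ∈ _ from ⟨by linarith, by linarith⟩)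
  refine ⟨σ, ?_, hz⟩
  have zσ : |σ - (s + τ)| ≤ 5 * ρ := abs_le.2 ⟨by linarith [hσ.1], by linarith [hσ.2]⟩
  rw [abs_le]
  rcases le_total σ (s + τ) with h | h
  · have := D.slope hδ ht hρ hn zσ z0 h
    constructor <;> linarith
  · have := D.slope hδ ht hρ hn z0 zσ h
    constructor <;> linarith

lemma ift (D : Dat T K w x g G δ) {t : ℝ} (ht : t ∈ Set.Ioo (-T) T) {s σ : ℝ}
    (hz : Gf w g G δ t s σ = 0) (hJ : Jf w g G δ t s σ ≠ 0) :
    ∃ ψ : ℝ × ℝ → ℝ, DifferentiableAt ℝ ψ (t, s) ∧ ψ (t, s) = σ ∧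
      ∀ᶠ q in nhds (t, s), Gf w g G δ q.1 q.2 (ψ q) = 0 := by
  set F : (ℝ × ℝ) × ℝ → ℝ := fun q => Gf w g G δ q.1.1 q.1.2 q.2 with hF
  have nh : ∀ s, strip T ∈ nhds (t, s) := fun s => (isOpen_strip T).mem_nhds (mem_strip.2 ht)
  have cG : ContDiffAt ℝ (⊤ : ℕ∞) (fun q : (ℝ × ℝ) × ℝ => G q.1.1 q.1.2) ((t, s), σ) :=
    ContDiffAt.comp (f := fun q : (ℝ × ℝ) × ℝ => q.1) (g := fun p : ℝ × ℝ => G p.1 p.2) ((t, s), σ)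
      (D.hG.smooth.contDiffAt (nh s)) contDiffAt_fst
  have cg : ContDiffAt ℝ (⊤ : ℕ∞) (fun q : (ℝ × ℝ) × ℝ => g q.1.1 q.2) ((t, s), σ) :=
    ContDiffAt.comp (f := fun q : (ℝ × ℝ) × ℝ => (q.1.1, q.2)) (g := fun p : ℝ × ℝ => g p.1 p.2)
      ((t, s), σ) (D.gsmooth.contDiffAt (nh σ)) (by fun_prop)
  have cw : ContDiffAt ℝ (⊤ : ℕ∞) (fun q : (ℝ × ℝ) × ℝ => w 0 q.1.1 q.2) ((t, s), σ) :=
    ContDiffAt.comp (f := fun q : (ℝ × ℝ) × ℝ => (q.1.1, q.2)) (g := fun p : ℝ × ℝ => w 0 p.1 p.2)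
      ((t, s), σ) ((D.hw.smooth 0).contDiffAt (nh σ)) (by fun_prop)
  have cF : ContDiffAt ℝ (⊤ : ℕ∞) F ((t, s), σ) := by
    simp only [hF, Gf, dot_eq_inner]
    exact (cG.sub cg).inner ℝ (cw.add contDiffAt_const)
  have hs := cF.hasStrictFDerivAt (by simp)
  have hinv : (fderiv ℝ F ((t, s), σ) ∘L .inr ℝ (ℝ × ℝ) ℝ).IsInvertible := by
    apply invertible_of_ne
    have e : HasDerivAt (fun σ => F ((t, s), σ)) (fderiv ℝ F ((t, s), σ) ((0, 0), 1)) σ :=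
      hs.hasFDerivAt.comp_hasDerivAt σ ((hasDerivAt_const σ (t, s)).prodMk (hasDerivAt_id σ))
    have e2 := e.unique (D.hasDerivAt_Gf ht s σ)
    have : (fderiv ℝ F ((t, s), σ) ∘L .inr ℝ (ℝ × ℝ) ℝ) 1 = fderiv ℝ F ((t, s), σ) ((0, 0), 1) := rfl
    rw [this, e2]
    exact neg_ne_zero.2 hJ
  refine ⟨hs.implicitFunctionOfProdDomain hinv,
    (hs.hasStrictFDerivAt_implicitFunctionOfProdDomain hinv).hasFDerivAt.differentiableAt,
    (hs.eventually_apply_eq_iff_implicitFunctionOfProdDomain hinv).self_of_nhds.1 rfl, ?_⟩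
  have := hs.eventually_apply_implicitFunctionOfProdDomain hinv
  have hz' : F ((t, s), σ) = 0 := hz
  rw [hz'] at this
  exact this

end Dat

/-- Branch of the implicit function over a time interval. -/
structure Branch (T K : ℝ) (w x : ℕ → ℝ → ℝ → R3) (g G : ℝ → ℝ → R3) (δ : R3) (τ ρ : ℝ)
    (I : Set ℝ) (σ : ℝ → ℝ → ℝ) : Prop where
  sub : I ⊆ Set.Ioo (-T) T
  isOpen : IsOpen I
  near : ∀ t ∈ I, ∀ s, |σ t s - (s + τ)| ≤ 4 * ‖G t s - g t (s + τ)‖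
  near5 : ∀ t ∈ I, ∀ s, |σ t s - (s + τ)| ≤ 5 * ρ
  zero : ∀ t ∈ I, ∀ s, Gf w g G δ t s (σ t s) = 0
  small : ∀ t ∈ I, ∀ s, ‖G t s - g t (σ t s)‖ * (4 * K) ≤ 1
  diff : ∀ t ∈ I, ∀ s, DifferentiableAt ℝ (fun q : ℝ × ℝ => σ q.1 q.2) (t, s)
  per : ∀ t ∈ I, ∀ s, σ t (s + 2 * π) = σ t s + 2 * π

lemma Dat.exists_branch {T K : ℝ} {w x : ℕ → ℝ → ℝ → R3} {g G : ℝ → ℝ → R3} {δ : R3}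
    (D : Dat T K w x g G δ) (hδ : ‖δ‖ ≤ 1 / 16) {τ ρ : ℝ} (hρ : ρ * (44 * K) = 1) {I : Set ℝ}
    (hI : IsOpen I) (hIT : I ⊆ Set.Ioo (-T) T)
    (hn : ∀ t ∈ I, ∀ s, ‖G t s - g t (s + τ)‖ < ρ) :
    ∃ σ, Branch T K w x g G δ τ ρ I σ := by
  have hρ0 : 0 < ρ := by
    have := D.K1
    by_contra h
    push Not at h
    nlinarith
  have ex : ∀ t s, ∃ σ, t ∈ I → |σ - (s + τ)| ≤ 4 * ‖G t s - g t (s + τ)‖ ∧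
      Gf w g G δ t s σ = 0 := by
    intro t s
    by_cases h : t ∈ I
    · obtain ⟨σ, hσ⟩ := D.exists_zero hδ (hIT h) hρ (hn t h s)
      exact ⟨σ, fun _ => hσ⟩
    · exact ⟨0, fun h' => absurd h' h⟩
  choose σ hσ using ex
  have near5 : ∀ t ∈ I, ∀ s, |σ t s - (s + τ)| < 5 * ρ := fun t ht s =>
    lt_of_le_of_lt (hσ t s ht).1 (by linarith [hn t ht s])
  have small : ∀ t ∈ I, ∀ s, ‖G t s - g t (σ t s)‖ * (4 * K) ≤ 1 := fun t ht s =>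
    D.zone hδ (hIT ht) hρ (hn t ht s) (near5 t ht s).le
  refine ⟨σ, hIT, hI, fun t ht s => (hσ t s ht).1, fun t ht s => (near5 t ht s).le,
    fun t ht s => (hσ t s ht).2, small, ?_, ?_⟩
  · intro t ht s
    obtain ⟨ψ, hψd, hψ0, hψ⟩ := D.ift (hIT ht) (hσ t s ht).2
      (ne_of_gt (by linarith [D.J_ge hδ (hIT ht) (small t ht s)]))
    refine hψd.congr_of_eventuallyEq ?_
    have e1 : ∀ᶠ q : ℝ × ℝ in nhds (t, s), q.1 ∈ I :=
      continuousAt_fst.eventually (hI.mem_nhds ht)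
    have e2 : ∀ᶠ q : ℝ × ℝ in nhds (t, s), |ψ q - (q.2 + τ)| < 5 * ρ := by
      have c : ContinuousAt (fun q : ℝ × ℝ => |ψ q - (q.2 + τ)|) (t, s) :=
        (hψd.continuousAt.sub (by fun_prop)).abs
      apply c.eventually_lt continuousAt_const
      rw [hψ0]
      exact near5 t ht s
    filter_upwards [e1, e2, hψ] with q q1 q2 q3
    exact D.uniq hδ (hIT q1) hρ (hn _ q1 _) (near5 _ q1 _).le q2.le (hσ _ _ q1).2 q3
  · intro t ht s
    refine D.uniq hδ (hIT ht) hρ (hn t ht (s + 2 * π)) (near5 t ht _).le ?_ (hσ t _ ht).2 ?_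
    · have := (near5 t ht s).le
      rwa [show σ t s + 2 * π - (s + 2 * π + τ) = σ t s - (s + τ) by ring]
    · have := (hσ t s ht).2
      unfold Gf at *
      rw [D.per t (hIT ht), D.hw.per 0 t (hIT ht)]
      exact this


/-! ### Differentiating along the branch -/

lemma chain_t {F : ℝ → ℝ → R3} {Ft Fs : R3} {t : ℝ} {θ : ℝ → ℝ} {θ' : ℝ}
    (hF : DifferentiableAt ℝ (fun p : ℝ × ℝ => F p.1 p.2) (t, θ t))
    (ht : HasDerivAt (fun τ => F τ (θ t)) Ft t) (hs : HasDerivAt (F t) Fs (θ t))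
    (hθ : HasDerivAt θ θ' t) : HasDerivAt (fun τ => F τ (θ τ)) (Ft + θ' • Fs) t := by
  have h1 : HasDerivAt (fun τ => (τ, θ τ)) ((1:ℝ), θ') t := (hasDerivAt_id t).prodMk hθ
  have h2 := hF.hasFDerivAt.comp_hasDerivAt t h1
  rw [fderiv_split, (hasDerivAt_Dt hF).unique ht, (hasDerivAt_Ds hF).unique hs] at h2
  simpa using! h2

lemma dot_comm' (a b : R3) : dot a b = dot b a := by simp only [dot]; ring

/-- space derivative of the branch -/
def sS (δ u v : R3) (j : ℝ) : ℝ := dot v (u + δ) * j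
/-- explicit part of the time derivative of the branch -/
def sE (δ u k l y : R3) (j : ℝ) : ℝ := (dot y (cross3 u l) - dot (cross3 u k) δ) * j
/-- time derivative of the branch -/
def sT (δ u k l y v v1 : R3) (j : ℝ) : ℝ := dot (cross3 v v1) (u + δ) * j + sE δ u k l y j
/-- derivative of the Jacobian -/
def jS (δ u k l y v : R3) (j : ℝ) : ℝ :=
  2 * sS δ u v j * dot (u + δ) k - dot (v - sS δ u v j • (u + δ)) k - sS δ u v j * dot y l
/-- derivative of the weight over the Jacobian -/
def fjS (δ u k l y v : R3) (j : ℝ) : ℝ :=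
  -2 * dot y (v - sS δ u v j • (u + δ)) * j - (1 - dot y y) * (jS δ u k l y v j * j ^ 2)
/-- the remainder -/
def RR (δ u k l y v : R3) (j : ℝ) : ℝ :=
  -2 * sS δ u v j * det3 v k y - 2 * det3 v u (v - sS δ u v j • (u + δ))
  + fjS δ u k l y v j * det3 v k (u + δ) + (1 - dot y y) * j * sS δ u v j * det3 v l (u + δ)
  + 2 * dot y (cross3 u k) * dot v u + (1 - dot y y) * det3 v u l
  + (1 - dot y y) * dot v k * sE δ u k l y j - dot δ (cross3 u l) * sS δ u v j
/-- the time derivative of the density -/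
def PT (δ u k l y v v1 v2 : R3) (j : ℝ) : ℝ :=
  -(-2 * dot y (cross3 v v1 - cross3 u k - sT δ u k l y v v1 j • (u + δ)) * dot v u
    + (1 - dot y y) * (dot (cross3 v v2) u
      + dot v (cross3 u l + sT δ u k l y v v1 j • k)))
/-- the flux -/
def QF (δ u k y v v1 : R3) (j : ℝ) : ℝ :=
  -((1 - dot y y) * dot (cross3 v v1) u + 2 * det3 v u y
    - (1 - dot y y) * j * det3 v k (u + δ) + dot δ (cross3 u k))

lemma cross_id {v v1 : R3} (hv : dot v v = 1) (hv1 : dot v v1 = 0) (A B : R3) :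
    dot v A * dot B (cross3 v v1) - dot (cross3 v v1) A * dot B v + det3 v1 A B = 0 := by
  have e : dot v A * dot B (cross3 v v1) - dot (cross3 v v1) A * dot B v =
      dot v v1 * det3 v A B - dot v v * det3 v1 A B := by
    simp only [det3, dot, cross3_0, cross3_1, cross3_2]; ring
  rw [e, hv, hv1]; ring

section contSec
variable {X : Type*} [TopologicalSpace X] {Z : Set X} {δ : R3} {u k l y v v1 v2 : X → R3} {j : X → ℝ}

attribute [local fun_prop] ContinuousOn.dot' ContinuousOn.cross3' ContinuousOn.det3'

lemma contRR (hu : ContinuousOn u Z) (hk : ContinuousOn k Z) (hl : ContinuousOn l Z)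
    (hy : ContinuousOn y Z) (hv : ContinuousOn v Z) (hj : ContinuousOn j Z) :
    ContinuousOn (fun a => RR δ (u a) (k a) (l a) (y a) (v a) (j a)) Z := by
  unfold RR fjS jS sE sS
  fun_prop

lemma contPT (hu : ContinuousOn u Z) (hk : ContinuousOn k Z) (hl : ContinuousOn l Z)
    (hy : ContinuousOn y Z) (hv : ContinuousOn v Z) (hv1 : ContinuousOn v1 Z)
    (hv2 : ContinuousOn v2 Z) (hj : ContinuousOn j Z) :
    ContinuousOn (fun a => PT δ (u a) (k a) (l a) (y a) (v a) (v1 a) (v2 a) (j a)) Z := by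
  unfold PT sT sE
  fun_prop

end contSec

/-- composition with the branch -/
def Uc (w : ℕ → ℝ → ℝ → R3) (σ : ℝ → ℝ → ℝ) (n : ℕ) (t s : ℝ) : R3 := w n t (σ t s)
/-- the displacement -/
def Yc (g G : ℝ → ℝ → R3) (σ : ℝ → ℝ → ℝ) (t s : ℝ) : R3 := G t s - g t (σ t s)
/-- inverse Jacobian along the branch -/
def jc (w : ℕ → ℝ → ℝ → R3) (g G : ℝ → ℝ → R3) (δ : R3) (σ : ℝ → ℝ → ℝ) (t s : ℝ) : ℝ :=
  (dot (Uc w σ 0 t s + δ) (Uc w σ 0 t s + δ) - dot (Yc g G σ t s) (Uc w σ 1 t s))⁻¹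

namespace Branch
variable {T K : ℝ} {w x : ℕ → ℝ → ℝ → R3} {g G : ℝ → ℝ → R3} {δ : R3} {τ ρ : ℝ} {I : Set ℝ}
  {σ : ℝ → ℝ → ℝ}

lemma J_ge (B : Branch T K w x g G δ τ ρ I σ) (D : Dat T K w x g G δ) (hδ : ‖δ‖ ≤ 1 / 16)
    {t : ℝ} (ht : t ∈ I) (s : ℝ) :
    1 / 2 ≤ dot (Uc w σ 0 t s + δ) (Uc w σ 0 t s + δ) - dot (Yc g G σ t s) (Uc w σ 1 t s) :=
  D.J_ge hδ (B.sub ht) (B.small t ht s)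

lemma yp (B : Branch T K w x g G δ τ ρ I σ) {t : ℝ} (ht : t ∈ I) (s : ℝ) :
    dot (Yc g G σ t s) (Uc w σ 0 t s + δ) = 0 := B.zero t ht s

lemma cσ (B : Branch T K w x g G δ τ ρ I σ) :
    ContinuousOn (fun p : ℝ × ℝ => σ p.1 p.2) (I ×ˢ Set.univ) := fun p hp =>
  (B.diff p.1 hp.1 p.2).continuousAt.continuousWithinAt

lemma cComp (B : Branch T K w x g G δ τ ρ I σ) {F : ℝ → ℝ → R3}
    (hF : ContinuousOn (fun p : ℝ × ℝ => F p.1 p.2) (strip T)) :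
    ContinuousOn (fun p : ℝ × ℝ => F p.1 (σ p.1 p.2)) (I ×ˢ Set.univ) :=
  hF.comp (f := fun p : ℝ × ℝ => (p.1, σ p.1 p.2)) (continuousOn_fst.prodMk B.cσ)
    (fun _ hp => mem_strip.2 (B.sub hp.1))

lemma cX (B : Branch T K w x g G δ τ ρ I σ) {F : ℝ → ℝ → R3}
    (hF : ContinuousOn (fun p : ℝ × ℝ => F p.1 p.2) (strip T)) :
    ContinuousOn (fun p : ℝ × ℝ => F p.1 p.2) (I ×ˢ Set.univ) :=
  hF.mono (Set.prod_mono B.sub le_rfl)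

lemma cU (B : Branch T K w x g G δ τ ρ I σ) (D : Dat T K w x g G δ) (n : ℕ) :
    ContinuousOn (fun p : ℝ × ℝ => Uc w σ n p.1 p.2) (I ×ˢ Set.univ) :=
  B.cComp (D.hw.smooth n).continuousOn

lemma cY (B : Branch T K w x g G δ τ ρ I σ) (D : Dat T K w x g G δ) :
    ContinuousOn (fun p : ℝ × ℝ => Yc g G σ p.1 p.2) (I ×ˢ Set.univ) :=
  (B.cX D.hG.smooth.continuousOn).sub (B.cComp D.gsmooth.continuousOn)

lemma cj (B : Branch T K w x g G δ τ ρ I σ) (D : Dat T K w x g G δ) (hδ : ‖δ‖ ≤ 1 / 16) :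
    ContinuousOn (fun p : ℝ × ℝ => jc w g G δ σ p.1 p.2) (I ×ˢ Set.univ) := by
  refine ContinuousOn.inv₀ ?_ ?_
  · have := (B.cU D 0).add (continuousOn_const (c := δ))
    exact (this.dot' this).sub ((B.cY D).dot' (B.cU D 1))
  · intro p hp
    have := B.J_ge D hδ hp.1 p.2
    linarith

lemma σ_s (B : Branch T K w x g G δ τ ρ I σ) (D : Dat T K w x g G δ) (hδ : ‖δ‖ ≤ 1 / 16)
    {t : ℝ} (ht : t ∈ I) (s : ℝ) :
    HasDerivAt (σ t) (sS δ (Uc w σ 0 t s) (x 0 t s) (jc w g G δ σ t s)) s := by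
  have h1 : HasDerivAt (σ t) (fderiv ℝ (fun q : ℝ × ℝ => σ q.1 q.2) (t, s) (0, 1)) s :=
    (B.diff t ht s).hasFDerivAt.comp_hasDerivAt s ((hasDerivAt_const s t).prodMk (hasDerivAt_id s))
  refine h1.congr_deriv ?_
  set d := fderiv ℝ (fun q : ℝ × ℝ => σ q.1 q.2) (t, s) (0, 1)
  have h2 := ((D.hG.ds t (B.sub ht) s).sub ((D.gs t (B.sub ht) (σ t s)).scomp s h1)).dot'
    (((D.hw.ds 0 t (B.sub ht) (σ t s)).scomp s h1).add_const δ)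
  have h3 : (fun s => dot ((G t - g t ∘ σ t) s) (((w 0 t ∘ σ t) s) + δ)) = fun _ => 0 :=
    funext fun s => B.zero t ht s
  rw [h3] at h2
  have h4 := h2.unique (hasDerivAt_const s (0:ℝ))
  have hJ := B.J_ge D hδ ht s
  rw [sS, jc, ← div_eq_mul_inv, eq_div_iff (by linarith)]
  simp only [Uc, Yc, dot, PiLp.sub_apply, PiLp.add_apply, PiLp.smul_apply, smul_eq_mul,
    Function.comp, zero_add, Pi.sub_apply] at h4 ⊢
  linear_combination -h4

lemma σ_t (B : Branch T K w x g G δ τ ρ I σ) (D : Dat T K w x g G δ) (hδ : ‖δ‖ ≤ 1 / 16)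
    {t : ℝ} (ht : t ∈ I) (s : ℝ) :
    HasDerivAt (fun t => σ t s) (sT δ (Uc w σ 0 t s) (Uc w σ 1 t s) (Uc w σ 2 t s) (Yc g G σ t s)
      (x 0 t s) (x 1 t s) (jc w g G δ σ t s)) t := by
  have h1 : HasDerivAt (fun t => σ t s) (fderiv ℝ (fun q : ℝ × ℝ => σ q.1 q.2) (t, s) (1, 0)) t := by
    have h0 : HasDerivAt (fun t : ℝ => (t, s)) ((1:ℝ), (0:ℝ)) t :=
      (hasDerivAt_id t).prodMk (hasDerivAt_const t s)
    have hd : HasFDerivAt (fun q : ℝ × ℝ => σ q.1 q.2)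
      (fderiv ℝ (fun q : ℝ × ℝ => σ q.1 q.2) (t, s)) ((fun t : ℝ => (t, s)) t) :=
      (B.diff t ht s).hasFDerivAt
    exact hd.comp_hasDerivAt t h0
  refine h1.congr_deriv ?_
  set d := fderiv ℝ (fun q : ℝ × ℝ => σ q.1 q.2) (t, s) (1, 0)
  have hT := B.sub ht
  have h2 := ((D.hG.dt t hT s).sub (chain_t (F := g) (θ := fun t => σ t s) (smooth_diffAt D.gsmooth hT)
    (D.gt t hT (σ t s)) (D.gs t hT (σ t s)) h1)).dot'
    ((chain_t (F := w 0) (θ := fun t => σ t s) (smooth_diffAt (D.hw.smooth 0) hT) (D.hw.dt0 t hT (σ t s))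
      (D.hw.ds 0 t hT (σ t s)) h1).add_const δ)
  have h4 := h2.unique ((hasDerivAt_const t (0:ℝ)).congr_of_eventuallyEq (by
    filter_upwards [B.isOpen.mem_nhds ht] with t ht
    exact B.zero t ht s))
  have hJ := B.J_ge D hδ ht s
  rw [sT, sE, ← add_mul, jc, ← div_eq_mul_inv, eq_div_iff (by linarith)]
  simp only [Uc, Yc, dot, PiLp.sub_apply, PiLp.add_apply, PiLp.smul_apply, smul_eq_mul,
    Function.comp, zero_add, Pi.sub_apply, cross3_0, cross3_1, cross3_2] at h4 ⊢
  linear_combination -h4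

lemma U_s (B : Branch T K w x g G δ τ ρ I σ) (D : Dat T K w x g G δ) (hδ : ‖δ‖ ≤ 1 / 16)
    (n : ℕ) {t : ℝ} (ht : t ∈ I) (s : ℝ) :
    HasDerivAt (fun s => Uc w σ n t s)
      (sS δ (Uc w σ 0 t s) (x 0 t s) (jc w g G δ σ t s) • Uc w σ (n + 1) t s) s :=
  (D.hw.ds n t (B.sub ht) (σ t s)).scomp s (B.σ_s D hδ ht s)

lemma Y_s (B : Branch T K w x g G δ τ ρ I σ) (D : Dat T K w x g G δ) (hδ : ‖δ‖ ≤ 1 / 16)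
    {t : ℝ} (ht : t ∈ I) (s : ℝ) :
    HasDerivAt (fun s => Yc g G σ t s)
      (x 0 t s - sS δ (Uc w σ 0 t s) (x 0 t s) (jc w g G δ σ t s) • (Uc w σ 0 t s + δ)) s :=
  (D.hG.ds t (B.sub ht) s).sub ((D.gs t (B.sub ht) (σ t s)).scomp s (B.σ_s D hδ ht s))

lemma U_t (B : Branch T K w x g G δ τ ρ I σ) (D : Dat T K w x g G δ) (hδ : ‖δ‖ ≤ 1 / 16)
    {t : ℝ} (ht : t ∈ I) (s : ℝ) :
    HasDerivAt (fun t => Uc w σ 0 t s) (cross3 (Uc w σ 0 t s) (Uc w σ 2 t s) +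
      sT δ (Uc w σ 0 t s) (Uc w σ 1 t s) (Uc w σ 2 t s) (Yc g G σ t s)
      (x 0 t s) (x 1 t s) (jc w g G δ σ t s) • Uc w σ 1 t s) t :=
  chain_t (F := w 0) (θ := fun t => σ t s) (smooth_diffAt (D.hw.smooth 0) (B.sub ht)) (D.hw.dt0 t (B.sub ht) (σ t s))
      (D.hw.ds 0 t (B.sub ht) (σ t s)) (B.σ_t D hδ ht s)

lemma Y_t (B : Branch T K w x g G δ τ ρ I σ) (D : Dat T K w x g G δ) (hδ : ‖δ‖ ≤ 1 / 16)
    {t : ℝ} (ht : t ∈ I) (s : ℝ) :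
    HasDerivAt (fun t => Yc g G σ t s) (cross3 (x 0 t s) (x 1 t s)
      - (cross3 (Uc w σ 0 t s) (Uc w σ 1 t s) +
      sT δ (Uc w σ 0 t s) (Uc w σ 1 t s) (Uc w σ 2 t s) (Yc g G σ t s)
      (x 0 t s) (x 1 t s) (jc w g G δ σ t s) • (Uc w σ 0 t s + δ))) t :=
  (D.hG.dt t (B.sub ht) s).sub (chain_t (F := g) (θ := fun t => σ t s) (smooth_diffAt D.gsmooth (B.sub ht))
    (D.gt t (B.sub ht) (σ t s)) (D.gs t (B.sub ht) (σ t s)) (B.σ_t D hδ ht s))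

lemma j_s (B : Branch T K w x g G δ τ ρ I σ) (D : Dat T K w x g G δ) (hδ : ‖δ‖ ≤ 1 / 16)
    {t : ℝ} (ht : t ∈ I) (s : ℝ) :
    HasDerivAt (fun s => jc w g G δ σ t s) (-jS δ (Uc w σ 0 t s) (Uc w σ 1 t s) (Uc w σ 2 t s)
      (Yc g G σ t s) (x 0 t s) (jc w g G δ σ t s) * jc w g G δ σ t s ^ 2) s := by
  have hp := (B.U_s D hδ 0 ht s).add_const δ
  have h := ((hp.dot' hp).sub ((B.Y_s D hδ ht s).dot' (B.U_s D hδ 1 ht s))).inv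
    (by have := B.J_ge D hδ ht s; exact ne_of_gt (by simp only [Pi.sub_apply]; linarith))
  refine h.congr_deriv ?_
  have e : jc w g G δ σ t s ^ 2 = 1 / (dot (Uc w σ 0 t s + δ) (Uc w σ 0 t s + δ) -
    dot (Yc g G σ t s) (Uc w σ 1 t s)) ^ 2 := by
    rw [jc, inv_pow, one_div]
  rw [e, mul_one_div, Pi.sub_apply]
  congr 1
  simp only [jS, dot, PiLp.sub_apply, PiLp.add_apply, PiLp.smul_apply, smul_eq_mul, zero_add]
  ring

end Branch


/-! ### The energy identity -/

lemma flux_alg {δ u k l y v v1 v2 p b ys yt : R3} {j S st Ev n Fj : ℝ} (hp : p = u + δ)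
    (hb : b = cross3 v v1) (hys : ys = v - S • p) (hyt : yt = b - cross3 u k - st • p)
    (hS : S = dot v p * j) (hst : st = dot b p * j + Ev)
    (hv : dot v v = 1) (hv1 : dot v v1 = 0) (hyp : dot y p = 0) :
    -(-2 * dot y ys * dot b u + n * (dot (cross3 v v2) u + dot b (S • k))
      + 2 * (det3 v1 u y + det3 v (S • k) y + det3 v u ys)
      - (Fj * det3 v k p + n * j * (det3 v1 k p + det3 v (S • l) p + det3 v k (S • k)))
      + (dot δ (cross3 (S • k) k) + dot δ (cross3 u (S • l)))) =
    -(-2 * dot y yt * dot v u + n * (dot (cross3 v v2) u + dot v (cross3 u l + st • k)))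
    + (-2 * S * det3 v k y - 2 * det3 v u ys + Fj * det3 v k p + n * j * S * det3 v l p
      + 2 * dot y (cross3 u k) * dot v u + n * det3 v u l + n * dot v k * Ev
      - dot δ (cross3 u l) * S) := by
  have e1 := cross_id hv hv1 u y
  have e2 := cross_id hv hv1 k p
  have a1 : dot y ys = dot y v - S * dot y p := by
    rw [hys]; simp only [dot, PiLp.sub_apply, PiLp.smul_apply, smul_eq_mul]; ring
  have a2 : dot y yt = dot y b - dot y (cross3 u k) - st * dot y p := by
    rw [hyt]; simp only [dot, PiLp.sub_apply, PiLp.smul_apply, smul_eq_mul]; ring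
  have a3 : dot b (S • k) = S * dot b k := by
    simp only [dot, PiLp.smul_apply, smul_eq_mul]; ring
  have a4 : det3 v (S • k) y = S * det3 v k y := by
    simp only [det3, dot, cross3_0, cross3_1, cross3_2, PiLp.smul_apply, smul_eq_mul]; ring
  have a5 : det3 v (S • l) p = S * det3 v l p := by
    simp only [det3, dot, cross3_0, cross3_1, cross3_2, PiLp.smul_apply, smul_eq_mul]; ring
  have a6 : det3 v k (S • k) = 0 := by
    simp only [det3, dot, cross3_0, cross3_1, cross3_2, PiLp.smul_apply, smul_eq_mul]; ring
  have a7 : dot δ (cross3 (S • k) k) = 0 := by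
    simp only [dot, cross3_0, cross3_1, cross3_2, PiLp.smul_apply, smul_eq_mul]; ring
  have a8 : dot δ (cross3 u (S • l)) = S * dot δ (cross3 u l) := by
    simp only [dot, cross3_0, cross3_1, cross3_2, PiLp.smul_apply, smul_eq_mul]; ring
  have a9 : dot v (cross3 u l + st • k) = det3 v u l + st * dot v k := by
    simp only [det3, dot, PiLp.add_apply, PiLp.smul_apply, smul_eq_mul]; ring
  rw [a1, a2, a3, a4, a5, a6, a7, a8, a9, hyp]
  rw [← hb] at e1 e2
  rw [dot_comm' b p, ] at hst
  rw [dot_comm' v p] at hS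
  rw [hst]
  linear_combination (-2) * e1 + n * j * e2 - n * dot b k * hS

namespace Branch
variable {T K : ℝ} {w x : ℕ → ℝ → ℝ → R3} {g G : ℝ → ℝ → R3} {δ : R3} {τ ρ : ℝ} {I : Set ℝ}
  {σ : ℝ → ℝ → ℝ}

/-- the energy density -/
def ph (w x : ℕ → ℝ → ℝ → R3) (g G : ℝ → ℝ → R3) (σ : ℝ → ℝ → ℝ) (t s : ℝ) : ℝ :=
  1 - (1 - dot (Yc g G σ t s) (Yc g G σ t s)) * dot (x 0 t s) (Uc w σ 0 t s)

lemma ph_t (B : Branch T K w x g G δ τ ρ I σ) (D : Dat T K w x g G δ) (hδ : ‖δ‖ ≤ 1 / 16)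
    {t : ℝ} (ht : t ∈ I) (s : ℝ) :
    HasDerivAt (fun t => ph w x g G σ t s) (PT δ (Uc w σ 0 t s) (Uc w σ 1 t s) (Uc w σ 2 t s)
      (Yc g G σ t s) (x 0 t s) (x 1 t s) (x 2 t s) (jc w g G δ σ t s)) t := by
  have hY := B.Y_t D hδ ht s
  have h := (((hY.dot' hY).const_sub 1).mul
    ((D.hx.dt0 t (B.sub ht) s).dot' (B.U_t D hδ ht s))).const_sub 1
  refine h.congr_deriv ?_
  rw [PT, ← sub_sub, dot_comm' (_ - _) (Yc g G σ t s)]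
  ring

lemma q_s (B : Branch T K w x g G δ τ ρ I σ) (D : Dat T K w x g G δ) (hδ : ‖δ‖ ≤ 1 / 16)
    {t : ℝ} (ht : t ∈ I) (s : ℝ) :
    HasDerivAt (fun s => QF δ (Uc w σ 0 t s) (Uc w σ 1 t s) (Yc g G σ t s) (x 0 t s) (x 1 t s)
      (jc w g G δ σ t s)) (PT δ (Uc w σ 0 t s) (Uc w σ 1 t s) (Uc w σ 2 t s)
      (Yc g G σ t s) (x 0 t s) (x 1 t s) (x 2 t s) (jc w g G δ σ t s) +
      RR δ (Uc w σ 0 t s) (Uc w σ 1 t s) (Uc w σ 2 t s)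
      (Yc g G σ t s) (x 0 t s) (jc w g G δ σ t s)) s := by
  have hY := B.Y_s D hδ ht s
  have hU := B.U_s D hδ 0 ht s
  have hU1 := B.U_s D hδ 1 ht s
  have hV := D.hx.ds 0 t (B.sub ht) s
  have hV1 := D.hx.ds 1 t (B.sub ht) s
  have hj := B.j_s D hδ ht s
  have hf := (hY.dot' hY).const_sub 1
  have h1 := hf.mul ((hV.cross3' hV1).dot' hU)
  have h2 := (hV.det3' hU hY).const_mul 2
  have h3 := (hf.mul hj).mul (hV.det3' hU1 (hU.add_const δ))
  have h4 := (hasDerivAt_const s δ).dot' (hU.cross3' hU1)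
  have h := (((h1.add h2).sub h3).add h4).neg
  refine h.congr_deriv ?_
  have key := flux_alg (δ := δ) (u := Uc w σ 0 t s) (k := Uc w σ 1 t s) (l := Uc w σ 2 t s)
    (y := Yc g G σ t s) (v := x 0 t s) (v1 := x 1 t s) (v2 := x 2 t s)
    (j := jc w g G δ σ t s) (S := sS δ (Uc w σ 0 t s) (x 0 t s) (jc w g G δ σ t s))
    (st := sT δ (Uc w σ 0 t s) (Uc w σ 1 t s) (Uc w σ 2 t s)
      (Yc g G σ t s) (x 0 t s) (x 1 t s) (jc w g G δ σ t s))
    (n := 1 - dot (Yc g G σ t s) (Yc g G σ t s))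
    (Fj := fjS δ (Uc w σ 0 t s) (Uc w σ 1 t s) (Uc w σ 2 t s)
      (Yc g G σ t s) (x 0 t s) (jc w g G δ σ t s))
    (Ev := sE δ (Uc w σ 0 t s) (Uc w σ 1 t s) (Uc w σ 2 t s)
      (Yc g G σ t s) (jc w g G δ σ t s)) rfl rfl rfl rfl rfl rfl
    (by rw [dot_self, D.hx.unit t (B.sub ht) s]; norm_num) (D.hx.c01 (B.sub ht) s) (B.yp ht s)
  refine Eq.trans ?_ key
  have z : ∀ a : R3, dot 0 a = 0 := fun a => by simp [dot]
  have add_l : ∀ a b c : R3, dot (a + b) c = dot a c + dot b c := fun a b c => by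
    simp only [dot, PiLp.add_apply]; ring
  have add_r : ∀ a b c : R3, dot a (b + c) = dot a b + dot a c := fun a b c => by
    simp only [dot, PiLp.add_apply]; ring
  have cc := dot_comm' (x 0 t s - sS δ (Uc w σ 0 t s) (x 0 t s) (jc w g G δ σ t s) •
    (Uc w σ 0 t s + δ)) (Yc g G σ t s)
  simp only [add_l, add_r, z, cross3_self, zero_add, Nat.reduceAdd, Pi.mul_apply]
  rw [fjS, cc]
  ring


lemma cph (B : Branch T K w x g G δ τ ρ I σ) (D : Dat T K w x g G δ) :
    ContinuousOn (fun p : ℝ × ℝ => ph w x g G σ p.1 p.2) (I ×ˢ Set.univ) := by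
  have hY := B.cY D
  exact continuousOn_const.sub ((continuousOn_const.sub (hY.dot' hY)).mul
    ((B.cX (D.hx.cont 0)).dot' (B.cU D 0)))

lemma U_per (B : Branch T K w x g G δ τ ρ I σ) (D : Dat T K w x g G δ) (n : ℕ)
    {t : ℝ} (ht : t ∈ I) : Uc w σ n t (2 * π) = Uc w σ n t 0 := by
  have := B.per t ht 0
  rw [zero_add] at this
  rw [Uc, this, D.hw.per n t (B.sub ht), Uc]

lemma Y_per (B : Branch T K w x g G δ τ ρ I σ) (D : Dat T K w x g G δ)
    {t : ℝ} (ht : t ∈ I) : Yc g G σ t (2 * π) = Yc g G σ t 0 := by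
  have := B.per t ht 0
  rw [zero_add] at this
  have h2 := D.per t (B.sub ht) 0 (σ t 0)
  rw [zero_add] at h2
  rw [Yc, this, h2, Yc]

lemma energy_t (B : Branch T K w x g G δ τ ρ I σ) (D : Dat T K w x g G δ) (hδ : ‖δ‖ ≤ 1 / 16)
    {t : ℝ} (ht : t ∈ I) :
    HasDerivAt (fun t => ∫ s in (0:ℝ)..2 * π, ph w x g G σ t s)
      (∫ s in (0:ℝ)..2 * π, -RR δ (Uc w σ 0 t s) (Uc w σ 1 t s) (Uc w σ 2 t s)
      (Yc g G σ t s) (x 0 t s) (jc w g G δ σ t s)) t := by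
  have cR := contRR (δ := δ) (B.cU D 0) (B.cU D 1) (B.cU D 2) (B.cY D) (B.cX (D.hx.cont 0)) (B.cj D hδ)
  have cP := contPT (δ := δ) (B.cU D 0) (B.cU D 1) (B.cU D 2) (B.cY D) (B.cX (D.hx.cont 0))
    (B.cX (D.hx.cont 1)) (B.cX (D.hx.cont 2)) (B.cj D hδ)
  refine energy B.isOpen
    (φ := ph w x g G σ)
    (R := fun t s => -RR δ (Uc w σ 0 t s) (Uc w σ 1 t s) (Uc w σ 2 t s)
      (Yc g G σ t s) (x 0 t s) (jc w g G δ σ t s))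
    (q := fun t s => QF δ (Uc w σ 0 t s) (Uc w σ 1 t s) (Yc g G σ t s) (x 0 t s) (x 1 t s)
      (jc w g G δ σ t s))
    (qs := fun t s => PT δ (Uc w σ 0 t s) (Uc w σ 1 t s) (Uc w σ 2 t s)
      (Yc g G σ t s) (x 0 t s) (x 1 t s) (x 2 t s) (jc w g G δ σ t s) +
      RR δ (Uc w σ 0 t s) (Uc w σ 1 t s) (Uc w σ 2 t s)
      (Yc g G σ t s) (x 0 t s) (jc w g G δ σ t s)) ?_ (fun t ht s => B.q_s D hδ ht s) (B.cph D)
    (cP.add cR) cR.neg ?_ ht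
  · intro t ht s
    exact (B.ph_t D hδ ht s).congr_deriv (by ring)
  · intro t ht
    have := B.U_per D 0 ht
    have := B.U_per D 1 ht
    have := B.Y_per D ht
    have := D.hx.per0 0 (B.sub ht)
    have := D.hx.per0 1 (B.sub ht)
    simp only [jc, *]

end Branch


/-! ### Pointwise estimates -/

lemma abs_mul_le' {a b A B : ℝ} (ha : |a| ≤ A) (hb : |b| ≤ B) : |a * b| ≤ A * B := by
  rw [abs_mul]
  exact mul_le_mul ha hb (abs_nonneg _) ((abs_nonneg _).trans ha)

lemma dot_add_r (a b c : R3) : dot a (b + c) = dot a b + dot a c := by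
  simp only [dot, PiLp.add_apply]; ring

lemma abs_dot_le' {a b : R3} {A B : ℝ} (ha : ‖a‖ ≤ A) (hb : ‖b‖ ≤ B) : |dot a b| ≤ A * B :=
  (abs_dot_le a b).trans (mul_le_mul ha hb (norm_nonneg _) ((norm_nonneg _).trans ha))

lemma abs_det_le' {a b c : R3} {A B C : ℝ} (ha : ‖a‖ ≤ A) (hb : ‖b‖ ≤ B) (hc : ‖c‖ ≤ C) :
    |det3 a b c| ≤ A * B * C := by
  have hA := (norm_nonneg _).trans ha
  have hB := (norm_nonneg _).trans hb
  refine (abs_det3_le a b c).trans ?_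
  gcongr

lemma abs_neg_le' {a A : ℝ} (h : |a| ≤ A) : |-a| ≤ A := by rwa [abs_neg]

lemma RR_alg {δ u k l y v z : R3} {j S Ev n Fj : ℝ} (hz : z = v - u) :
    -2 * S * det3 v k y - 2 * det3 v u (v - S • (u + δ))
      + Fj * det3 v k (u + δ) + n * j * S * det3 v l (u + δ)
      + 2 * dot y (cross3 u k) * dot v u + n * det3 v u l
      + n * dot v k * Ev - dot δ (cross3 u l) * S =
    2 * (det3 y u k * (dot v u - S) - S * det3 y z k) + 2 * (S * det3 z u δ)
      + Fj * (det3 z k u + det3 v k δ) + n * (det3 z u l * (1 - j * S))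
      + S * ((n * j - 1) * det3 u l δ + n * j * det3 z l δ)
      + n * ((dot z k + dot u k) * Ev) := by
  subst hz
  simp only [det3, dot, cross3_0, cross3_1, cross3_2, PiLp.sub_apply, PiLp.add_apply,
    PiLp.smul_apply, smul_eq_mul]
  ring

lemma abs_add3 {a b c A B C : ℝ} (ha : |a| ≤ A) (hb : |b| ≤ B) (hc : |c| ≤ C) :
    |a + b + c| ≤ A + B + C := by
  rw [abs_le] at *
  constructor <;> linarith [ha.1, ha.2, hb.1, hb.2, hc.1, hc.2]

lemma abs_add2 {a b A B : ℝ} (ha : |a| ≤ A) (hb : |b| ≤ B) :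
    |a + b| ≤ A + B := (abs_add_le a b).trans (add_le_add ha hb)

lemma abs_sub2 {a b A B : ℝ} (ha : |a| ≤ A) (hb : |b| ≤ B) :
    |a - b| ≤ A + B := (abs_sub a b).trans (add_le_add ha hb)

lemma sq_three (a b c : ℝ) : (a + b + c) ^ 2 ≤ 3 * (a ^ 2 + b ^ 2 + c ^ 2) := by
  linarith [sq_nonneg (a - b), sq_nonneg (a - c), sq_nonneg (b - c)]

lemma final_arith {K q : ℝ} (hK : 1 ≤ K) (hq : 0 ≤ q) :
    2 * (q * 1 * K * (9 * K * q) + 4 * (q * q * K)) + 2 * (4 * (q * 1 * q)) +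
      72 * K * q * (q * K * 1 + 1 * K * q) + 1 * (q * 1 * K * (22 * K * q)) +
      4 * (7 * K * q * (1 * K * q) + 1 * 2 * (q * K * q)) + 1 * (q * K * (4 * K * q)) ≤
    (240:ℝ) * K ^ 2 * q ^ 2 := by
  have k1 : q ^ 2 ≤ K * q ^ 2 := by nlinarith [sq_nonneg q]
  have k2 : K * q ^ 2 ≤ K ^ 2 * q ^ 2 := by nlinarith [sq_nonneg q]
  have k3 : 0 ≤ q ^ 2 := sq_nonneg q
  ring_nf
  ring_nf at k1 k2 k3
  linarith

set_option maxHeartbeats 1000000 in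
lemma estimates {K : ℝ} {δ u k l y v : R3} {j : ℝ} (hK : 1 ≤ K) (hu : ‖u‖ = 1) (hv : ‖v‖ = 1)
    (huk : dot u k = 0) (hk : ‖k‖ ≤ K) (hl : ‖l‖ ≤ K) (hδ : ‖δ‖ ≤ 1 / 16)
    (hyp : dot y (u + δ) = 0) (hy : ‖y‖ * (4 * K) ≤ 1)
    (hJ : 1 / 2 ≤ dot (u + δ) (u + δ) - dot y k)
    (hj : j = (dot (u + δ) (u + δ) - dot y k)⁻¹) :
    |RR δ u k l y v j| ≤ 720 * K ^ 2 * (‖y‖ ^ 2 + ‖v - u‖ ^ 2 + ‖δ‖ ^ 2) ∧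
    |sS δ u v j - 1| ≤ 8 * K * (‖y‖ + ‖v - u‖ + ‖δ‖) ∧
    ‖v - sS δ u v j • (u + δ)‖ ≤ 12 * K * (‖y‖ + ‖v - u‖ + ‖δ‖) := by
  set z := v - u with hz
  set J := dot (u + δ) (u + δ) - dot y k with hJdef
  set S := sS δ u v j with hS
  set q := ‖y‖ + ‖z‖ + ‖δ‖ with hq
  have a0 := norm_nonneg y
  have z0 := norm_nonneg z
  have d0 := norm_nonneg δ
  have q0 : 0 ≤ q := by positivity
  have aq : ‖y‖ ≤ q := by linarith
  have zq : ‖z‖ ≤ q := by linarith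
  have dq : ‖δ‖ ≤ q := by linarith
  have a4 : ‖y‖ ≤ 1 / 4 := by nlinarith
  have z2 : ‖z‖ ≤ 2 := by
    have := norm_sub_le v u
    rw [hu, hv] at this; linarith
  have qKq : q ≤ K * q := by nlinarith
  have huu : dot u u = 1 := by rw [dot_self, hu]; norm_num
  have hvv : dot v v = 1 := by rw [dot_self, hv]; norm_num
  have hvu : dot v u - 1 = -(‖z‖ ^ 2 / 2) := by
    rw [← dot_self z, hz]
    have : dot (v - u) (v - u) = dot v v + dot u u - 2 * dot v u := by
      simp only [dot, PiLp.sub_apply]; ring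
    rw [this, huu, hvv]; ring
  have hvu' : |dot v u - 1| ≤ ‖z‖ := by
    rw [hvu, abs_neg, abs_of_nonneg (by positivity)]; nlinarith
  have hJ1 : |J - 1| ≤ 3 * K * q := by
    have e : J - 1 = 2 * dot u δ + ‖δ‖ ^ 2 - dot y k := by
      rw [hJdef, ← dot_self δ]
      have : dot (u + δ) (u + δ) = dot u u + 2 * dot u δ + dot δ δ := by
        simp only [dot, PiLp.add_apply]; ring
      rw [this, huu]; ring
    have h1 := abs_dot_le' hu.le (le_refl ‖δ‖)
    have h2 := abs_dot_le' (le_refl ‖y‖) hk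
    have h3 : ‖δ‖ ^ 2 ≤ ‖δ‖ := by nlinarith
    have h5 : ‖δ‖ ≤ K * ‖δ‖ := by nlinarith
    have h6 : 0 ≤ K * ‖z‖ := by positivity
    have h7 : 0 ≤ K * ‖y‖ := by positivity
    rw [e]
    refine (abs_sub2 (abs_add2 (abs_mul_le' (show |(2:ℝ)| ≤ 2 by norm_num) h1)
      (show |‖δ‖ ^ 2| ≤ ‖δ‖ by rwa [abs_of_nonneg (by positivity)])) h2).trans ?_
    rw [hq]
    linarith
  have hj0 : 0 ≤ j := by rw [hj]; exact inv_nonneg.2 (by linarith)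
  have hj2 : j ≤ 2 := by
    rw [hj]
    exact (inv_anti₀ (by norm_num) hJ).trans (by norm_num)
  have hj2' : |j| ≤ 2 := by rwa [abs_of_nonneg hj0]
  have hjJ : j * J = 1 := by rw [hj]; exact inv_mul_cancel₀ (by linarith)
  have hj1 : |j - 1| ≤ 6 * K * q := by
    have : j - 1 = - (j * (J - 1)) := by linear_combination hjJ
    rw [this, abs_neg]
    exact (abs_mul_le' hj2' hJ1).trans (by linarith)
  have hvp : |dot v (u + δ) - 1| ≤ q := by
    rw [dot_add_r, show dot v u + dot v δ - 1 = (dot v u - 1) + dot v δ by ring]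
    refine (abs_add2 hvu' (abs_dot_le' hv.le (le_refl ‖δ‖))).trans ?_
    linarith
  have hpn : ‖u + δ‖ ≤ 2 := (norm_add_le _ _).trans (by linarith)
  have hSe : S = dot v (u + δ) * j := rfl
  have hS4 : |S| ≤ 4 := by
    rw [hSe]
    exact (abs_mul_le' (abs_dot_le' hv.le hpn) hj2').trans (by norm_num)
  have hS1 : |S - 1| ≤ 8 * K * q := by
    rw [hSe, show dot v (u + δ) * j - 1 = (dot v (u + δ) - 1) * j + (j - 1) by ring]
    refine (abs_add2 (abs_mul_le' hvp hj2') hj1).trans ?_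
    nlinarith
  have hys : ‖v - S • (u + δ)‖ ≤ 12 * K * q := by
    have e : v - S • (u + δ) = z + ((1 - S) • u - S • δ) := by
      rw [hz]; module
    rw [e]
    refine (norm_add_le _ _).trans ((add_le_add_right (norm_sub_le _ _) _).trans ?_)
    rw [norm_smul, norm_smul, hu, Real.norm_eq_abs, Real.norm_eq_abs, abs_sub_comm]
    have : |S| * ‖δ‖ ≤ 4 * ‖δ‖ := by gcongr
    nlinarith
  refine ⟨?_, hS1, hys⟩
  set n := 1 - dot y y with hn
  have hyy : dot y y = ‖y‖ ^ 2 := dot_self y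
  have hn0 : 0 ≤ n := by rw [hn, hyy]; nlinarith
  have hn1 : |n| ≤ 1 := by rw [abs_of_nonneg hn0, hn, hyy]; nlinarith
  -- the coefficient
  have hyu : dot y u = - dot y δ := by rw [dot_add_r] at hyp; linarith
  have hyys : |dot y (v - S • (u + δ))| ≤ q := by
    have e : dot y (v - S • (u + δ)) = dot y z - dot y δ := by
      have : dot y (v - S • (u + δ)) = dot y z + dot y u - S * dot y (u + δ) := by
        rw [hz]; simp only [dot, PiLp.sub_apply, PiLp.smul_apply, smul_eq_mul]; ring
      rw [this, hyp, hyu]; ring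
    rw [e]
    refine (abs_sub2 (abs_dot_le' a4 (le_refl ‖z‖)) (abs_dot_le' a4 (le_refl ‖δ‖))).trans ?_
    linarith
  have hjS : |jS δ u k l y v j| ≤ 17 * K * q := by
    have e : jS δ u k l y v j = S * (3 * dot δ k - dot y l) - dot z k := by
      have : jS δ u k l y v j = S * (3 * (dot u k + dot δ k) - dot y l) - (dot z k + dot u k) := by
        rw [hz, jS, ← hS]
        simp only [dot, PiLp.sub_apply, PiLp.add_apply, PiLp.smul_apply, smul_eq_mul]; ring
      rw [this, huk]; ring
    rw [e]
    have h3 : |3 * dot δ k| ≤ 3 * (‖δ‖ * K) := by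
      rw [abs_mul, abs_of_pos (by norm_num : (0:ℝ) < 3)]
      exact mul_le_mul_of_nonneg_left (abs_dot_le' (le_refl ‖δ‖) hk) (by norm_num)
    refine (abs_sub2 (abs_mul_le' hS4 (abs_sub2 h3 (abs_dot_le' (le_refl ‖y‖) hl)))
      (abs_dot_le' (le_refl ‖z‖) hk)).trans ?_
    rw [hq]
    nlinarith [mul_nonneg a0 (by linarith : (0:ℝ) ≤ K), mul_nonneg z0 (by linarith : (0:ℝ) ≤ K),
      mul_nonneg d0 (by linarith : (0:ℝ) ≤ K)]
  have hF : |fjS δ u k l y v j| ≤ 72 * K * q := by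
    have e : fjS δ u k l y v j = -(2 * (dot y (v - S • (u + δ)) * j))
      - n * (jS δ u k l y v j * (j * j)) := by rw [fjS, ← hS, ← hn]; ring
    rw [e]
    have h2 : |(2:ℝ)| ≤ 2 := by norm_num
    refine (abs_sub2 (abs_neg_le' (abs_mul_le' h2 (abs_mul_le' hyys hj2')))
      (abs_mul_le' hn1 (abs_mul_le' hjS (abs_mul_le' hj2' hj2')))).trans ?_
    linarith
  have hE : |sE δ u k l y j| ≤ 4 * K * q := by
    rw [sE]
    refine (abs_mul_le' (abs_sub2 (abs_dot_le' (le_refl ‖y‖) ((norm_cross3_le u l).trans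
      (show _ ≤ K by rw [hu, one_mul]; exact hl))) (abs_dot_le' ((norm_cross3_le u k).trans
      (show _ ≤ K by rw [hu, one_mul]; exact hk)) (le_refl ‖δ‖))) hj2').trans ?_
    have h1 : 0 ≤ K * ‖z‖ := by positivity
    have h2 : 0 ≤ K * ‖y‖ := by positivity
    have h3 : 0 ≤ K * ‖δ‖ := by positivity
    rw [hq]
    linarith
  have hjS1 : |1 - j * S| ≤ 22 * K * q := by
    rw [show 1 - j * S = -(j - 1) - j * (S - 1) by ring]
    refine (abs_sub2 (abs_neg_le' hj1) (abs_mul_le' hj2' hS1)).trans ?_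
    linarith
  have hnj : |n * j - 1| ≤ 7 * K * q := by
    rw [show n * j - 1 = (j - 1) - ‖y‖ ^ 2 * j by rw [hn, hyy]; ring]
    have : |‖y‖ ^ 2| ≤ q / 4 := by rw [abs_of_nonneg (by positivity)]; nlinarith
    refine (abs_sub2 hj1 (abs_mul_le' this hj2')).trans ?_
    linarith
  have hvuS : |dot v u - S| ≤ 9 * K * q := by
    rw [show dot v u - S = (dot v u - 1) - (S - 1) by ring]
    refine (abs_sub2 hvu' hS1).trans ?_
    linarith
  have two : |(2:ℝ)| ≤ 2 := by norm_num
  rw [RR, ← hS, ← hn, RR_alg hz, huk, add_zero]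
  have t1 := abs_mul_le' two (abs_sub2 (abs_mul_le' (abs_det_le' aq hu.le hk) hvuS)
    (abs_mul_le' hS4 (abs_det_le' aq zq hk)))
  have t2 := abs_mul_le' two (abs_mul_le' hS4 (abs_det_le' zq hu.le dq))
  have t3 := abs_mul_le' hF (abs_add2 (abs_det_le' zq hk hu.le) (abs_det_le' hv.le hk dq))
  have t4 := abs_mul_le' hn1 (abs_mul_le' (abs_det_le' zq hu.le hl) hjS1)
  have t5 := abs_mul_le' hS4 (abs_add2 (abs_mul_le' hnj (abs_det_le' hu.le hl dq))
    (abs_mul_le' (abs_mul_le' hn1 hj2') (abs_det_le' zq hl dq)))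
  have t6 := abs_mul_le' hn1 (abs_mul_le' (abs_dot_le' zq hk) hE)
  refine (abs_add2 (abs_add2 (abs_add2 (abs_add2 (abs_add2 t1 t2) t3) t4) t5) t6).trans ?_
  exact (final_arith hK q0).trans (by
    have := mul_le_mul_of_nonneg_left (sq_three ‖y‖ ‖z‖ ‖δ‖) (show 0 ≤ 240 * K ^ 2 by positivity)
    rw [← hq] at this
    linarith)


/-! ### Integrated estimates -/

/-- the energy -/
def En (w x : ℕ → ℝ → ℝ → R3) (g G : ℝ → ℝ → R3) (δ : R3) (σ : ℝ → ℝ → ℝ) (t : ℝ) : ℝ :=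
  (∫ s in (0:ℝ)..2 * π, Branch.ph w x g G σ t s) + ‖δ‖ ^ 2

lemma two_pi_le : 2 * π ≤ 7 := by linarith [pi_lt_d2]

namespace Branch
variable {T K : ℝ} {w x : ℕ → ℝ → ℝ → R3} {g G : ℝ → ℝ → R3} {δ : R3} {τ ρ : ℝ} {I : Set ℝ}
  {σ : ℝ → ℝ → ℝ}

lemma Y_small (B : Branch T K w x g G δ τ ρ I σ) (D : Dat T K w x g G δ) {t : ℝ} (ht : t ∈ I)
    (s : ℝ) : ‖Yc g G σ t s‖ ≤ 1 / 4 := by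
  have h1 := B.small t ht s
  have h2 := D.K1
  have h3 := norm_nonneg (Yc g G σ t s)
  change ‖Yc g G σ t s‖ * (4 * K) ≤ 1 at h1
  nlinarith

lemma ph_bd (B : Branch T K w x g G δ τ ρ I σ) (D : Dat T K w x g G δ) {t : ℝ} (ht : t ∈ I)
    (s : ℝ) : ‖Yc g G σ t s‖ ^ 2 + ‖x 0 t s - Uc w σ 0 t s‖ ^ 2 / 4 ≤ ph w x g G σ t s ∧
      ph w x g G σ t s ≤ ‖Yc g G σ t s‖ ^ 2 + ‖x 0 t s - Uc w σ 0 t s‖ ^ 2 / 2 := by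
  have hv := D.hx.unit t (B.sub ht) s
  have hu := D.hw.unit t (B.sub ht) (σ t s)
  change ‖Uc w σ 0 t s‖ = 1 at hu
  have hs := B.Y_small D ht s
  have h0 := norm_nonneg (Yc g G σ t s)
  unfold ph
  set y := Yc g G σ t s
  set u := Uc w σ 0 t s
  set v := x 0 t s
  have hvu : dot v u = 1 - ‖v - u‖ ^ 2 / 2 := by
    rw [← dot_self (v - u)]
    have : dot (v - u) (v - u) = dot v v + dot u u - 2 * dot v u := by
      simp only [dot, PiLp.sub_apply]; ring
    rw [this, dot_self, dot_self, hu, hv]; ring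
  rw [hvu, dot_self]
  have hy2 : ‖y‖ ^ 2 ≤ 1 / 16 := by nlinarith
  have hz := sq_nonneg ‖v - u‖
  have hy := sq_nonneg ‖y‖
  have m1 := mul_le_mul_of_nonneg_right hy2 hz
  have m2 := mul_nonneg hy hz
  constructor <;> linarith

lemma ests (B : Branch T K w x g G δ τ ρ I σ) (D : Dat T K w x g G δ) (hδ : ‖δ‖ ≤ 1 / 16)
    {t : ℝ} (ht : t ∈ I) (s : ℝ) :
    |RR δ (Uc w σ 0 t s) (Uc w σ 1 t s) (Uc w σ 2 t s) (Yc g G σ t s) (x 0 t s)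
      (jc w g G δ σ t s)| ≤ 720 * K ^ 2 *
        (‖Yc g G σ t s‖ ^ 2 + ‖x 0 t s - Uc w σ 0 t s‖ ^ 2 + ‖δ‖ ^ 2) ∧
    |sS δ (Uc w σ 0 t s) (x 0 t s) (jc w g G δ σ t s) - 1| ≤
      8 * K * (‖Yc g G σ t s‖ + ‖x 0 t s - Uc w σ 0 t s‖ + ‖δ‖) ∧
    ‖x 0 t s - sS δ (Uc w σ 0 t s) (x 0 t s) (jc w g G δ σ t s) • (Uc w σ 0 t s + δ)‖ ≤
      12 * K * (‖Yc g G σ t s‖ + ‖x 0 t s - Uc w σ 0 t s‖ + ‖δ‖) :=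
  estimates D.K1 (D.hw.unit t (B.sub ht) _) (D.hx.unit t (B.sub ht) s)
    (D.hw.c01 (B.sub ht) _) (D.b1 t (B.sub ht) _) (D.b2 t (B.sub ht) _) hδ (B.yp ht s)
    (B.small t ht s) (B.J_ge D hδ ht s) rfl

lemma sY (B : Branch T K w x g G δ τ ρ I σ) (D : Dat T K w x g G δ) {t : ℝ} (ht : t ∈ I) :
    Continuous fun s => Yc g G σ t s := slice_cont (B.cY D) ht

lemma sU (B : Branch T K w x g G δ τ ρ I σ) (D : Dat T K w x g G δ) (n : ℕ) {t : ℝ} (ht : t ∈ I) :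
    Continuous fun s => Uc w σ n t s := slice_cont (B.cU D n) ht

lemma sj (B : Branch T K w x g G δ τ ρ I σ) (D : Dat T K w x g G δ) (hδ : ‖δ‖ ≤ 1 / 16)
    {t : ℝ} (ht : t ∈ I) :
    Continuous fun s => jc w g G δ σ t s := slice_cont (B.cj D hδ) ht

lemma sph (B : Branch T K w x g G δ τ ρ I σ) (D : Dat T K w x g G δ) {t : ℝ} (ht : t ∈ I) :
    Continuous fun s => ph w x g G σ t s := slice_cont (B.cph D) ht

lemma ph_nonneg (B : Branch T K w x g G δ τ ρ I σ) (D : Dat T K w x g G δ) {t : ℝ} (ht : t ∈ I)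
    (s : ℝ) : 0 ≤ ph w x g G σ t s :=
  le_trans (by positivity) (B.ph_bd D ht s).1

lemma int_sq (B : Branch T K w x g G δ τ ρ I σ) (D : Dat T K w x g G δ) {t : ℝ} (ht : t ∈ I) :
    ∫ s in (0:ℝ)..2 * π, (4 * ph w x g G σ t s + 1 * ‖δ‖ ^ 2) ≤ 7 * En w x g G δ σ t := by
  rw [int_lin (B.sph D ht) continuous_const, intervalIntegral.integral_const, En, sub_zero,
    smul_eq_mul, one_mul]
  have := int_nonneg (B.ph_nonneg D ht)
  have := mul_le_mul_of_nonneg_right two_pi_le (sq_nonneg ‖δ‖)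
  linarith

lemma En_nonneg (B : Branch T K w x g G δ τ ρ I σ) (D : Dat T K w x g G δ) {t : ℝ} (ht : t ∈ I) :
    0 ≤ En w x g G δ σ t := add_nonneg (int_nonneg (B.ph_nonneg D ht)) (sq_nonneg _)

lemma En_gron (D : Dat T K w x g G δ) (hδ : ‖δ‖ ≤ 1 / 16) {a b : ℝ}
    (B : Branch T K w x g G δ τ ρ (Set.Ioo a b) σ)
    {t0 t : ℝ} (h0 : t0 ∈ Set.Ioo a b) (ht : t ∈ Set.Ioo a b) :
    En w x g G δ σ t ≤ exp (5040 * K ^ 2 * |t - t0|) * En w x g G δ σ t0 := by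
  refine gron (E := En w x g G δ σ) (fun t ht => (B.energy_t D hδ ht).add_const _) ?_ h0 ht
  intro t ht
  have cR : Continuous fun s => RR δ (Uc w σ 0 t s) (Uc w σ 1 t s) (Uc w σ 2 t s)
      (Yc g G σ t s) (x 0 t s) (jc w g G δ σ t s) :=
    continuousOn_univ.1 (contRR (B.sU D 0 ht).continuousOn (B.sU D 1 ht).continuousOn
      (B.sU D 2 ht).continuousOn (B.sY D ht).continuousOn
      (D.hx.conts 0 (B.sub ht)).continuousOn (B.sj D hδ ht).continuousOn)
  have cp := B.sph D ht
  have h1 := abs_int_le cR.neg (g := fun s => 720 * K ^ 2 * (4 * ph w x g G σ t s + 1 * ‖δ‖ ^ 2))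
    (by fun_prop) (fun s => by
      rw [Pi.neg_apply, abs_neg]
      refine (B.ests D hδ ht s).1.trans (mul_le_mul_of_nonneg_left ?_ (by positivity))
      have := (B.ph_bd D ht s).1
      have := sq_nonneg ‖Yc g G σ t s‖
      linarith)
  refine h1.trans ?_
  rw [intervalIntegral.integral_const_mul]
  have := mul_le_mul_of_nonneg_left (B.int_sq D ht) (show 0 ≤ 720 * K ^ 2 by positivity)
  linarith

lemma int_q (B : Branch T K w x g G δ τ ρ I σ) (D : Dat T K w x g G δ) {t : ℝ} (ht : t ∈ I) :
    ∫ s in (0:ℝ)..2 * π, (‖Yc g G σ t s‖ + ‖x 0 t s - Uc w σ 0 t s‖ + ‖δ‖) ^ 2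
      ≤ 21 * En w x g G δ σ t := by
  have c1 := B.sY D ht
  have c2 := B.sU D 0 ht
  have c3 := D.hx.conts 0 (B.sub ht)
  have cp := B.sph D ht
  have := int_mono (f := fun s => (‖Yc g G σ t s‖ + ‖x 0 t s - Uc w σ 0 t s‖ + ‖δ‖) ^ 2)
    (g := fun s => 3 * (4 * ph w x g G σ t s + 1 * ‖δ‖ ^ 2)) (by fun_prop) (by fun_prop) (fun s => by
      refine (sq_three _ _ _).trans ?_
      have := (B.ph_bd D ht s).1
      have := sq_nonneg ‖Yc g G σ t s‖
      linarith)
  refine this.trans ?_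
  rw [intervalIntegral.integral_const_mul]
  linarith [B.int_sq D ht]

lemma σ_near (B : Branch T K w x g G δ τ ρ I σ) (D : Dat T K w x g G δ) (hδ : ‖δ‖ ≤ 1 / 16)
    {t : ℝ} (ht : t ∈ I) (s : ℝ) :
    (σ t s - (s + σ t 0)) ^ 2 ≤ 35000 * K ^ 2 * En w x g G δ σ t := by
  have main : ∀ s ∈ Set.Icc 0 (2 * π),
      (σ t s - (s + σ t 0)) ^ 2 ≤ 35000 * K ^ 2 * En w x g G δ σ t := by
    intro s hs
    have c1 := B.sY D ht
    have c2 := B.sU D 0 ht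
    have c3 := D.hx.conts 0 (B.sub ht)
    have c4 := B.sj D hδ ht
    have cS : Continuous fun s => sS δ (Uc w σ 0 t s) (x 0 t s) (jc w g G δ σ t s) := by
      unfold sS
      refine Continuous.mul ?_ c4
      exact continuousOn_univ.1 (c3.continuousOn.dot' (by fun_prop))
    have hd : ∀ s, HasDerivAt (fun s => σ t s - (s + σ t 0))
        (sS δ (Uc w σ 0 t s) (x 0 t s) (jc w g G δ σ t s) - 1) s := fun s =>
      (B.σ_s D hδ ht s).sub ((hasDerivAt_id s).add_const _)
    have h1 := poinc_sup hd (by fun_prop) (c := 0) ⟨le_rfl, by positivity⟩ (by ring) hs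
    have h2 := int_mono (f := fun s => (sS δ (Uc w σ 0 t s) (x 0 t s) (jc w g G δ σ t s) - 1) ^ 2)
      (g := fun s => (64 * K ^ 2) * (‖Yc g G σ t s‖ + ‖x 0 t s - Uc w σ 0 t s‖ + ‖δ‖) ^ 2)
      (by fun_prop) (by fun_prop) (fun s => by
        have := (B.ests D hδ ht s).2.1
        have := pow_le_pow_left₀ (abs_nonneg _) this 2
        rw [sq_abs] at this
        linarith)
    rw [intervalIntegral.integral_const_mul] at h2
    have h3 := mul_le_mul_of_nonneg_left (B.int_q D ht) (show 0 ≤ 64 * K ^ 2 by positivity)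
    have h4 := mul_le_mul_of_nonneg_left (h2.trans h3) (show 0 ≤ 8 * π by positivity)
    refine (h1.trans h4).trans ?_
    have h5 : 8 * π ≤ 26 := by linarith [pi_lt_d2]
    have h6 : 0 ≤ K ^ 2 * En w x g G δ σ t := mul_nonneg (sq_nonneg _) (B.En_nonneg D ht)
    have h7 := mul_le_mul_of_nonneg_right h5 h6
    linarith
  have hper : Function.Periodic (fun s => σ t s - (s + σ t 0)) (2 * π) := by
    intro s
    simp only
    rw [B.per t ht s]; ring
  obtain ⟨r, hr, e⟩ := hper.exists_mem_Ico₀ (by positivity) s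
  rw [e]
  exact main r ⟨hr.1, hr.2.le⟩

lemma Y_near (B : Branch T K w x g G δ τ ρ I σ) (D : Dat T K w x g G δ) (hδ : ‖δ‖ ≤ 1 / 16)
    {t : ℝ} (ht : t ∈ I) (s : ℝ) :
    ‖Yc g G σ t s‖ ^ 2 ≤ 3100 * K ^ 2 * En w x g G δ σ t := by
  have main : ∀ s ∈ Set.Icc 0 (2 * π),
      ‖Yc g G σ t s‖ ^ 2 ≤ 3100 * K ^ 2 * En w x g G δ σ t := by
    intro s hs
    have c1 := B.sY D ht
    have c2 := B.sU D 0 ht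
    have c3 := D.hx.conts 0 (B.sub ht)
    have c4 := B.sj D hδ ht
    have cS : Continuous fun s => sS δ (Uc w σ 0 t s) (x 0 t s) (jc w g G δ σ t s) := by
      unfold sS
      refine Continuous.mul ?_ c4
      exact continuousOn_univ.1 (c3.continuousOn.dot' (by fun_prop))
    have h1 := sob_sup (B.Y_s D hδ ht) (by fun_prop) hs
    have h2 := int_mono (f := fun s => 2 * ‖Yc g G σ t s‖ ^ 2 +
      ‖x 0 t s - sS δ (Uc w σ 0 t s) (x 0 t s) (jc w g G δ σ t s) • (Uc w σ 0 t s + δ)‖ ^ 2)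
      (g := fun s => (146 * K ^ 2) * (‖Yc g G σ t s‖ + ‖x 0 t s - Uc w σ 0 t s‖ + ‖δ‖) ^ 2)
      (by fun_prop) (by fun_prop) (fun s => by
        have h3 := pow_le_pow_left₀ (norm_nonneg _) (B.ests D hδ ht s).2.2 2
        have h0 := norm_nonneg (Yc g G σ t s)
        have h0' := norm_nonneg (x 0 t s - Uc w σ 0 t s)
        have h0'' := norm_nonneg δ
        have h4 : ‖Yc g G σ t s‖ ^ 2 ≤
          (‖Yc g G σ t s‖ + ‖x 0 t s - Uc w σ 0 t s‖ + ‖δ‖) ^ 2 :=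
          pow_le_pow_left₀ h0 (by linarith) 2
        have h5 : 1 ≤ K ^ 2 := one_le_pow₀ D.K1
        have h6 := mul_le_mul_of_nonneg_right h5
          (sq_nonneg (‖Yc g G σ t s‖ + ‖x 0 t s - Uc w σ 0 t s‖ + ‖δ‖))
        linarith)
    rw [intervalIntegral.integral_const_mul] at h2
    have h3 := mul_le_mul_of_nonneg_left (B.int_q D ht) (show 0 ≤ 146 * K ^ 2 by positivity)
    have h6 : 0 ≤ K ^ 2 * En w x g G δ σ t := mul_nonneg (sq_nonneg _) (B.En_nonneg D ht)
    refine (h1.trans (h2.trans h3)).trans ?_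
    linarith
  have hper : Function.Periodic (fun s => Yc g G σ t s) (2 * π) := by
    intro s
    simp only [Yc]
    rw [B.per t ht s, D.per t (B.sub ht)]
  obtain ⟨r, hr, e⟩ := hper.exists_mem_Ico₀ (by positivity) s
  rw [e]
  exact main r ⟨hr.1, hr.2.le⟩

lemma G_near (B : Branch T K w x g G δ τ ρ I σ) (D : Dat T K w x g G δ) (hδ : ‖δ‖ ≤ 1 / 16)
    {t : ℝ} (ht : t ∈ I) (s : ℝ) :
    ‖G t s - g t (s + σ t 0)‖ ^ 2 ≤ 300000 * K ^ 2 * En w x g G δ σ t := by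
  have h1 := B.σ_near D hδ ht s
  have h2 := B.Y_near D hδ ht s
  have h3 := D.g_lip hδ (B.sub ht) (σ t s) (s + σ t 0)
  have h4 : ‖G t s - g t (s + σ t 0)‖ ≤ ‖Yc g G σ t s‖ + 2 * |σ t s - (s + σ t 0)| := by
    have : G t s - g t (s + σ t 0) = Yc g G σ t s + (g t (σ t s) - g t (s + σ t 0)) := by
      rw [Yc]; abel
    rw [this]
    exact (norm_add_le _ _).trans (by linarith)
  have h5 := pow_le_pow_left₀ (norm_nonneg _) h4 2
  rw [← sq_abs] at h1
  have h6 : 0 ≤ K ^ 2 * En w x g G δ σ t := mul_nonneg (sq_nonneg _) (B.En_nonneg D ht)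
  linarith [sq_nonneg (‖Yc g G σ t s‖ - 2 * |σ t s - (s + σ t 0)|)]

lemma L2_near (B : Branch T K w x g G δ τ ρ I σ) (D : Dat T K w x g G δ) (hδ : ‖δ‖ ≤ 1 / 16)
    {t : ℝ} (ht : t ∈ I) :
    ∫ s in (0:ℝ)..2 * π, ‖x 0 t s - w 0 t (s + σ t 0)‖ ^ 2 ≤
      500000 * K ^ 4 * En w x g G δ σ t := by
  have c1 := B.sph D ht
  have c2 := D.hw.conts 0 (B.sub ht)
  have c3 := D.hx.conts 0 (B.sub ht)
  have h0 := B.En_nonneg D ht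
  have hm := int_mono (f := fun s => ‖x 0 t s - w 0 t (s + σ t 0)‖ ^ 2)
    (g := fun s => 8 * ph w x g G σ t s + 1 * (70000 * K ^ 4 * En w x g G δ σ t))
    (by fun_prop) (by fun_prop) (fun s => by
      have h1 := B.σ_near D hδ ht s
      have h2 := (B.ph_bd D ht s).1
      have h3 := D.w_lip (B.sub ht) (σ t s) (s + σ t 0)
      have h4 : ‖x 0 t s - w 0 t (s + σ t 0)‖ ≤ ‖x 0 t s - Uc w σ 0 t s‖
          + K * |σ t s - (s + σ t 0)| := by
        have : x 0 t s - w 0 t (s + σ t 0) = (x 0 t s - Uc w σ 0 t s)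
          + (w 0 t (σ t s) - w 0 t (s + σ t 0)) := by rw [Uc]; abel
        rw [this]
        exact (norm_add_le _ _).trans (by linarith)
      have h5 := pow_le_pow_left₀ (norm_nonneg _) h4 2
      rw [← sq_abs] at h1
      have h6 := mul_le_mul_of_nonneg_left h1 (sq_nonneg K)
      linarith [sq_nonneg (‖x 0 t s - Uc w σ 0 t s‖ - K * |σ t s - (s + σ t 0)|),
        sq_nonneg ‖Yc g G σ t s‖])
  refine hm.trans ?_
  rw [int_lin c1 continuous_const, intervalIntegral.integral_const, sub_zero, smul_eq_mul, one_mul]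
  have h7 : ∫ s in (0:ℝ)..2 * π, ph w x g G σ t s ≤ En w x g G δ σ t := by
    rw [En]; linarith [sq_nonneg ‖δ‖]
  have hK : 1 ≤ K ^ 4 := one_le_pow₀ D.K1
  have h8 := mul_le_mul_of_nonneg_right hK h0
  have h9 := mul_le_mul_of_nonneg_right two_pi_le
    (show 0 ≤ 70000 * K ^ 4 * En w x g G δ σ t by positivity)
  linarith

end Branch


/-! ### Continuation in time -/

/-- the state propagated in time -/
def PP (K : ℝ) (w x : ℕ → ℝ → ℝ → R3) (g G : ℝ → ℝ → R3) (δ : R3) (ρ E0 t τ : ℝ) : Prop :=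
  ∃ σ0 : ℝ → ℝ, σ0 0 = τ ∧ (∀ s, |σ0 s - (s + τ)| ≤ 5 * ρ) ∧ (∀ s, Gf w g G δ t s (σ0 s) = 0) ∧
    (∀ s, ‖G t s - g t (s + τ)‖ ≤ ρ / 2) ∧
    En w x g G δ (fun _ => σ0) t ≤ exp (5040 * K ^ 2 * |t|) * E0 ∧
    ∫ s in (0:ℝ)..2 * π, ‖x 0 t s - w 0 t (s + τ)‖ ^ 2 ≤
      500000 * K ^ 4 * (exp (5040 * K ^ 2 * |t|) * E0)

section
variable {T K : ℝ} {w x : ℕ → ℝ → ℝ → R3} {g G : ℝ → ℝ → R3} {δ : R3} {τ ρ E0 : ℝ} {I : Set ℝ}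
  {σ : ℝ → ℝ → ℝ}

lemma Branch.pp (B : Branch T K w x g G δ τ ρ I σ) (D : Dat T K w x g G δ) (hδ : ‖δ‖ ≤ 1 / 16)
    (hρ : 0 < ρ) (hE0 : 0 ≤ E0)
    (hs : 300000 * K ^ 2 * (exp (5040 * K ^ 2 * T) * E0) ≤ (ρ / 2) ^ 2) {t : ℝ} (ht : t ∈ I)
    (hE : En w x g G δ σ t ≤ exp (5040 * K ^ 2 * |t|) * E0) :
    PP K w x g G δ ρ E0 t (σ t 0) := by
  have hT := B.sub ht
  have habs : |t| ≤ T := abs_le.2 ⟨hT.1.le, hT.2.le⟩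
  have h0 := B.En_nonneg D ht
  have hE2 : En w x g G δ σ t ≤ exp (5040 * K ^ 2 * T) * E0 := hE.trans (by gcongr)
  have hE3 := mul_le_mul_of_nonneg_left hE2 (sq_nonneg K)
  have hE4 : 0 ≤ K ^ 2 * En w x g G δ σ t := mul_nonneg (sq_nonneg _) h0
  refine ⟨σ t, rfl, fun s => ?_, fun s => B.zero t ht s, fun s => ?_, hE, ?_⟩
  · have h1 := B.σ_near D hδ ht s
    have h2 : |σ t s - (s + σ t 0)| ≤ ρ / 2 := by
      apply abs_le_of_sq_le_sq _ (by positivity)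
      linarith
    linarith
  · have h1 := B.G_near D hδ ht s
    apply le_of_sq_le_sq _ (by positivity)
    linarith
  · exact (B.L2_near D hδ ht).trans (by gcongr)

lemma Dat.bound (D : Dat T K w x g G δ) {T2 : ℝ} (hT2 : T2 < T) :
    ∃ N, 0 ≤ N ∧ ∀ t, |t| ≤ T2 → ∀ s, ‖x 1 t s‖ ≤ N := by
  have hsub : Set.Icc (-T2) T2 ×ˢ Set.Icc 0 (2 * π) ⊆ Set.Ioo (-T) T ×ˢ Set.univ := fun p hp =>
    ⟨⟨by linarith [hp.1.1], by linarith [hp.1.2]⟩, trivial⟩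
  obtain ⟨N, hN⟩ := (isCompact_Icc.prod isCompact_Icc).exists_bound_of_continuousOn
    ((D.hx.cont 1).mono hsub)
  refine ⟨max N 0, le_max_right _ _, fun t ht s => ?_⟩
  have ht' := abs_le.1 ht
  have hper : Function.Periodic (x 1 t) (2 * π) := fun s =>
    D.hx.per 1 t ⟨by linarith [ht'.1], by linarith [ht'.2]⟩ s
  obtain ⟨r, hr, e⟩ := hper.exists_mem_Ico₀ (by positivity) s
  rw [e]
  exact (hN (t, r) ⟨ht', hr.1, hr.2.le⟩).trans (le_max_left _ _)

lemma Dat.step_branch (D : Dat T K w x g G δ) (hδ : ‖δ‖ ≤ 1 / 16) (hρ : ρ * (44 * K) = 1)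
    (hρ0 : 0 < ρ) {T1 : ℝ} (hT1 : T1 < T) :
    ∃ h, 0 < h ∧ ∀ t0, |t0| ≤ T1 → ∀ τ, (∀ s, ‖G t0 s - g t0 (s + τ)‖ ≤ ρ / 2) →
      ∃ σ, Branch T K w x g G δ τ ρ (Set.Ioo (t0 - h) (t0 + h)) σ := by
  obtain ⟨N, hN0, hN⟩ := D.bound (T2 := (T1 + T) / 2) (by linarith)
  have hK := D.K1
  refine ⟨min ((T - T1) / 2) (ρ / (4 * (N + K))), lt_min (by linarith) (by positivity), ?_⟩
  intro t0 ht0 τ hτ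
  set h := min ((T - T1) / 2) (ρ / (4 * (N + K))) with hh
  have h1 : h ≤ (T - T1) / 2 := min_le_left _ _
  have h2 : h ≤ ρ / (4 * (N + K)) := min_le_right _ _
  have ht0' := abs_le.1 ht0
  have hh0 : 0 < h := lt_min (by linarith) (by positivity)
  have hT2 : ∀ t ∈ Set.Ioo (t0 - h) (t0 + h), |t| ≤ (T1 + T) / 2 := fun t ht =>
    abs_le.2 ⟨by linarith [ht.1], by linarith [ht.2]⟩
  have hIT : Set.Ioo (t0 - h) (t0 + h) ⊆ Set.Ioo (-T) T := fun t ht =>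
    ⟨by linarith [ht.1], by linarith [ht.2]⟩
  refine D.exists_branch hδ hρ isOpen_Ioo hIT ?_
  intro t ht s
  have m := (convex_Ioo (t0 - h) (t0 + h)).norm_image_sub_le_of_norm_hasDerivWithin_le
    (f := fun t => G t s - g t (s + τ)) (C := N + K) (x := t0) (y := t)
    (fun t ht => ((D.hG.dt t (hIT ht) s).sub (D.gt t (hIT ht) (s + τ))).hasDerivWithinAt)
    (fun t ht => by
      refine (norm_sub_le _ _).trans (add_le_add ?_ ?_)
      · refine (norm_cross3_le _ _).trans ?_
        rw [D.hx.unit t (hIT ht), one_mul]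
        exact hN t (hT2 t ht) s
      · refine (norm_cross3_le _ _).trans ?_
        rw [D.hw.unit t (hIT ht), one_mul]
        exact D.b1 t (hIT ht) _) ⟨by linarith, by linarith⟩ ht
  have m2 : ‖t - t0‖ ≤ ρ / (4 * (N + K)) := by
    rw [Real.norm_eq_abs]
    exact (abs_le.2 ⟨by linarith [ht.1], by linarith [ht.2]⟩ : |t - t0| ≤ h).trans h2
  have m3 : (N + K) * ‖t - t0‖ ≤ ρ / 4 := by
    refine (mul_le_mul_of_nonneg_left m2 (by positivity)).trans (le_of_eq ?_)
    field_simp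
  have m4 := norm_sub_norm_le (G t s - g t (s + τ)) (G t0 s - g t0 (s + τ))
  have := hτ s
  linarith

lemma Dat.step (D : Dat T K w x g G δ) (hδ : ‖δ‖ ≤ 1 / 16) (hρ : ρ * (44 * K) = 1)
    (hρ0 : 0 < ρ) (hE0 : 0 ≤ E0)
    (hs : 300000 * K ^ 2 * (exp (5040 * K ^ 2 * T) * E0) ≤ (ρ / 2) ^ 2) {T1 : ℝ} (hT1 : T1 < T) :
    ∃ h, 0 < h ∧ ∀ t0, |t0| ≤ T1 → ∀ τ, PP K w x g G δ ρ E0 t0 τ →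
      ∃ θ : ℝ → ℝ, ContinuousOn θ (Set.Ioo (t0 - h) (t0 + h)) ∧ θ t0 = τ ∧
        ∀ t ∈ Set.Ioo (t0 - h) (t0 + h), |t| = |t0| + |t - t0| → PP K w x g G δ ρ E0 t (θ t) := by
  obtain ⟨h, hh, H⟩ := D.step_branch hδ hρ hρ0 hT1
  refine ⟨h, hh, ?_⟩
  rintro t0 ht0 τ ⟨σ0, e0, n0, z0, c0, E1, -⟩
  obtain ⟨σ, B⟩ := H t0 ht0 τ c0
  have m0 : t0 ∈ Set.Ioo (t0 - h) (t0 + h) := ⟨by linarith, by linarith⟩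
  have eσ : σ t0 = σ0 := funext fun s =>
    D.uniq hδ (B.sub m0) hρ ((c0 s).trans_lt (by linarith)) (B.near5 t0 m0 s) (n0 s)
      (B.zero t0 m0 s) (z0 s)
  refine ⟨fun t => σ t 0, ?_, by simp only [eσ, e0], ?_⟩
  · exact B.cσ.comp (f := fun t => (t, (0:ℝ))) (by fun_prop) (fun t ht => ⟨ht, trivial⟩)
  · intro t ht habs
    refine B.pp D hδ hρ0 hE0 hs ht ?_
    refine (Branch.En_gron D hδ B m0 ht).trans ?_
    have e2 : En w x g G δ σ t0 = En w x g G δ (fun _ => σ0) t0 := by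
      simp only [En, Branch.ph, Yc, Uc, eσ]
    have e3 : exp (5040 * K ^ 2 * (|t0| + |t - t0|)) * E0 =
        exp (5040 * K ^ 2 * |t - t0|) * (exp (5040 * K ^ 2 * |t0|) * E0) := by
      rw [mul_add, exp_add]; ring
    rw [e2, habs, e3]
    exact mul_le_mul_of_nonneg_left E1 (exp_pos _).le

lemma Dat.init (D : Dat T K w x g G δ) (hδ : ‖δ‖ ≤ 1 / 16) (hρ : ρ * (44 * K) = 1)
    (hρ0 : 0 < ρ) {ε : ℝ} (hε : 0 ≤ ε)
    (hA : ∫ s in (0:ℝ)..2 * π, ‖x 0 0 s - w 0 0 s‖ ^ 2 = ε ^ 2) (hδε : ‖δ‖ ≤ ε)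
    (hGg : ∀ s, ‖G 0 s - g 0 s‖ ≤ 13 * ε) (hε0 : 13 * ε ≤ ρ / 2)
    (hE0 : E0 = 120000 * K ^ 2 * ε ^ 2)
    (hs : 300000 * K ^ 2 * (exp (5040 * K ^ 2 * T) * E0) ≤ (ρ / 2) ^ 2) :
    ∃ τ, PP K w x g G δ ρ E0 0 τ := by
  obtain ⟨h, hh, H⟩ := D.step_branch hδ hρ hρ0 (T1 := 0) (by linarith [D.zero.1, D.zero.2])
  obtain ⟨σ, B⟩ := H 0 (by simp) 0 (fun s => by rw [add_zero]; exact (hGg s).trans hε0)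
  have m0 : (0:ℝ) ∈ Set.Ioo (0 - h) (0 + h) := ⟨by linarith, by linarith⟩
  have hK2 : 1 ≤ K ^ 2 := one_le_pow₀ D.K1
  have hK := D.K1
  refine ⟨σ 0 0, B.pp D hδ hρ0 (by rw [hE0]; positivity) hs m0 ?_⟩
  rw [abs_zero, mul_zero, exp_zero, one_mul, hE0]
  have c1 := B.sph D m0
  have c2 := D.hw.conts 0 D.zero
  have c3 := D.hx.conts 0 D.zero
  have hm := int_mono (f := fun s => Branch.ph w x g G σ 0 s)
    (g := fun s => 1 * ‖x 0 0 s - w 0 0 s‖ ^ 2 + 1 * (16400 * K ^ 2 * ε ^ 2))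
    (by fun_prop) (by fun_prop) (fun s => by
      refine (B.ph_bd D m0 s).2.trans ?_
      have n1 := B.near 0 m0 s
      have n2 := hGg s
      rw [add_zero] at n1
      have n3 : |σ 0 s - s| ≤ 52 * ε := by linarith
      have y1 : ‖Yc g G σ 0 s‖ ≤ 117 * ε := by
        have : Yc g G σ 0 s = (G 0 s - g 0 s) - (g 0 (σ 0 s) - g 0 s) := by rw [Yc]; abel
        rw [this]
        have := D.g_lip hδ D.zero (σ 0 s) s
        exact (norm_sub_le _ _).trans (by linarith)
      have z1 : ‖x 0 0 s - Uc w σ 0 0 s‖ ≤ ‖x 0 0 s - w 0 0 s‖ + K * (52 * ε) := by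
        have : x 0 0 s - Uc w σ 0 0 s = (x 0 0 s - w 0 0 s) - (w 0 0 (σ 0 s) - w 0 0 s) := by
          rw [Uc]; abel
        rw [this]
        have h1 := D.w_lip D.zero (σ 0 s) s
        have h2 := mul_le_mul_of_nonneg_left n3 (show 0 ≤ K by linarith)
        exact (norm_sub_le _ _).trans (by linarith)
      have y2 := pow_le_pow_left₀ (norm_nonneg _) y1 2
      have z2 := pow_le_pow_left₀ (norm_nonneg _) z1 2
      have k1 : ε ^ 2 ≤ K ^ 2 * ε ^ 2 := le_mul_of_one_le_left (sq_nonneg ε) hK2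
      have y3 : ‖Yc g G σ 0 s‖ ^ 2 ≤ 13689 * ε ^ 2 := y2.trans (le_of_eq (by ring))
      have z3 : (‖x 0 0 s - w 0 0 s‖ + K * (52 * ε)) ^ 2 ≤
          2 * ‖x 0 0 s - w 0 0 s‖ ^ 2 + 5408 * (K ^ 2 * ε ^ 2) := by
        nlinarith [sq_nonneg (‖x 0 0 s - w 0 0 s‖ - K * (52 * ε))]
      have k3 : 16400 * K ^ 2 * ε ^ 2 = 16400 * (K ^ 2 * ε ^ 2) := by ring
      have k4 : 0 ≤ K ^ 2 * ε ^ 2 := by positivity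
      rw [k3]
      linarith)
  have ci : Continuous fun s => ‖x 0 0 s - w 0 0 s‖ ^ 2 := by fun_prop
  rw [int_lin ci continuous_const, intervalIntegral.integral_const, sub_zero, smul_eq_mul, hA] at hm
  rw [En]
  have d2 := pow_le_pow_left₀ (norm_nonneg _) hδε 2
  have k1 : ε ^ 2 ≤ K ^ 2 * ε ^ 2 := le_mul_of_one_le_left (sq_nonneg ε) hK2
  have k2 := mul_le_mul_of_nonneg_right two_pi_le (show 0 ≤ 16400 * K ^ 2 * ε ^ 2 by positivity)
  have k3 : 16400 * K ^ 2 * ε ^ 2 = 16400 * (K ^ 2 * ε ^ 2) := by ring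
  have k4 : 0 ≤ K ^ 2 * ε ^ 2 := by positivity
  rw [k3] at k2 hm
  rw [mul_assoc 120000]
  linarith

end

/-! ### Abstract continuation -/

lemma lift_compact {Q : ℝ → ℝ → Prop} {h b : ℝ} (hh : 0 < h)
    (hst : ∀ t0, 0 ≤ t0 → t0 ≤ b → ∀ τ, Q t0 τ → ∃ θ : ℝ → ℝ,
      ContinuousOn θ (Set.Icc t0 (t0 + h)) ∧ θ t0 = τ ∧ ∀ t ∈ Set.Icc t0 (t0 + h), Q t (θ t))
    {a : ℝ} (ha : 0 ≤ a) {θ0 : ℝ → ℝ} (hc : ContinuousOn θ0 (Set.Icc 0 a))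
    (hQ : ∀ t ∈ Set.Icc 0 a, Q t (θ0 t)) (hab : a ≤ b) :
    ∃ θ : ℝ → ℝ, ContinuousOn θ (Set.Icc 0 b) ∧ (∀ t ∈ Set.Icc 0 b, Q t (θ t)) ∧
      ∀ t ∈ Set.Icc 0 a, θ t = θ0 t := by
  have main : ∀ n : ℕ, ∃ θ : ℝ → ℝ, ContinuousOn θ (Set.Icc 0 (min (a + n * h) b)) ∧
      (∀ t ∈ Set.Icc 0 (min (a + n * h) b), Q t (θ t)) ∧ ∀ t ∈ Set.Icc 0 a, θ t = θ0 t := by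
    intro n
    induction n with
    | zero =>
      refine ⟨θ0, ?_, ?_, fun _ _ => rfl⟩
      · simpa [hab] using hc
      · simpa [hab] using hQ
    | succ n ih =>
      obtain ⟨θ, c1, q1, e1⟩ := ih
      set m := min (a + n * h) b with hm
      have hm0 : 0 ≤ m := le_min (by positivity) (by linarith)
      have ham : a ≤ m := le_min (by nlinarith [Nat.cast_nonneg (α := ℝ) n]) hab
      obtain ⟨ψ, c2, e2, q2⟩ := hst m hm0 (min_le_right _ _) (θ m) (q1 m ⟨hm0, le_rfl⟩)
      have hle : min (a + (n + 1 : ℕ) * h) b ≤ m + h := by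
        rw [hm, ← min_add_add_right]
        refine min_le_min ?_ (by linarith)
        push_cast; linarith
      refine ⟨fun t => θ (min t m) + ψ (max t m) - θ m, ?_, ?_, ?_⟩
      · refine (ContinuousOn.add ?_ ?_).sub continuousOn_const
        · refine c1.comp (f := fun t => min t m) (by fun_prop) ?_
          intro t ht
          exact ⟨le_min ht.1 hm0, min_le_right _ _⟩
        · refine c2.comp (f := fun t => max t m) (by fun_prop) ?_
          intro t ht
          exact ⟨le_max_right _ _, max_le (ht.2.trans hle) (by linarith)⟩
      · intro t ht
        rcases le_total t m with h1 | h1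
        · simp only [min_eq_left h1, max_eq_right h1, e2, add_sub_cancel_right]
          exact q1 t ⟨ht.1, h1⟩
        · simp only [min_eq_right h1, max_eq_left h1, add_sub_cancel_left]
          exact q2 t ⟨h1, ht.2.trans hle⟩
      · intro t ht
        have h1 : t ≤ m := ht.2.trans ham
        simp only [min_eq_left h1, max_eq_right h1, e2, add_sub_cancel_right]
        exact e1 t ht
  obtain ⟨n, hn⟩ := exists_nat_ge ((b - a) / h)
  obtain ⟨θ, c1, q1, e1⟩ := main n
  have : min (a + n * h) b = b := by
    apply min_eq_right
    rw [div_le_iff₀ hh] at hn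
    linarith
  rw [this] at c1 q1
  exact ⟨θ, c1, q1, e1⟩

lemma lift_all {Q : ℝ → ℝ → Prop} {T : ℝ} (hT : 0 < T)
    (hst : ∀ T1, T1 < T → ∃ h, 0 < h ∧ ∀ t0, 0 ≤ t0 → t0 ≤ T1 → ∀ τ, Q t0 τ → ∃ θ : ℝ → ℝ,
      ContinuousOn θ (Set.Icc t0 (t0 + h)) ∧ θ t0 = τ ∧ ∀ t ∈ Set.Icc t0 (t0 + h), Q t (θ t))
    {α : ℝ} (hα : Q 0 α) :
    ∃ θ : ℝ → ℝ, ContinuousOn θ (Set.Ico 0 T) ∧ θ 0 = α ∧ ∀ t ∈ Set.Ico 0 T, Q t (θ t) := by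
  obtain ⟨b, bmono, blt, blim⟩ := exists_seq_strictMono_tendsto' hT
  have b0 : ∀ n, 0 < b n := fun n => (blt n).1
  let Good : ℕ → (ℝ → ℝ) → Prop := fun n θ => ContinuousOn θ (Set.Icc 0 (b n)) ∧
    (∀ t ∈ Set.Icc 0 (b n), Q t (θ t)) ∧ θ 0 = α
  have first : ∃ θ, Good 0 θ := by
    obtain ⟨h, hh, H⟩ := hst (b 0) (blt 0).2
    obtain ⟨θ, c, q, e⟩ := lift_compact hh H (a := 0) le_rfl (θ0 := fun _ => α) continuousOn_const
      (fun t ht => by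
        have : t = 0 := le_antisymm ht.2 ht.1
        rw [this]; exact hα) (b0 0).le
    exact ⟨θ, c, q, e 0 ⟨le_rfl, le_rfl⟩⟩
  have next : ∀ n θ, ∃ θ', Good n θ → Good (n + 1) θ' ∧ ∀ t ∈ Set.Icc 0 (b n), θ' t = θ t := by
    intro n θ
    by_cases hg : Good n θ
    · obtain ⟨h, hh, H⟩ := hst (b (n + 1)) (blt _).2
      obtain ⟨θ', c, q, e⟩ := lift_compact hh H (b0 n).le hg.1 hg.2.1 (bmono (Nat.lt_succ_self n)).le
      exact ⟨θ', fun _ => ⟨⟨c, q, (e 0 ⟨le_rfl, (b0 n).le⟩).trans hg.2.2⟩, e⟩⟩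
    · exact ⟨θ, fun h => absurd h hg⟩
  obtain ⟨θ0, hθ0⟩ := first
  choose nx hnx using next
  let F : ℕ → ℝ → ℝ := fun n => Nat.rec θ0 (fun n θ => nx n θ) n
  have hF : ∀ n, Good n (F n) := by
    intro n
    induction n with
    | zero => exact hθ0
    | succ n ih => exact (hnx n (F n) ih).1
  have hF1 : ∀ n, ∀ t ∈ Set.Icc 0 (b n), F (n + 1) t = F n t := fun n => (hnx n (F n) (hF n)).2
  have hF2 : ∀ n m, n ≤ m → ∀ t ∈ Set.Icc 0 (b n), F m t = F n t := by
    intro n m hnm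
    induction m, hnm using Nat.le_induction with
    | base => intro t _; rfl
    | succ m hnm ih =>
      intro t ht
      rw [hF1 m t ⟨ht.1, ht.2.trans (bmono.monotone hnm)⟩, ih t ht]
  have hF3 : ∀ n m t, t ∈ Set.Icc 0 (b n) → t ∈ Set.Icc 0 (b m) → F m t = F n t := by
    intro n m t hn hm
    rcases le_total n m with h | h
    · exact hF2 n m h t hn
    · exact (hF2 m n h t hm).symm
  have ex : ∀ t, ∃ n, t < T → t < b n := by
    intro t
    by_cases h : t < T
    · obtain ⟨n, hn⟩ := (blim.eventually (lt_mem_nhds h)).exists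
      exact ⟨n, fun _ => hn⟩
    · exact ⟨0, fun h' => absurd h' h⟩
  choose N hN using ex
  refine ⟨fun t => F (N t) t, ?_, (hF _).2.2, ?_⟩
  · intro t ht
    have hb := hN t ht.2
    have c := (hF (N t)).1 t ⟨ht.1, hb.le⟩
    have c2 : ContinuousWithinAt (F (N t)) (Set.Ico 0 T) t := by
      refine c.mono_of_mem_nhdsWithin ?_
      filter_upwards [self_mem_nhdsWithin, mem_nhdsWithin_of_mem_nhds (Iio_mem_nhds hb)] with r h1 h2
      exact ⟨h1.1, le_of_lt h2⟩
    refine c2.congr_of_eventuallyEq ?_ rfl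
    filter_upwards [self_mem_nhdsWithin, mem_nhdsWithin_of_mem_nhds (Iio_mem_nhds hb)] with r h1 h2
    exact hF3 _ _ r ⟨h1.1, le_of_lt h2⟩ ⟨h1.1, (hN r h1.2).le⟩
  · intro t ht
    exact (hF (N t)).2.1 t ⟨ht.1, (hN t ht.2).le⟩


/-! ### Assembly -/

lemma Dat.global {T K : ℝ} {w x : ℕ → ℝ → ℝ → R3} {g G : ℝ → ℝ → R3} {δ : R3} {ρ E0 α : ℝ}
    (D : Dat T K w x g G δ) (hT : 0 < T) (hδ : ‖δ‖ ≤ 1 / 16) (hρ : ρ * (44 * K) = 1)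
    (hρ0 : 0 < ρ) (hE0 : 0 ≤ E0)
    (hs : 300000 * K ^ 2 * (exp (5040 * K ^ 2 * T) * E0) ≤ (ρ / 2) ^ 2)
    (hα : PP K w x g G δ ρ E0 0 α) :
    ∃ σ : ℝ → ℝ, ContinuousOn σ (Set.Ioo (-T) T) ∧
      ∀ t ∈ Set.Ioo (-T) T, PP K w x g G δ ρ E0 t (σ t) := by
  obtain ⟨θ1, c1, e1, q1⟩ := lift_all (Q := fun t τ => PP K w x g G δ ρ E0 t τ) hT (by
    intro T1 hT1
    obtain ⟨h, hh, H⟩ := D.step hδ hρ hρ0 hE0 hs hT1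
    refine ⟨h / 2, by positivity, fun t0 h0 h1 τ hτ => ?_⟩
    obtain ⟨θ, c, e, q⟩ := H t0 (by rwa [abs_of_nonneg h0]) τ hτ
    refine ⟨θ, c.mono ?_, e, fun t ht => q t ⟨by linarith [ht.1], by linarith [ht.2]⟩ ?_⟩
    · intro t ht
      exact ⟨by linarith [ht.1], by linarith [ht.2]⟩
    · have a1 := ht.1
      rw [abs_of_nonneg (h0.trans a1), abs_of_nonneg h0, abs_of_nonneg (sub_nonneg.2 a1)]; ring) hα
  obtain ⟨θ2, c2, e2, q2⟩ := lift_all (Q := fun t τ => PP K w x g G δ ρ E0 (-t) τ) hT (by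
    intro T1 hT1
    obtain ⟨h, hh, H⟩ := D.step hδ hρ hρ0 hE0 hs hT1
    refine ⟨h / 2, by positivity, fun t0 h0 h1 τ hτ => ?_⟩
    obtain ⟨θ, c, e, q⟩ := H (-t0) (by rwa [abs_neg, abs_of_nonneg h0]) τ hτ
    refine ⟨fun t => θ (-t), c.comp (f := fun t => -t) (by fun_prop) ?_, e,
      fun t ht => q (-t) ⟨by linarith [ht.2], by linarith [ht.1]⟩ ?_⟩
    · intro t ht
      exact ⟨by linarith [ht.2], by linarith [ht.1]⟩
    · have a1 := ht.1
      have a2 : -t - -t0 = -(t - t0) := by ring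
      rw [a2, abs_neg, abs_neg, abs_neg, abs_of_nonneg (h0.trans a1), abs_of_nonneg h0,
        abs_of_nonneg (sub_nonneg.2 a1)]; ring) (by simpa using hα)
  refine ⟨fun t => θ1 (max t 0) + θ2 (max (-t) 0) - α, ?_, ?_⟩
  · refine (ContinuousOn.add ?_ ?_).sub continuousOn_const
    · refine c1.comp (f := fun t => max t 0) (by fun_prop) ?_
      intro t ht
      exact ⟨le_max_right _ _, max_lt ht.2 hT⟩
    · refine c2.comp (f := fun t => max (-t) 0) (by fun_prop) ?_
      intro t ht
      exact ⟨le_max_right _ _, max_lt (by linarith [ht.1]) hT⟩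
  · intro t ht
    rcases le_total 0 t with h | h
    · have h2 : -t ≤ 0 := by linarith
      simp only [max_eq_left h, max_eq_right h2, e2, add_sub_cancel_right]
      exact q1 t ⟨h, ht.2⟩
    · have h2 : 0 ≤ -t := by linarith
      simp only [max_eq_right h, max_eq_left h2, e1, add_sub_cancel_left]
      have := q2 (-t) ⟨h2, by linarith [ht.1]⟩
      simpa using this

/-- Theorem 1, smooth-solution version: weak-strong stability, up
to a translation, for the Schrödinger map equation on the torus. -/
theorem stmt11
    (T M : ℝ) (hT : 0 < T) (hM : 0 < M) :
    ∃ C : ℝ, 0 < C ∧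
      ∀ u v : ℝ → ℝ → R3,
        ContDiffOn ℝ (⊤ : ℕ∞) (fun p : ℝ × ℝ => u p.1 p.2) (Set.Ioo (-T) T ×ˢ Set.univ) →
        ContDiffOn ℝ (⊤ : ℕ∞) (fun p : ℝ × ℝ => v p.1 p.2) (Set.Ioo (-T) T ×ˢ Set.univ) →
        (∀ t ∈ Set.Ioo (-T) T, ∀ s : ℝ, u t (s + 2 * π) = u t s) →
        (∀ t ∈ Set.Ioo (-T) T, ∀ s : ℝ, v t (s + 2 * π) = v t s) →
        (∀ t ∈ Set.Ioo (-T) T, ∀ s : ℝ, ‖u t s‖ = 1) →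
        (∀ t ∈ Set.Ioo (-T) T, ∀ s : ℝ, ‖v t s‖ = 1) →
        (∀ t ∈ Set.Ioo (-T) T, ∀ s : ℝ,
          deriv (fun τ => u τ s) t =
            deriv (fun σ => cross3 (u t σ) (deriv (u t) σ)) s) →
        (∀ t ∈ Set.Ioo (-T) T, ∀ s : ℝ,
          deriv (fun τ => v τ s) t =
            deriv (fun σ => cross3 (v t σ) (deriv (v t) σ)) s) →
        Real.sqrt (∫ s in (0:ℝ)..2 * π, ‖deriv (deriv (deriv (u 0))) s‖ ^ 2) ≤ M →
        ∃ σ : ℝ → ℝ, ContinuousOn σ (Set.Ioo (-T) T) ∧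
          ∀ t ∈ Set.Ioo (-T) T,
            Real.sqrt (∫ s in (0:ℝ)..2 * π, ‖v t s - u t (s + σ t)‖ ^ 2) ≤
              C * Real.sqrt (∫ s in (0:ℝ)..2 * π, ‖v 0 s - u 0 s‖ ^ 2) := by
  obtain ⟨K, hK, hap⟩ := apriori T M
  have hK0 : 0 < K := by linarith
  obtain ⟨ρ, hρdef⟩ : ∃ ρ, ρ = 1 / (44 * K) := ⟨_, rfl⟩
  have hρ0 : 0 < ρ := by rw [hρdef]; positivity
  have hρ : ρ * (44 * K) = 1 := by rw [hρdef]; field_simp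
  have hρ1 : ρ ≤ 1 := by nlinarith
  obtain ⟨E, hE⟩ : ∃ E, E = exp (5040 * K ^ 2 * T) := ⟨_, rfl⟩
  have hEpos : 0 < E := by rw [hE]; exact exp_pos _
  obtain ⟨P, hP⟩ : ∃ P, P = 300000 * K ^ 2 * (E * (120000 * K ^ 2)) := ⟨_, rfl⟩
  have hP0 : 0 < P := by rw [hP]; positivity
  obtain ⟨R, hR⟩ : ∃ R, R = 500000 * K ^ 4 * (E * (120000 * K ^ 2)) := ⟨_, rfl⟩
  have hR0 : 0 < R := by rw [hR]; positivity
  obtain ⟨ε0, hε0⟩ : ∃ ε0, ε0 = min (ρ / 26) (ρ / (2 * (P + 1))) := ⟨_, rfl⟩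
  have hεpos : 0 < ε0 := by rw [hε0]; exact lt_min (by positivity) (by positivity)
  have hC1 : 0 < sqrt R := sqrt_pos.2 hR0
  have hC2 : 0 < sqrt (8 * π) / ε0 := div_pos (sqrt_pos.2 (by positivity)) hεpos
  refine ⟨sqrt R + sqrt (8 * π) / ε0, by positivity, ?_⟩
  intro u v hu hv hup hvp hu1 hv1 hue hve hM3
  have h0 : (0:ℝ) ∈ Set.Ioo (-T) T := ⟨by linarith, hT⟩
  obtain ⟨w, hw, rfl, hw3⟩ := exists_sol hu hup hu1 hue
  obtain ⟨x, hx, rfl, -⟩ := exists_sol hv hvp hv1 hve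
  have hN : NN w 3 0 ≤ M ^ 2 := by
    rw [hw3 0 h0] at hM3
    exact (sqrt_le_left hM.le).1 hM3
  have hb := hap w hw h0 hN
  obtain ⟨g, G, δ, D, hδ, hGg⟩ := exists_dat h0 hK hw hx hb
  have hA0 : 0 ≤ ∫ s in (0:ℝ)..2 * π, ‖x 0 0 s - w 0 0 s‖ ^ 2 := int_nonneg fun s => by positivity
  have hsq := sq_sqrt hA0
  obtain ⟨ε, hε⟩ : ∃ ε, ε = sqrt (∫ s in (0:ℝ)..2 * π, ‖x 0 0 s - w 0 0 s‖ ^ 2) := ⟨_, rfl⟩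
  rw [← hε] at hδ hGg hsq ⊢
  have hεn : 0 ≤ ε := by rw [hε]; exact sqrt_nonneg _
  rcases le_total ε0 ε with hcase | hcase
  · refine ⟨fun _ => 0, continuousOn_const, fun t ht => ?_⟩
    have c2 := hw.conts 0 ht
    have c3 := hx.conts 0 ht
    have hm := int_mono (f := fun s => ‖x 0 t s - w 0 t (s + 0)‖ ^ 2) (g := fun _ => 4)
      (by simp only [add_zero]; fun_prop) continuous_const (fun s => by
        have h1 := norm_sub_le (x 0 t s) (w 0 t (s + 0))
        rw [hx.unit t ht, hw.unit t ht] at h1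
        have h2 := pow_le_pow_left₀ (norm_nonneg _) h1 2
        exact h2.trans (by norm_num))
    rw [intervalIntegral.integral_const, sub_zero, smul_eq_mul] at hm
    have h1 : sqrt (∫ s in (0:ℝ)..2 * π, ‖x 0 t s - w 0 t (s + 0)‖ ^ 2) ≤ sqrt (8 * π) :=
      sqrt_le_sqrt (hm.trans (le_of_eq (by ring)))
    have h2 : sqrt (8 * π) = sqrt (8 * π) / ε0 * ε0 := by field_simp
    have h3 : sqrt (8 * π) / ε0 * ε0 ≤ sqrt (8 * π) / ε0 * ε :=
      mul_le_mul_of_nonneg_left hcase hC2.le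
    have h4 : 0 ≤ sqrt R * ε := mul_nonneg hC1.le hεn
    rw [add_mul]
    linarith
  · have i1 : ε ≤ ρ / 26 := hcase.trans (by rw [hε0]; exact min_le_left _ _)
    have i2 : ε ≤ ρ / (2 * (P + 1)) := hcase.trans (by rw [hε0]; exact min_le_right _ _)
    have i3 : ε * (P + 1) ≤ ρ / 2 := by
      have := mul_le_mul_of_nonneg_right i2 (show 0 ≤ P + 1 by linarith)
      refine this.trans (le_of_eq ?_)
      field_simp
    have i4 : (ε * (P + 1)) ^ 2 ≤ (ρ / 2) ^ 2 := pow_le_pow_left₀ (by positivity) i3 2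
    have i5 : P * ε ^ 2 ≤ (ε * (P + 1)) ^ 2 := by
      have h1 : (ε * (P + 1)) ^ 2 = P * ε ^ 2 + (P ^ 2 + P + 1) * ε ^ 2 := by ring
      have h2 : 0 ≤ (P ^ 2 + P + 1) * ε ^ 2 := by positivity
      linarith
    have hs : 300000 * K ^ 2 * (exp (5040 * K ^ 2 * T) * (120000 * K ^ 2 * ε ^ 2)) ≤
        (ρ / 2) ^ 2 := by
      have h1 : 300000 * K ^ 2 * (exp (5040 * K ^ 2 * T) * (120000 * K ^ 2 * ε ^ 2)) = P * ε ^ 2 := by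
        rw [hP, hE]; ring
      rw [h1]; exact i5.trans i4
    have hδ' : ‖δ‖ ≤ 1 / 16 := by linarith
    obtain ⟨α, hα⟩ := D.init hδ' hρ hρ0 hεn hsq.symm hδ hGg (by linarith) rfl hs
    obtain ⟨σ, hσ, hPP⟩ := D.global hT hδ' hρ hρ0 (by positivity) hs hα
    refine ⟨σ, hσ, fun t ht => ?_⟩
    obtain ⟨-, -, -, -, -, -, hL⟩ := hPP t ht
    have habs : |t| ≤ T := abs_le.2 ⟨ht.1.le, ht.2.le⟩
    have hL2 : 500000 * K ^ 4 * (exp (5040 * K ^ 2 * |t|) * (120000 * K ^ 2 * ε ^ 2)) ≤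
        (sqrt R * ε) ^ 2 := by
      have h1 : (sqrt R * ε) ^ 2 =
          500000 * K ^ 4 * (exp (5040 * K ^ 2 * T) * (120000 * K ^ 2 * ε ^ 2)) := by
        rw [mul_pow, sq_sqrt hR0.le, hR, hE]; ring
      rw [h1]; gcongr
    have h1 := (sqrt_le_left (mul_nonneg hC1.le hεn)).2 (hL.trans hL2)
    have h4 : 0 ≤ sqrt (8 * π) / ε0 * ε := mul_nonneg hC2.le hεn
    rw [add_mul]
    linarith
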